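/- The R-linear map ι : A_q(n;r,s) → A_q(n, r+(n−1)s) admits an R-linear left inverse φ (i.e. φ∘ι = id on A_q(n;r,s)); in particular ι is a split injection of R-modules, and consequently the dual map ι* : Hom_R(A_q(n,r+(n−1)s), R) → Hom_R(A_q(n;r,s), R) is a split surjection of R-modules. -/

import Mathlib

open scoped BigOperators

/-- Free algebra on two families of generators `x_{ij}` and `x*_{ij}`. -/
abbrev FA2 (R : Type*) [CommRing R] (n : ℕ) :=
  FreeAlgebra R ((Fin n × Fin n) ⊕ (Fin n × Fin n))

/-- The generator `x_{ij}`. -/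
def Xg (R : Type*) [CommRing R] (n : ℕ) (i j : Fin n) : FA2 R n :=
  FreeAlgebra.ι R (Sum.inl (i, j))

/-- The generator `x*_{ij}`. -/
def Xs (R : Type*) [CommRing R] (n : ℕ) (i j : Fin n) : FA2 R n :=
  FreeAlgebra.ι R (Sum.inr (i, j))

/-- The monomial in the `x`-generators given by a list of index pairs. -/
def xW (R : Type*) [CommRing R] (n : ℕ) (l : List (Fin n × Fin n)) : FA2 R n :=
  (l.map fun p => Xg R n p.1 p.2).prod

/-- The monomial in the `x*`-generators given by a list of index pairs. -/
def xsW (R : Type*) [CommRing R] (n : ℕ) (l : List (Fin n × Fin n)) : FA2 R n :=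
  (l.map fun p => Xs R n p.1 p.2).prod

/-- The quantum-matrix relations among the `x`-generators (parameter `q`). -/
def XRel2 (R : Type*) [CommRing R] (q : Rˣ) (n : ℕ) (h : FA2 R n) : Prop :=
  (∃ i j k : Fin n, i < j ∧
    h = Xg R n i k * Xg R n j k - (q : R) • (Xg R n j k * Xg R n i k)) ∨
  (∃ k i j : Fin n, i < j ∧
    h = Xg R n k i * Xg R n k j - (q : R) • (Xg R n k j * Xg R n k i)) ∨
  (∃ i j k l : Fin n, i < k ∧ l < j ∧
    h = Xg R n i j * Xg R n k l - Xg R n k l * Xg R n i j) ∨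
  (∃ i j k l : Fin n, i < k ∧ j < l ∧
    h = Xg R n i j * Xg R n k l - Xg R n k l * Xg R n i j -
      ((q : R) - ((q⁻¹ : Rˣ) : R)) • (Xg R n i l * Xg R n k j))

/-- The quantum-matrix relations among the `x*`-generators (parameter `q⁻¹`). -/
def XsRel2 (R : Type*) [CommRing R] (q : Rˣ) (n : ℕ) (h : FA2 R n) : Prop :=
  (∃ i j k : Fin n, i < j ∧
    h = Xs R n i k * Xs R n j k - ((q⁻¹ : Rˣ) : R) • (Xs R n j k * Xs R n i k)) ∨
  (∃ k i j : Fin n, i < j ∧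
    h = Xs R n k i * Xs R n k j - ((q⁻¹ : Rˣ) : R) • (Xs R n k j * Xs R n k i)) ∨
  (∃ i j k l : Fin n, i < k ∧ l < j ∧
    h = Xs R n i j * Xs R n k l - Xs R n k l * Xs R n i j) ∨
  (∃ i j k l : Fin n, i < k ∧ j < l ∧
    h = Xs R n i j * Xs R n k l - Xs R n k l * Xs R n i j +
      ((q : R) - ((q⁻¹ : Rˣ) : R)) • (Xs R n i l * Xs R n k j))

/-- The generating set of the submodule `Y` of relations defining
`A_q(n;r,s)` inside `F(n,r) ⊗ F_*(n,s)` (monomials are written with all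
`x`-letters in front of all `x*`-letters). -/
def Ygen (R : Type*) [CommRing R] (q : Rˣ) (n : ℕ) (r s : ℕ) : Set (FA2 R n) :=
  {a | (∃ (u v w : List (Fin n × Fin n)) (h2 : FA2 R n),
          u.length + v.length + 2 = r ∧ w.length = s ∧ XRel2 R q n h2 ∧
          a = xW R n u * h2 * xW R n v * xsW R n w) ∨
       (∃ (u w1 w2 : List (Fin n × Fin n)) (h2 : FA2 R n),
          u.length = r ∧ w1.length + w2.length + 2 = s ∧ XsRel2 R q n h2 ∧
          a = xW R n u * xsW R n w1 * h2 * xsW R n w2) ∨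
       (∃ (i j : Fin n) (u v w1 w2 : List (Fin n × Fin n)),
          i ≠ j ∧ u.length + v.length + 1 = r ∧ w1.length + w2.length + 1 = s ∧
          a = ∑ k : Fin n,
            xW R n u * Xg R n i k * xW R n v * xsW R n w1 * Xs R n j k * xsW R n w2) ∨
       (∃ (i j : Fin n) (u v w1 w2 : List (Fin n × Fin n)),
          i ≠ j ∧ u.length + v.length + 1 = r ∧ w1.length + w2.length + 1 = s ∧
          a = ∑ k : Fin n, ((q ^ (2 * ((k : ℕ) + 1)) : Rˣ) : R) •
            (xW R n u * Xg R n k i * xW R n v * xsW R n w1 * Xs R n k j * xsW R n w2)) ∨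
       (∃ (i j : Fin n) (u v w1 w2 : List (Fin n × Fin n)),
          u.length + v.length + 1 = r ∧ w1.length + w2.length + 1 = s ∧
          a = (∑ k : Fin n, ((q ^ (2 * (k : ℤ) - 2 * (i : ℤ)) : Rˣ) : R) •
                (xW R n u * Xg R n k i * xW R n v * xsW R n w1 * Xs R n k i * xsW R n w2)) -
              ∑ k : Fin n,
                xW R n u * Xg R n j k * xW R n v * xsW R n w1 * Xs R n j k * xsW R n w2)}

/-- The submodule `Y` of relations defining `A_q(n;r,s)`. -/
def Ysub (R : Type*) [CommRing R] (q : Rˣ) (n : ℕ) (r s : ℕ) : Submodule R (FA2 R n) :=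
  Submodule.span R (Ygen R q n r s)

/-- The `R`-span `F(n,r) ⊗ F_*(n,s)` of the bidegree-`(r,s)` monomials
(`x`-letters first). -/
def Frs (R : Type*) [CommRing R] (n : ℕ) (r s : ℕ) : Submodule R (FA2 R n) :=
  Submodule.span R
    {a | ∃ u v : List (Fin n × Fin n), u.length = r ∧ v.length = s ∧
          a = xW R n u * xsW R n v}

/-- The element `𝔡et_q^{(k)}` of `A_q(n;k,k)` (here: its canonical
representative in the span of monomials), defined recursively by
`𝔡et_q^{(0)} = 1` and `𝔡et_q^{(k)} = Σ_l x_{1l}·𝔡et_q^{(k−1)}·x*_{1l}`. -/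
noncomputable def detMix (R : Type*) [CommRing R] (n : ℕ) [NeZero n] : ℕ → FA2 R n
  | 0 => 1
  | (k + 1) => ∑ l : Fin n, Xg R n 0 l * detMix R n k * Xs R n 0 l

/-- Number of inversions of a permutation of `Fin k` (its Coxeter length). -/
def invCount {k : ℕ} (w : Equiv.Perm (Fin k)) : ℕ :=
  ((Finset.univ : Finset (Fin k × Fin k)).filter
    (fun p => p.1 < p.2 ∧ w p.2 < w p.1)).card

/-- Ordered product of a tuple of elements in a (possibly noncommutative) monoid. -/
def oprod {A : Type*} [Monoid A] {k : ℕ} (g : Fin k → A) : A :=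
  (List.ofFn g).prod

/-- The increasing enumeration of `{1,…,n} \ {i}` (0-based). -/
def omitIdx {n : ℕ} (i : Fin n) (t : Fin (n - 1)) : Fin n :=
  if (t : ℕ) < (i : ℕ) then ⟨t, by have := t.2; omega⟩ else ⟨(t : ℕ) + 1, by have := t.2; omega⟩

/-- The sequence `i, f 0, f 1, …` of length `n` (prepending an entry to a
sequence of length `n-1`). -/
def consSeq {n : ℕ} (i : Fin n) (f : Fin (n - 1) → Fin n) : Fin n → Fin n :=
  fun t => if h : (t : ℕ) = 0 then i else f ⟨(t : ℕ) - 1, by have := t.2; omega⟩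

/-- The defining relations of the quantum matrix bialgebra `A_q(n)`. -/
inductive QMRel (R : Type*) [CommRing R] (q : Rˣ) (n : ℕ) :
    FreeAlgebra R (Fin n × Fin n) → FreeAlgebra R (Fin n × Fin n) → Prop
  | col {i j k : Fin n} (h : i < j) :
      QMRel R q n (FreeAlgebra.ι R (i, k) * FreeAlgebra.ι R (j, k))
        ((q : R) • (FreeAlgebra.ι R (j, k) * FreeAlgebra.ι R (i, k)))
  | row {k i j : Fin n} (h : i < j) :
      QMRel R q n (FreeAlgebra.ι R (k, i) * FreeAlgebra.ι R (k, j))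
        ((q : R) • (FreeAlgebra.ι R (k, j) * FreeAlgebra.ι R (k, i)))
  | comm {i j k l : Fin n} (h1 : i < k) (h2 : l < j) :
      QMRel R q n (FreeAlgebra.ι R (i, j) * FreeAlgebra.ι R (k, l))
        (FreeAlgebra.ι R (k, l) * FreeAlgebra.ι R (i, j))
  | qcomm {i j k l : Fin n} (h1 : i < k) (h2 : j < l) :
      QMRel R q n (FreeAlgebra.ι R (i, j) * FreeAlgebra.ι R (k, l))
        (FreeAlgebra.ι R (k, l) * FreeAlgebra.ι R (i, j) +
          ((q : R) - ((q⁻¹ : Rˣ) : R)) • (FreeAlgebra.ι R (i, l) * FreeAlgebra.ι R (k, j)))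

/-- The quantum matrix bialgebra `A_q(n)`. -/
abbrev AqAlg (R : Type*) [CommRing R] (q : Rˣ) (n : ℕ) := RingQuot (QMRel R q n)

/-- The generator `x_{ij}` of `A_q(n)`. -/
def xq (R : Type*) [CommRing R] (q : Rˣ) (n : ℕ) (i j : Fin n) : AqAlg R q n :=
  RingQuot.mkAlgHom R (QMRel R q n) (FreeAlgebra.ι R (i, j))

/-- The right quantum minor `(i_1 … i_k | j_1 … j_k)_r` for an increasing row
sequence and an arbitrary column sequence. -/
noncomputable def qMinorR (R : Type*) [CommRing R] (q : Rˣ) (n : ℕ) {k : ℕ}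
    (rows cols : Fin k → Fin n) : AqAlg R q n :=
  ∑ w : Equiv.Perm (Fin k),
    (((-q) ^ invCount w : Rˣ) : R) • oprod (fun t => xq R q n (rows (w t)) (cols t))

/-- The left quantum minor `(i_1 … i_k | j_1 … j_k)_l` for an arbitrary row
sequence and an increasing column sequence. -/
noncomputable def qMinorL (R : Type*) [CommRing R] (q : Rˣ) (n : ℕ) {k : ℕ}
    (rows cols : Fin k → Fin n) : AqAlg R q n :=
  ∑ w : Equiv.Perm (Fin k),
    (((-q) ^ invCount w : Rˣ) : R) • oprod (fun t => xq R q n (rows t) (cols (w t)))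

/-- The quantum determinant. -/
noncomputable def detq (R : Type*) [CommRing R] (q : Rˣ) (n : ℕ) : AqAlg R q n :=
  qMinorR R q n (fun t => t) (fun t => t)

/-- The complementary `(n-1) × (n-1)` quantum minor `(1…î…n | 1…ĵ…n)`. -/
noncomputable def compMinor (R : Type*) [CommRing R] (q : Rˣ) (n : ℕ) (i j : Fin n) :
    AqAlg R q n :=
  qMinorR R q n (omitIdx i) (omitIdx j)

/-- The algebra homomorphism `ι̂` from the free algebra on the `x`- and
`x*`-generators to `A_q(n)`, determined by `x_{ij} ↦ x_{ij}` and
`x*_{ij} ↦ (−q)^{j−i}·(1…î…n | 1…ĵ…n)`. -/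
noncomputable def iotaHat (R : Type*) [CommRing R] (q : Rˣ) (n : ℕ) :
    FA2 R n →ₐ[R] AqAlg R q n :=
  FreeAlgebra.lift R fun g =>
    match g with
    | Sum.inl (i, j) => xq R q n i j
    | Sum.inr (i, j) => (((-q) ^ ((j : ℤ) - (i : ℤ)) : Rˣ) : R) • compMinor R q n i j

/-- The homogeneous component `A_q(n,m)`: the `R`-span in `A_q(n)` of the
degree-`m` monomials. -/
noncomputable def AqDeg (R : Type*) [CommRing R] (q : Rˣ) (n : ℕ) (m : ℕ) :
    Submodule R (AqAlg R q n) :=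
  Submodule.span R
    {a | ∃ g : List (Fin n × Fin n), g.length = m ∧ a = (g.map fun p => xq R q n p.1 p.2).prod}

/-- The mixed quantum coordinate space `A_q(n;r,s) = (F(n,r) ⊗ F_*(n,s))/Y`. -/
abbrev AqMixed (R : Type*) [CommRing R] (q : Rˣ) (n r s : ℕ) :=
  ↥(Frs R n r s) ⧸ (Ysub R q n r s).comap (Frs R n r s).subtype

namespace QM
open Finset
local notation:max "𝔽" n:max => Finset (Fin n)
local notation:max "𝕄" n:max => Matrix (Fin n) (Fin n)
local notation:max "𝕃" n:max => List (Fin n × Fin n)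
local notation:max "𝕟" q:max R:max => -(Units.val q : R)
section one
variable {R : Type*} [CommRing R] {n : ℕ} {B : Type*} [Ring B] [Algebra R B]

def cl (A : 𝔽 n) (i : Fin n) : ℕ := ∑ b ∈ A, if b < i then 1 else 0

def ninv (A C : 𝔽 n) : ℕ := ∑ a ∈ A, cl C a

def Dm (s : R) (X : 𝕄 n B) : 𝔽 n → List (Fin n) → B
  | I, [] => if I = ∅ then 1 else 0
  | I, (j :: J) => ∑ i ∈ I, s ^ cl I i • (X i j * Dm s X (I.erase i) J)

def minor (s : R) (X : 𝕄 n B) (I J : 𝔽 n) : B :=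
  Dm s X I (J.sort (· ≤ ·))

theorem cl_erase (A : 𝔽 n) (i a : Fin n) (h : i ∈ A) :
    cl A a = cl (A.erase i) a + if i < a then 1 else 0 := by
  unfold cl; rw [sum_erase_add _ _ h]

theorem cl_insert (A : 𝔽 n) (i a : Fin n) (h : i ∉ A) :
    cl (insert i A) a = cl A a + if i < a then 1 else 0 := by
  unfold cl; rw [sum_insert h, add_comm]

theorem cl_union (A C : 𝔽 n) (a : Fin n) (h : Disjoint A C) :
    cl (A ∪ C) a = cl A a + cl C a := by
  unfold cl; rw [sum_union h]

theorem cl_self_erase (A : 𝔽 n) (i : Fin n) : cl (A.erase i) i = cl A i := by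
  by_cases h : i ∈ A
  · rw [cl_erase A i i h]; simp
  · rw [erase_eq_of_notMem h]

@[simp] theorem cl_empty (a : Fin n) : cl ∅ a = 0 := by simp [cl]
@[simp] theorem ninv_empty_left (A : 𝔽 n) : ninv ∅ A = 0 := by simp [ninv]
@[simp] theorem ninv_empty_right (A : 𝔽 n) : ninv A ∅ = 0 := by simp [ninv]

theorem ninv_insert_left (A C : 𝔽 n) (i : Fin n) (h : i ∉ A) :
    ninv (insert i A) C = cl C i + ninv A C := by
  unfold ninv; rw [sum_insert h]

theorem ninv_union_left (A A' C : 𝔽 n) (h : Disjoint A A') :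
    ninv (A ∪ A') C = ninv A C + ninv A' C := by
  unfold ninv; rw [sum_union h]

theorem ninv_union_right (A C C' : 𝔽 n) (h : Disjoint C C') :
    ninv A (C ∪ C') = ninv A C + ninv A C' := by
  unfold ninv; rw [← sum_add_distrib]
  exact sum_congr rfl fun a _ => cl_union _ _ _ h

theorem ninv_singleton_left (C : 𝔽 n) (i : Fin n) : ninv {i} C = cl C i := by
  simp [ninv]

theorem Dm_card (s : R) (X : 𝕄 n B) (L : List (Fin n)) :
    ∀ I : 𝔽 n, I.card ≠ L.length → Dm s X I L = 0 := by
  induction L with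
  | nil => intro I h; rw [Dm, if_neg]; rintro rfl; simp at h
  | cons j L ih =>
    intro I h
    rw [Dm]
    refine sum_eq_zero fun i hi => ?_
    rw [ih, mul_zero, smul_zero]
    rw [card_erase_of_mem hi]
    simp at h
    have := card_pos.2 ⟨i, hi⟩
    omega

theorem minor_card (s : R) (X : 𝕄 n B) (I J : 𝔽 n)
    (h : I.card ≠ J.card) : minor s X I J = 0 := Dm_card s X _ I (by simpa using h)

@[simp] theorem minor_empty (s : R) (X : 𝕄 n B) :
    minor s X ∅ ∅ = 1 := by simp [minor, Dm]

theorem Dm_append (s : R) (X : 𝕄 n B) (J1 J2 : List (Fin n)) :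
    ∀ I : 𝔽 n, Dm s X I (J1 ++ J2) =
      ∑ I1 ∈ I.powerset, s ^ ninv I1 (I \ I1) • (Dm s X I1 J1 * Dm s X (I \ I1) J2) := by
  induction J1 with
  | nil =>
    intro I
    rw [sum_eq_single_of_mem ∅ (by simp)]
    · simp [Dm]
    · intro b _ hb; simp [Dm, hb]
  | cons j J1 ih =>
    intro I
    rw [List.cons_append, Dm]
    simp_rw [ih, Dm, mul_sum, sum_mul, smul_sum]
    rw [sum_sigma', sum_sigma']
    refine sum_bij' (fun p _ => ⟨insert p.1 p.2, p.1⟩) (fun p _ => ⟨p.2, p.1.erase p.2⟩) ?_ ?_ ?_ ?_ ?_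
    · rintro ⟨i, I1⟩ h
      simp only [mem_sigma, mem_powerset] at h ⊢
      exact ⟨insert_subset h.1 (h.2.trans (erase_subset _ _)), mem_insert_self _ _⟩
    · rintro ⟨I1, i⟩ h
      simp only [mem_sigma, mem_powerset] at h ⊢
      exact ⟨h.1 h.2, erase_subset_erase _ h.1⟩
    · rintro ⟨i, I1⟩ h
      simp only [mem_sigma, mem_powerset] at h
      have : i ∉ I1 := fun h' => by simpa using h.2 h'
      simp [erase_insert this]
    · rintro ⟨I1, i⟩ h
      simp only [mem_sigma, mem_powerset] at h
      simp [insert_erase h.2]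
    · rintro ⟨i, I1⟩ h
      simp only [mem_sigma, mem_powerset] at h
      have hi : i ∉ I1 := fun h' => by simpa using h.2 h'
      have e1 : I.erase i \ I1 = I \ insert i I1 := by
        ext a; simp only [mem_sdiff, mem_erase, mem_insert]; tauto
      simp only [erase_insert hi, ← e1]
      rw [mul_smul_comm, smul_smul, smul_mul_assoc, smul_smul, ← mul_assoc, ← pow_add, ← pow_add]
      congr 2
      rw [ninv_insert_left _ _ _ hi, ← cl_self_erase (insert i I1), erase_insert hi]
      have : cl I i = cl I1 i + cl (I.erase i \ I1) i := by
        rw [← cl_union _ _ _ disjoint_sdiff, union_sdiff_of_subset h.2, cl_self_erase]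
      omega

end one
section two
variable {R : Type*} [CommRing R] {n : ℕ} {B : Type*} [Ring B] [Algebra R B]

structure IsQM (q : Rˣ) (X : 𝕄 n B) : Prop where
  col : ∀ i j k, i < j → X i k * X j k = (q : R) • (X j k * X i k)
  row : ∀ k i j, i < j → X k i * X k j = (q : R) • (X k j * X k i)
  comm : ∀ i j k l, i < k → l < j → X i j * X k l = X k l * X i j
  qcomm : ∀ i j k l, i < k → j < l → X i j * X k l = X k l * X i j +
    ((q : R) - ((q⁻¹ : Rˣ) : R)) • (X i l * X k j)

theorem IsQM.transpose {q : Rˣ} {X : 𝕄 n B} (h : IsQM q X) :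
    IsQM q X.transpose where
  col i j k hij := h.row k i j hij
  row k i j hij := h.col i j k hij
  comm i j k l hik hlj := (h.comm l k j i hlj hik).symm
  qcomm i j k l hik hjl := by
    have := h.qcomm j i l k hjl hik
    simp only [Matrix.transpose_apply]
    rw [this, h.comm j k l i hjl hik]

theorem Dm_pair (s : R) (X : 𝕄 n B) (a b j k : Fin n) (h : a < b) :
    Dm s X {a, b} [j, k] = X a j * X b k + s • (X b j * X a k) := by
  have e1 : ({a, b} : 𝔽 n).erase a = {b} := by
    ext x; simp only [mem_erase, mem_insert, mem_singleton]; grind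
  have e2 : ({a, b} : 𝔽 n).erase b = {a} := by
    ext x; simp only [mem_erase, mem_insert, mem_singleton]; grind
  rw [Dm, sum_pair h.ne, e1, e2]
  have h1 : cl {a, b} a = 0 := by simp [cl, h.le]
  have h2 : cl {a, b} b = 1 := by
    unfold cl; rw [sum_pair h.ne]; simp [h]
  have h3 : ∀ c : Fin n, cl {c} c = 0 := fun c => by simp [cl]
  rw [h1, h2]
  simp [Dm, h3]

theorem exists_pair (I : 𝔽 n) (h : I.card = 2) : ∃ a b, a < b ∧ I = {a, b} := by
  obtain ⟨a, b, hab, rfl⟩ := card_eq_two.1 h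
  rcases lt_or_gt_of_ne hab with h | h
  · exact ⟨a, b, h, rfl⟩
  · exact ⟨b, a, h, pair_comm _ _⟩

variable {q : Rˣ} {X : 𝕄 n B}

theorem Dm_rep (hX : IsQM q X) (j : Fin n) (L : List (Fin n)) (I : 𝔽 n) :
    Dm (𝕟 q R) X I (j :: j :: L) = 0 := by
  rw [show j :: j :: L = [j, j] ++ L from rfl, Dm_append]
  refine sum_eq_zero fun I1 _ => ?_
  have : Dm (𝕟 q R) X I1 [j, j] = 0 := by
    by_cases h : I1.card = 2
    · obtain ⟨a, b, hab, rfl⟩ := exists_pair I1 h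
      rw [Dm_pair _ _ _ _ _ _ hab, hX.col a b j hab]
      module
    · exact Dm_card _ _ _ _ (by simpa using h)
  rw [this, zero_mul, smul_zero]

theorem Dm_swap (hX : IsQM q X) (j k : Fin n) (hjk : k < j) (L : List (Fin n))
    (I : 𝔽 n) :
    Dm (𝕟 q R) X I (j :: k :: L) = (𝕟 q R) • Dm (𝕟 q R) X I (k :: j :: L) := by
  rw [show j :: k :: L = [j, k] ++ L from rfl, show k :: j :: L = [k, j] ++ L from rfl,
    Dm_append, Dm_append, smul_sum]
  refine sum_congr rfl fun I1 _ => ?_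
  have : Dm (𝕟 q R) X I1 [j, k] = (𝕟 q R) • Dm (𝕟 q R) X I1 [k, j] := by
    by_cases h : I1.card = 2
    · obtain ⟨a, b, hab, rfl⟩ := exists_pair I1 h
      rw [Dm_pair _ _ _ _ _ _ hab, Dm_pair _ _ _ _ _ _ hab, hX.qcomm a k b j hab hjk,
        ← hX.comm a j b k hab hjk]
      have e : (q : R) * ((q⁻¹ : Rˣ) : R) = 1 := q.mul_inv
      have : (-(q:R)) • (((q : R) - ((q⁻¹ : Rˣ) : R)) • (X a j * X b k)) =
        (1 - (q : R)*q) • (X a j * X b k) := by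
        rw [smul_smul]; congr 1; linear_combination e
      rw [smul_add, smul_add, this]
      module
    · rw [Dm_card _ _ _ _ (by simpa using h), Dm_card _ _ _ _ (by simpa using h), smul_zero]
  rw [this, smul_mul_assoc, smul_comm]

theorem sort_min_cons (K : 𝔽 n) (a : Fin n) (h : ∀ b ∈ K, a < b) :
    (insert a K).sort (· ≤ ·) = a :: K.sort (· ≤ ·) := by
  have : a ∉ K := fun h' => lt_irrefl _ (h a h')
  rw [← sort_cons (· ≤ ·) (fun b hb => (h b hb).le) this, cons_eq_insert]

theorem exists_min_split (K : 𝔽 n) (m : ℕ) (hK : K.card = m + 1) :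
    ∃ a K', (∀ b ∈ K', a < b) ∧ insert a K' = K ∧ K'.card = m := by
  have h : K.Nonempty := card_pos.1 (by omega)
  refine ⟨K.min' h, K.erase (K.min' h), ?_, ?_, ?_⟩
  · intro b hb; exact Finset.min'_lt_of_mem_erase_min' _ _ hb
  · exact insert_erase (Finset.min'_mem _ _)
  · rw [card_erase_of_mem (Finset.min'_mem _ _), hK]; rfl

theorem Dm_insert (hX : IsQM q X) (k : Fin n) : ∀ (m : ℕ) (K : 𝔽 n), K.card = m →
    ∀ I : 𝔽 n, Dm (𝕟 q R) X I (k :: K.sort (· ≤ ·)) =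
      if k ∈ K then 0 else (𝕟 q R) ^ cl K k • minor (𝕟 q R) X I (insert k K) := by
  intro m
  induction m with
  | zero =>
    intro K hK I
    rw [card_eq_zero] at hK
    subst hK
    simp [minor]
  | succ m ih =>
    intro K hK I
    obtain ⟨a, K', haK, rfl, hK'⟩ := exists_min_split K m hK
    have haK' : a ∉ K' := fun h' => lt_irrefl _ (haK a h')
    rw [sort_min_cons _ _ haK]
    rcases lt_trichotomy k a with hka | hka | hka
    · have h1 : k ∉ insert a K' := by
        simp only [mem_insert, not_or]
        exact ⟨hka.ne, fun h => lt_asymm hka (haK _ h)⟩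
      have h2 : ∀ b ∈ insert a K', k < b := by
        intro b hb; rcases mem_insert.1 hb with rfl | hb
        · exact hka
        · exact hka.trans (haK _ hb)
      have h3 : cl (insert a K') k = 0 := by
        unfold cl; exact sum_eq_zero fun b hb => if_neg (h2 b hb).not_gt
      rw [if_neg h1, h3, minor, sort_min_cons _ _ h2, sort_min_cons _ _ haK, pow_zero, one_smul]
    · subst hka
      rw [Dm_rep hX, if_pos (mem_insert_self _ _)]
    · rw [Dm_swap hX _ _ hka, Dm]
      simp_rw [ih K' hK']
      have hak : a ≠ k := hka.ne
      by_cases hk : k ∈ K'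
      · simp [hk]
      · have hk' : k ∉ insert a K' := by simp [hk, hka.ne']
        simp only [if_neg hk, if_neg hk']
        have h2 : ∀ b ∈ insert k K', a < b := by
          intro b hb; rcases mem_insert.1 hb with rfl | hb
          · exact hka
          · exact haK _ hb
        rw [minor, insert_comm, sort_min_cons _ _ h2, Dm, smul_sum, smul_sum]
        refine sum_congr rfl fun i _ => ?_
        rw [cl_insert _ _ _ haK', if_pos hka, minor, mul_smul_comm, pow_succ]
        module

theorem Dm_merge (hX : IsQM q X) (J2 : 𝔽 n) : ∀ (m : ℕ) (J1 : 𝔽 n),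
    J1.card = m →
    ∀ I : 𝔽 n, Dm (𝕟 q R) X I (J1.sort (· ≤ ·) ++ J2.sort (· ≤ ·)) =
      if Disjoint J1 J2 then (𝕟 q R) ^ ninv J1 J2 • minor (𝕟 q R) X I (J1 ∪ J2) else 0 := by
  intro m
  induction m with
  | zero =>
    intro K hK I
    rw [card_eq_zero] at hK
    subst hK
    simp [minor]
  | succ m ih =>
    intro K hK I
    obtain ⟨a, K', haK, rfl, hK'⟩ := exists_min_split K m hK
    have haK' : a ∉ K' := fun h' => lt_irrefl _ (haK a h')
    rw [sort_min_cons _ _ haK, List.cons_append, Dm]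
    simp_rw [ih K' hK']
    by_cases hd : Disjoint K' J2
    · simp only [if_pos hd]
      have : ∑ i ∈ I, (𝕟 q R) ^ cl I i • (X i a * (𝕟 q R) ^ ninv K' J2 •
          minor (𝕟 q R) X (I.erase i) (K' ∪ J2)) = (𝕟 q R) ^ ninv K' J2 •
          Dm (𝕟 q R) X I (a :: (K' ∪ J2).sort (· ≤ ·)) := by
        rw [Dm, smul_sum]
        refine sum_congr rfl fun i _ => ?_
        rw [minor, mul_smul_comm, smul_comm]
      rw [this, Dm_insert hX a _ _ rfl]
      have hiff : Disjoint (insert a K') J2 ↔ a ∉ K' ∪ J2 := by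
        rw [disjoint_insert_left, mem_union]; tauto
      by_cases ha' : a ∈ K' ∪ J2
      · rw [if_pos ha', if_neg (by tauto), smul_zero]
      · rw [if_neg ha', if_pos (by tauto), smul_smul, ← pow_add, ninv_insert_left _ _ _ haK',
          insert_union, cl_union _ _ _ hd]
        have : cl K' a = 0 := by
          unfold cl; exact sum_eq_zero fun b hb => if_neg (haK b hb).not_gt
        rw [this, zero_add, add_comm]
    · rw [if_neg (by rw [disjoint_insert_left]; tauto)]
      simp [hd]

theorem lapCol (hX : IsQM q X) (I J1 J2 : 𝔽 n) :
    ∑ I1 ∈ I.powerset, (𝕟 q R) ^ ninv I1 (I \ I1) •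
      (minor (𝕟 q R) X I1 J1 * minor (𝕟 q R) X (I \ I1) J2) =
      if Disjoint J1 J2 then (𝕟 q R) ^ ninv J1 J2 • minor (𝕟 q R) X I (J1 ∪ J2) else 0 := by
  rw [← Dm_merge hX J2 _ J1 rfl, Dm_append]; rfl

end two
section three
variable {R : Type*} [CommRing R] {n : ℕ} {B : Type*} [Ring B] [Algebra R B]
variable {q : Rˣ} {X : 𝕄 n B}

theorem minor_insert (s : R) (X : 𝕄 n B) (I J' : 𝔽 n) (j : Fin n)
    (h : ∀ b ∈ J', j < b) : minor s X I (insert j J') =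
      ∑ i ∈ I, s ^ cl I i • (X i j * minor s X (I.erase i) J') := by
  rw [minor, sort_min_cons _ _ h, Dm]; rfl

theorem cl_eq_zero (I : 𝔽 n) (i : Fin n) (h : ∀ b ∈ I, i ≤ b) : cl I i = 0 := by
  unfold cl; exact sum_eq_zero fun b hb => if_neg (h b hb).not_gt

theorem minor_corner (s : R) (X : 𝕄 n B) (m : ℕ)
    (ih : ∀ I J : 𝔽 n, I.card ≤ m → minor s X I J = minor s X.transpose J I)
    (i0 j0 : Fin n) (I' J' : 𝔽 n) (hI : ∀ b ∈ I', i0 < b) (hJ : ∀ b ∈ J', j0 < b)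
    (hm : I'.card = m) :
    minor s X (insert i0 I') (insert j0 J') = X i0 j0 * minor s X I' J' +
      ∑ i ∈ I', ∑ j ∈ J', s ^ (cl I' i + 1 + cl J' j) •
        (X i j0 * X i0 j * minor s X (I'.erase i) (J'.erase j)) := by
  have hi0 : i0 ∉ I' := fun h => lt_irrefl _ (hI _ h)
  rw [minor_insert _ _ _ _ _ hJ, sum_insert hi0, erase_insert hi0]
  congr 1
  · rw [cl_eq_zero, pow_zero, one_smul]
    intro b hb; rcases mem_insert.1 hb with rfl | hb
    · exact le_rfl
    · exact (hI _ hb).le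
  · refine sum_congr rfl fun i hi => ?_
    have hii : i0 ≠ i := (hI i hi).ne
    have e : (insert i0 I').erase i = insert i0 (I'.erase i) := erase_insert_of_ne hii
    have hc : (I'.erase i).card + 1 = m := by rw [card_erase_add_one hi, hm]
    have hi0' : i0 ∉ I'.erase i := fun h => hi0 (mem_of_mem_erase h)
    rw [ih _ _ (by rw [e, card_insert_of_notMem hi0', hc]), e,
      minor_insert _ _ _ _ _ (fun b hb => hI b (mem_of_mem_erase hb)),
      mul_sum, smul_sum]
    refine sum_congr rfl fun j hj => ?_
    rw [← ih _ _ (by omega), cl_insert _ _ _ hi0, if_pos (hI i hi), mul_smul_comm, smul_smul,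
      ← pow_add, Matrix.transpose_apply, mul_assoc]

theorem minor_transpose (hX : IsQM q X) (I J : 𝔽 n) :
    minor (𝕟 q R) X I J = minor (𝕟 q R) X.transpose J I := by
  suffices H : ∀ (m : ℕ) (I J : 𝔽 n), I.card ≤ m →
    minor (𝕟 q R) X I J = minor (𝕟 q R) X.transpose J I from H _ I J le_rfl
  intro m
  induction m with
  | zero =>
    intro I J h
    have : I = ∅ := card_eq_zero.1 (by omega)
    subst this
    by_cases hJ : J = ∅
    · subst hJ; simp
    · have : J.card ≠ 0 := fun h => hJ (card_eq_zero.1 h)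
      rw [minor_card _ _ _ _ (by simpa using this.symm), minor_card _ _ _ _ (by simpa using this)]
  | succ m ih =>
    intro I J h
    by_cases hc : I.card ≤ m
    · exact ih I J hc
    have hI : I.card = m + 1 := by omega
    by_cases hJ : J.card = m + 1
    swap
    · rw [minor_card _ _ _ _ (by omega), minor_card _ _ _ _ (by omega)]
    obtain ⟨i0, I', hi0, rfl, hI'⟩ := exists_min_split I m hI
    obtain ⟨j0, J', hj0, rfl, hJ'⟩ := exists_min_split J m hJ
    rw [minor_corner _ X m ih i0 j0 I' J' hi0 hj0 hI', minor_corner _ X.transpose m ?_ j0 i0 J' I' hj0 hi0 hJ']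
    · congr 1
      · rw [ih _ _ hI'.le, Matrix.transpose_apply]
      · rw [sum_comm]
        refine sum_congr rfl fun j hj => sum_congr rfl fun i hi => ?_
        rw [ih (I'.erase i) _ (by rw [card_erase_of_mem hi]; omega), Matrix.transpose_apply, Matrix.transpose_apply,
          hX.comm i0 j i j0 (hi0 _ hi) (hj0 _ hj)]
        congr 2; omega
    · intro A C hA
      rw [Matrix.transpose_transpose]
      by_cases hAC : C.card ≤ m
      · exact (ih C A hAC).symm
      · rw [minor_card _ _ _ _ (by omega), minor_card _ _ _ _ (by omega)]

theorem lapRow (hX : IsQM q X) (J I1 I2 : 𝔽 n) :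
    ∑ J1 ∈ J.powerset, (𝕟 q R) ^ ninv J1 (J \ J1) •
      (minor (𝕟 q R) X I1 J1 * minor (𝕟 q R) X I2 (J \ J1)) =
      if Disjoint I1 I2 then (𝕟 q R) ^ ninv I1 I2 • minor (𝕟 q R) X (I1 ∪ I2) J else 0 := by
  simp_rw [minor_transpose hX]
  exact lapCol hX.transpose J I1 I2

theorem Dm_commute (s : R) (X : 𝕄 n B) (b : B) (h : ∀ i j, Commute b (X i j))
    (L : List (Fin n)) : ∀ I, Commute b (Dm s X I L) := by
  induction L with
  | nil => intro I; rw [Dm]; split_ifs; exacts [Commute.one_right _, Commute.zero_right _]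
  | cons j L ih =>
    intro I; rw [Dm]
    exact Commute.sum_right _ _ _ fun i _ => ((h i j).mul_right (ih _)).smul_right _

theorem minor_commute (s : R) (X Y : 𝕄 n B)
    (h : ∀ i j k l, Commute (X i j) (Y k l)) (I J I' J' : 𝔽 n) :
    Commute (minor s X I J) (minor s Y I' J') := by
  refine Dm_commute _ _ _ (fun i j => ?_) _ _
  exact (Dm_commute _ _ _ (fun k l => (h k l i j).symm) _ _).symm

theorem Dm_mul (hX : IsQM q X) (Y : 𝕄 n B)
    (h : ∀ i j k l, Commute (X i j) (Y k l)) (L : List (Fin n)) : ∀ I,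
    Dm (𝕟 q R) (X * Y) I L = ∑ K, minor (𝕟 q R) X I K * Dm (𝕟 q R) Y K L := by
  induction L with
  | nil =>
    intro I
    rw [sum_eq_single_of_mem ∅ (mem_univ _)]
    · simp [Dm, minor]
    · intro K _ hK; simp [Dm, hK]
  | cons j L ih =>
    intro I
    have e1 : Dm (𝕟 q R) (X * Y) I (j :: L) = ∑ k, ∑ K,
        (∑ i ∈ I, (𝕟 q R) ^ cl I i • (X i k * minor (𝕟 q R) X (I.erase i) K)) *
          (Y k j * Dm (𝕟 q R) Y K L) := by
      rw [Dm]
      simp_rw [ih, Matrix.mul_apply, sum_mul, mul_sum, smul_sum]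
      rw [sum_comm]
      refine sum_congr rfl fun k _ => ?_
      rw [sum_comm]
      refine sum_congr rfl fun K _ => sum_congr rfl fun i _ => ?_
      rw [smul_mul_assoc]
      congr 1
      have : Y k j * minor (𝕟 q R) X (I.erase i) K = minor (𝕟 q R) X (I.erase i) K * Y k j :=
        Dm_commute _ _ _ (fun a b => (h a b k j).symm) _ _
      simp only [mul_assoc]
      rw [← mul_assoc (Y k j), this]
      simp only [mul_assoc]
    rw [e1]
    have e2 : ∀ k K, (∑ i ∈ I, (𝕟 q R) ^ cl I i • (X i k * minor (𝕟 q R) X (I.erase i) K)) =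
      if k ∈ K then 0 else (𝕟 q R) ^ cl K k • minor (𝕟 q R) X I (insert k K) := by
      intro k K
      rw [← Dm_insert hX k _ K rfl, Dm]; rfl
    simp_rw [e2, Dm, mul_sum]
    rw [sum_sigma', sum_sigma',
      ← sum_filter_add_sum_filter_not _ (fun p : (_ : Fin n) × 𝔽 n => p.1 ∈ p.2)]
    rw [sum_eq_zero, zero_add]
    swap
    · rintro ⟨k, K⟩ hp
      simp only [mem_filter] at hp
      rw [if_pos hp.2, zero_mul]
    refine sum_bij' (fun p _ => ⟨insert p.1 p.2, p.1⟩) (fun p _ => ⟨p.2, p.1.erase p.2⟩)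
      ?_ ?_ ?_ ?_ ?_
    · rintro ⟨k, K⟩ hp; simp
    · rintro ⟨K, k⟩ hp; simp
    · rintro ⟨k, K⟩ hp
      simp at hp; simp [hp]
    · rintro ⟨K, k⟩ hp
      simp at hp; simp [hp]
    · rintro ⟨k, K⟩ hp
      simp only [mem_filter, mem_sigma, mem_univ, true_and] at hp
      simp only [if_neg hp, erase_insert hp]
      rw [smul_mul_assoc, mul_smul_comm]
      congr 2
      rw [← cl_self_erase (insert k K), erase_insert hp]

theorem minor_mul (hX : IsQM q X) (Y : 𝕄 n B)
    (h : ∀ i j k l, Commute (X i j) (Y k l)) (I J : 𝔽 n) :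
    minor (𝕟 q R) (X * Y) I J = ∑ K, minor (𝕟 q R) X I K * minor (𝕟 q R) Y K J :=
  Dm_mul hX Y h _ I

theorem sum2_zero {M : Type*} [AddCommGroup M] (G : Fin n → Fin n → M)
    (h0 : ∀ a, G a a = 0) (h : ∀ a b, a < b → G a b + G b a = 0) : ∑ a, ∑ b, G a b = 0 := by
  rw [sum_sigma']
  refine sum_involution (fun p _ => ⟨p.2, p.1⟩) ?_ ?_ ?_ ?_
  · rintro ⟨a, b⟩ -
    rcases lt_trichotomy a b with hab | hab | hab
    · exact h a b hab
    · subst hab; simp [h0]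
    · rw [add_comm]; exact h b a hab
  · rintro ⟨a, b⟩ - hne heq
    simp only [Sigma.mk.injEq] at heq
    obtain ⟨rfl, -⟩ := heq
    exact hne (h0 _)
  · intro _ _; simp
  · intro _ _; rfl

theorem mul_mul_expand (X Y : 𝕄 n B)
    (h : ∀ i j k l, Commute (X i j) (Y k l)) (i j k l : Fin n) :
    (X * Y) i k * (X * Y) j l = ∑ a, ∑ b, (X i a * X j b) * (Y a k * Y b l) := by
  simp_rw [Matrix.mul_apply, sum_mul, mul_sum]
  refine sum_congr rfl fun a _ => sum_congr rfl fun b _ => ?_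
  have := (h j b a k).eq
  simp only [mul_assoc]
  rw [← mul_assoc (Y a k), ← this, mul_assoc]

theorem mul_mul_expand' (X Y : 𝕄 n B)
    (h : ∀ i j k l, Commute (X i j) (Y k l)) (i j k l : Fin n) :
    (X * Y) i k * (X * Y) j l = ∑ a, ∑ b, (X i b * X j a) * (Y b k * Y a l) := by
  rw [mul_mul_expand X Y h, sum_comm]

theorem IsQM.mul_row (hX : IsQM q X) {Y : 𝕄 n B} (hY : IsQM q Y)
    (h : ∀ i j k l, Commute (X i j) (Y k l)) (k i j : Fin n) (hij : i < j) :
    (X * Y) k i * (X * Y) k j = (q : R) • ((X * Y) k j * (X * Y) k i) := by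
  have e : (q : R) * ((q⁻¹ : Rˣ) : R) = 1 := q.mul_inv
  rw [mul_mul_expand X Y h, mul_mul_expand' X Y h, ← sub_eq_zero, smul_sum]
  simp_rw [smul_sum, ← sum_sub_distrib]
  apply sum2_zero
  · intro a
    rw [hY.row a i j hij, mul_smul_comm, sub_self]
  · intro a b hab
    rw [hX.row k a b hab, hY.qcomm a i b j hab hij, hY.comm a j b i hab hij]
    simp only [mul_add, mul_smul_comm, smul_mul_assoc, smul_add]
    match_scalars
    · ring
    · linear_combination (-1 : R) * e

theorem IsQM.mul (hX : IsQM q X) {Y : 𝕄 n B} (hY : IsQM q Y)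
    (h : ∀ i j k l, Commute (X i j) (Y k l)) : IsQM q (X * Y) := by
  have e : (q : R) * ((q⁻¹ : Rˣ) : R) = 1 := q.mul_inv
  have ht : (X * Y).transpose = Y.transpose * X.transpose := by
    ext i j; simp only [Matrix.mul_apply, Matrix.transpose_apply]
    exact sum_congr rfl fun k _ => h _ _ _ _
  refine ⟨fun i j k hij => ?_, fun k i j hij => hX.mul_row hY h k i j hij, ?_, ?_⟩
  · have := hY.transpose.mul_row hX.transpose (fun a b c d => (h d c b a).symm) k i j hij
    rw [← ht] at this
    exact this
  · intro i k j l hij hlk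
    rw [mul_mul_expand X Y h, mul_mul_expand' X Y h, ← sub_eq_zero]
    simp_rw [← sum_sub_distrib]
    apply sum2_zero
    · intro a
      rw [hX.col i j a hij, hY.row a l k hlk]
      simp only [mul_smul_comm, smul_mul_assoc, sub_self]
    · intro a b hab
      rw [hX.qcomm i a j b hij hab, hY.comm a k b l hab hlk, hX.comm i b j a hij hab, hY.qcomm a l b k hab hlk]
      simp only [mul_add, add_mul, mul_smul_comm, smul_mul_assoc, smul_add]
      rw [hY.comm a k b l hab hlk]
      module
  · intro i k j l hij hkl
    rw [mul_mul_expand X Y h, mul_mul_expand' X Y h, mul_mul_expand X Y h, ← sub_eq_zero]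
    simp_rw [smul_sum, ← sum_add_distrib, ← sum_sub_distrib]
    apply sum2_zero
    · intro a
      rw [hX.col i j a hij, hY.row a k l hkl]
      simp only [mul_smul_comm, smul_mul_assoc, smul_smul]
      match_scalars
      linear_combination e
    · intro a b hab
      rw [hX.qcomm i a j b hij hab, hX.comm i b j a hij hab, hY.comm a l b k hab hkl, hY.qcomm a k b l hab hkl,
        hY.comm a l b k hab hkl]
      simp only [mul_add, add_mul, mul_smul_comm, smul_mul_assoc, smul_add]
      module

end three
section four
variable {R : Type*} [CommRing R] {n : ℕ} {M : Type*} [AddCommGroup M] [Module R M]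

structure Coef (c : 𝔽 n → 𝔽 n → 𝔽 n → Rˣ) : Prop where
  ca : ∀ (t : Fin n) (K L : 𝔽 n) (k : ℕ), (∀ a ∈ K, a < t) → (∀ a ∈ L, a < t) →
    ∃ ρ : Rˣ, ∀ H ⊆ K \ L, H.card = k → c (insert t K) L H = ρ * c K L H
  cb : ∀ (t : Fin n) (K L : 𝔽 n) (k : ℕ), (∀ a ∈ K, a < t) → (∀ a ∈ L, a < t) →
    ∃ ρ : Rˣ, ∀ H ⊆ K \ L, H.card = k → c (insert t K) L (insert t H) = ρ * c K L H
  cc : ∀ (t : Fin n) (K L : 𝔽 n) (k : ℕ), (∀ a ∈ K, a < t) → (∀ a ∈ L, a < t) →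
    ∃ ρ : Rˣ, ∀ H ⊆ K \ L, H.card = k → c K (insert t L) H = ρ * c K L H
  cd : ∀ (t : Fin n) (K L : 𝔽 n) (k : ℕ), (∀ a ∈ K, a < t) → (∀ a ∈ L, a < t) →
    ∃ ρ : Rˣ, ∀ H ⊆ K \ L, H.card = k → c (insert t K) (insert t L) H = ρ * c K L H

def Fs (c : 𝔽 n → 𝔽 n → 𝔽 n → Rˣ)
    (f : 𝔽 n → 𝔽 n → M) (k : ℕ) (K L : 𝔽 n) : M :=
  ∑ H ∈ (K \ L).powersetCard k, (c K L H : R) • f (K \ H) (L ∪ H)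

variable {c : 𝔽 n → 𝔽 n → 𝔽 n → Rˣ}

theorem Fs_c (hc : Coef c) (f : 𝔽 n → 𝔽 n → M) (t : Fin n) (k : ℕ)
    (K L : 𝔽 n) (hK : ∀ a ∈ K, a < t) (hL : ∀ a ∈ L, a < t) :
    ∃ ρ : Rˣ, Fs c (fun I J => f I (insert t J)) k K L = (ρ : R) • Fs c f k K (insert t L) := by
  obtain ⟨ρ, h⟩ := hc.cc t K L k hK hL
  refine ⟨ρ⁻¹, ?_⟩
  have htK : t ∉ K := fun h => lt_irrefl _ (hK _ h)
  have e : K \ insert t L = K \ L := by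
    ext a; simp only [mem_sdiff, mem_insert]; grind
  rw [Fs, Fs, e, smul_sum]
  refine sum_congr rfl fun H hH => ?_
  rw [mem_powersetCard] at hH
  rw [h H hH.1 hH.2, smul_smul, insert_union, ← Units.val_mul, inv_mul_cancel_left]

theorem Fs_d (hc : Coef c) (f : 𝔽 n → 𝔽 n → M) (t : Fin n) (k : ℕ)
    (K L : 𝔽 n) (hK : ∀ a ∈ K, a < t) (hL : ∀ a ∈ L, a < t) :
    ∃ ρ : Rˣ, Fs c (fun I J => f (insert t I) (insert t J)) k K L =
      (ρ : R) • Fs c f k (insert t K) (insert t L) := by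
  obtain ⟨ρ, h⟩ := hc.cd t K L k hK hL
  refine ⟨ρ⁻¹, ?_⟩
  have htK : t ∉ K := fun h => lt_irrefl _ (hK _ h)
  have e : insert t K \ insert t L = K \ L := by
    ext a; simp only [mem_sdiff, mem_insert]; grind
  rw [Fs, Fs, e, smul_sum]
  refine sum_congr rfl fun H hH => ?_
  rw [mem_powersetCard] at hH
  have htH : t ∉ H := fun h => htK (mem_sdiff.1 (hH.1 h)).1
  rw [h H hH.1 hH.2, smul_smul, insert_union, ← Units.val_mul, inv_mul_cancel_left,
    insert_sdiff_of_notMem _ htH]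

theorem Fs_ab (hc : Coef c) (f : 𝔽 n → 𝔽 n → M) (t : Fin n) (k : ℕ)
    (K L : 𝔽 n) (hK : ∀ a ∈ K, a < t) (hL : ∀ a ∈ L, a < t) :
    ∃ ρ ρ' : Rˣ, Fs c f (k + 1) (insert t K) L =
      (ρ : R) • Fs c (fun I J => f (insert t I) J) (k + 1) K L +
      (ρ' : R) • Fs c (fun I J => f I (insert t J)) k K L := by
  obtain ⟨ρ, h⟩ := hc.ca t K L (k + 1) hK hL
  obtain ⟨ρ', h'⟩ := hc.cb t K L k hK hL
  refine ⟨ρ, ρ', ?_⟩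
  have htK : t ∉ K := fun h => lt_irrefl _ (hK _ h)
  have htL : t ∉ L := fun h => lt_irrefl _ (hL _ h)
  have htKL : t ∉ K \ L := fun h => htK (mem_sdiff.1 h).1
  rw [Fs, Fs, Fs, insert_sdiff_of_notMem _ htL, powersetCard_succ_insert htKL,
    sum_union, smul_sum, smul_sum, sum_image]
  · congr 1
    · refine sum_congr rfl fun H hH => ?_
      rw [mem_powersetCard] at hH
      have htH : t ∉ H := fun h => htKL (hH.1 h)
      rw [h H hH.1 hH.2, smul_smul, Units.val_mul, insert_sdiff_of_notMem _ htH]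
    · refine sum_congr rfl fun H hH => ?_
      rw [mem_powersetCard] at hH
      have htH : t ∉ H := fun h => htKL (hH.1 h)
      have e : insert t K \ insert t H = K \ H := by
        ext a; simp only [mem_sdiff, mem_insert]; grind
      rw [h' H hH.1 hH.2, smul_smul, Units.val_mul, e, union_insert]
  · intro H hH H' hH' hHH
    have h1 : t ∉ H := fun h => htKL ((mem_powersetCard.1 hH).1 h)
    have h2 : t ∉ H' := fun h => htKL ((mem_powersetCard.1 hH').1 h)
    rw [← erase_insert h1, ← erase_insert h2, hHH]
  · rw [disjoint_left]
    intro H hH hH'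
    obtain ⟨H', -, rfl⟩ := mem_image.1 hH'
    exact htKL ((mem_powersetCard.1 hH).1 (mem_insert_self _ _))

def Tsp (c : 𝔽 n → 𝔽 n → 𝔽 n → Rˣ)
    (f : 𝔽 n → 𝔽 n → M) (t p r : ℕ) : Submodule R M :=
  Submodule.span R {m | ∃ (k : ℕ) (K L : 𝔽 n), r ≤ k + p ∧ K.card = p + k ∧
    L.card + k = r ∧ (∀ a ∈ K, a.1 < t) ∧ (∀ a ∈ L, a.1 < t) ∧ m = Fs c f k K L}

theorem split_top (t : ℕ) (ht : t < n) (I : 𝔽 n) (h : ∀ a ∈ I, a.1 < t + 1) :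
    (∀ a ∈ I, a.1 < t) ∨ ∃ I0, (∀ a ∈ I0, a.1 < t) ∧ I = insert ⟨t, ht⟩ I0 ∧
      I.card = I0.card + 1 := by
  by_cases hI : (⟨t, ht⟩ : Fin n) ∈ I
  · right
    refine ⟨I.erase ⟨t, ht⟩, ?_, (insert_erase hI).symm, (card_erase_add_one hI).symm⟩
    intro a ha
    rw [mem_erase] at ha
    have := h a ha.2
    have : a.1 ≠ t := fun h => ha.1 (Fin.ext h)
    omega
  · left
    intro a ha
    have := h a ha
    have : a.1 ≠ t := fun h => hI (by rwa [show (⟨t, ht⟩ : Fin n) = a from Fin.ext h.symm])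
    omega

theorem span_push {S : Set M} {N : Submodule R M} {x : M} (hx : x ∈ Submodule.span R S)
    (h : ∀ y ∈ S, y ∈ N) : x ∈ N := (Submodule.span_le.2 h) hx

theorem unit_mem {N : Submodule R M} (ρ : Rˣ) {x : M} (h : (ρ : R) • x ∈ N) : x ∈ N := by
  have := N.smul_mem ((ρ⁻¹ : Rˣ) : R) h
  rwa [smul_smul, Units.inv_mul, one_smul] at this

theorem insert_lt (t : ℕ) (ht : t < n) (K : 𝔽 n) (h : ∀ a ∈ K, a.1 < t) :
    ∀ a ∈ insert (⟨t, ht⟩ : Fin n) K, a.1 < t + 1 := by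
  intro a ha
  rcases mem_insert.1 ha with rfl | ha
  · simp
  · have := h a ha; omega

theorem card_insert_top (t : ℕ) (ht : t < n) (K : 𝔽 n) (h : ∀ a ∈ K, a.1 < t) :
    (insert (⟨t, ht⟩ : Fin n) K).card = K.card + 1 :=
  card_insert_of_notMem fun h' => lt_irrefl _ (h _ h')

theorem Fs_mem (f : 𝔽 n → 𝔽 n → M) (k : ℕ) (K L : 𝔽 n)
    (N : Submodule R M)
    (h : ∀ H ⊆ K \ L, H.card = k → f (K \ H) (L ∪ H) ∈ N) : Fs c f k K L ∈ N :=
  Submodule.sum_mem _ fun H hH => N.smul_mem _ (by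
    rw [mem_powersetCard] at hH; exact h H hH.1 hH.2)

theorem card_facts {K L H : 𝔽 n} (h : H ⊆ K \ L) :
    (K \ H).card + H.card = K.card ∧ (L ∪ H).card = L.card + H.card := by
  constructor
  · exact card_sdiff_add_card_eq_card (h.trans sdiff_subset)
  · rw [card_union_of_disjoint]
    rw [disjoint_right]; intro a ha; exact (mem_sdiff.1 (h ha)).2

theorem lemStar (hc : Coef c) (t : ℕ) (ht : t ≤ n) :
    ∀ (f : 𝔽 n → 𝔽 n → M) (I J : 𝔽 n),
      (∀ a ∈ I, a.1 < t) → (∀ a ∈ J, a.1 < t) → I.card ≤ J.card →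
      f I J ∈ Tsp c f t I.card J.card := by
  have triv : ∀ (t : ℕ) (f : 𝔽 n → 𝔽 n → M) (I J : 𝔽 n),
      (∀ a ∈ I, a.1 < t) → (∀ a ∈ J, a.1 < t) → I.card = J.card →
      f I J ∈ Tsp c f t I.card J.card := by
    intro t f I J hI hJ h
    refine unit_mem (c I J ∅) (Submodule.subset_span ⟨0, I, J, by omega, by simp, by simp, hI, hJ, ?_⟩)
    simp [Fs]
  induction t with
  | zero =>
    intro f I J hI hJ h
    refine triv 0 f I J hI hJ ?_
    rw [eq_empty_of_forall_notMem (s := I) (fun a ha => by simpa using hI a ha),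
      eq_empty_of_forall_notMem (s := J) (fun a ha => by simpa using hJ a ha)]
  | succ t ih =>
    have ih := ih (by omega)
    have ht' : t < n := by omega
    intro f I J hI hJ h
    have lt_of : ∀ {K : 𝔽 n}, (∀ a ∈ K, a.1 < t) → ∀ a ∈ K, a < (⟨t, ht'⟩ : Fin n) :=
      fun h a ha => Fin.lt_def.2 (h a ha)
    -- case of letter in I only
    have caseI : ∀ I0 J : 𝔽 n, (∀ a ∈ I0, a.1 < t) → (∀ a ∈ J, a.1 < t) →
        I0.card + 1 ≤ J.card → f (insert ⟨t, ht'⟩ I0) J ∈ Tsp c f (t + 1) (I0.card + 1) J.card := by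
      intro I0 J hI0 hJ hc1
      have := ih (fun I J => f (insert ⟨t, ht'⟩ I) J) I0 J hI0 hJ (by omega)
      refine span_push this ?_
      rintro _ ⟨k, K, L, h1, h2, h3, h4, h5, rfl⟩
      obtain ⟨k, rfl⟩ : ∃ k', k = k' + 1 := ⟨k - 1, by omega⟩
      obtain ⟨ρ, ρ', e⟩ := Fs_ab hc f ⟨t, ht'⟩ k K L (lt_of h4) (lt_of h5)
      obtain ⟨ρc, ec⟩ := Fs_c hc f ⟨t, ht'⟩ k K L (lt_of h4) (lt_of h5)
      apply unit_mem ρ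
      replace e := eq_sub_of_add_eq e.symm
      rw [e, ec]
      refine Submodule.sub_mem _ (Submodule.subset_span ?_)
        (Submodule.smul_mem _ _ (Submodule.smul_mem _ _ (Submodule.subset_span ?_)))
      · refine ⟨k + 1, _, _, by omega, ?_, h3, insert_lt t ht' K h4, fun a ha => (h5 a ha).trans (by omega), rfl⟩
        rw [card_insert_top t ht' K h4]; omega
      · refine ⟨k, _, _, by omega, by omega, ?_, fun a ha => (h4 a ha).trans (by omega), insert_lt t ht' L h5, rfl⟩
        rw [card_insert_top t ht' L h5]; omega
    by_cases heq : I.card = J.card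
    · exact triv _ f I J hI hJ heq
    rcases split_top t ht' I hI with hI' | ⟨I0, hI0, rfl, hIc⟩ <;>
      rcases split_top t ht' J hJ with hJ' | ⟨J0, hJ0, rfl, hJc⟩
    · have hih := ih f I J hI' hJ' h
      refine span_push hih ?_
      rintro _ ⟨k, K, L, h1, h2, h3, h4, h5, rfl⟩
      exact Submodule.subset_span ⟨k, K, L, h1, h2, h3, fun a ha => (h4 a ha).trans (by omega),
        fun a ha => (h5 a ha).trans (by omega), rfl⟩
    · have hih := ih (fun I J => f I (insert ⟨t, ht'⟩ J)) I J0 hI' hJ0 (by omega)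
      refine span_push hih ?_
      rintro _ ⟨k, K, L, h1, h2, h3, h4, h5, rfl⟩
      obtain ⟨ρ, ρ', e⟩ := Fs_ab hc f ⟨t, ht'⟩ k K L (lt_of h4) (lt_of h5)
      apply unit_mem ρ'
      replace e := eq_sub_of_add_eq' e.symm
      rw [e]
      refine Submodule.sub_mem _ (Submodule.subset_span ?_) (Submodule.smul_mem _ _ (Fs_mem _ _ _ _ _ ?_))
      · refine ⟨k + 1, _, _, by omega, ?_, by omega, insert_lt t ht' K h4, fun a ha => (h5 a ha).trans (by omega), rfl⟩
        rw [card_insert_top t ht' K h4]; omega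
      · intro H hH hHc
        obtain ⟨hc1, hc2⟩ := card_facts hH
        have hh := caseI (K \ H) (L ∪ H) (fun a ha => h4 a (mem_sdiff.1 ha).1)
          (fun a ha => by
            rcases mem_union.1 ha with ha | ha
            · exact h5 a ha
            · exact h4 a (mem_sdiff.1 (hH ha)).1) (by omega)
        rw [show (K \ H).card + 1 = I.card by omega, show (L ∪ H).card = (insert ⟨t, ht'⟩ J0).card by omega] at hh
        exact hh
    · have := caseI I0 J hI0 hJ' (by omega)
      rwa [← hIc] at this
    · have hih := ih (fun I J => f (insert ⟨t, ht'⟩ I) (insert ⟨t, ht'⟩ J)) I0 J0 hI0 hJ0 (by omega)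
      refine span_push hih ?_
      rintro _ ⟨k, K, L, h1, h2, h3, h4, h5, rfl⟩
      obtain ⟨ρ, e⟩ := Fs_d hc f ⟨t, ht'⟩ k K L (lt_of h4) (lt_of h5)
      rw [e]
      refine Submodule.smul_mem _ _ (Submodule.subset_span ⟨k, _, _, by omega, ?_, ?_, insert_lt t ht' K h4, insert_lt t ht' L h5, rfl⟩)
      · rw [card_insert_top t ht' K h4]; omega
      · rw [card_insert_top t ht' L h5]; omega

def colk (I : 𝔽 n) : ℕ := ∑ i ∈ I, 2 ^ i.1

theorem colk_lt (t : ℕ) (I : 𝔽 n) (h : ∀ a ∈ I, a.1 < t) : colk I < 2 ^ t := by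
  have : colk I = ∑ i ∈ I.map Fin.valEmbedding, 2 ^ i := by simp [colk]
  rw [this]
  exact Nat.geomSum_lt (le_refl 2) (by simpa using h)

def cnt (I : 𝔽 n) (t : Fin n) : ℕ := (I.filter (· ≤ t)).card

def Usp (c : 𝔽 n → 𝔽 n → 𝔽 n → Rˣ)
    (f : 𝔽 n → 𝔽 n → M) (u : ℕ) (I J : 𝔽 n) : Submodule R M :=
  Submodule.span R ({m | ∃ (k : ℕ) (K L : 𝔽 n), K.card = I.card + (k + 1) ∧
    L.card + (k + 1) = J.card ∧ (∀ a ∈ K, a.1 < u) ∧ (∀ a ∈ L, a.1 < u) ∧ m = Fs c f (k + 1) K L} ∪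
    {m | ∃ I' J', I'.card = I.card ∧ J'.card = J.card ∧ colk I' < colk I ∧ colk J < colk J' ∧
      (∀ a ∈ I', a.1 < u) ∧ (∀ a ∈ J', a.1 < u) ∧ m = f I' J'})

theorem lemTwo_aux (hc : Coef c) (t : Fin n) (u : ℕ) (hu : t.1 + 1 + u ≤ n) :
    ∀ (f : 𝔽 n → 𝔽 n → M) (I J : 𝔽 n),
      (∀ a ∈ I, a.1 < t.1 + 1 + u) → (∀ a ∈ J, a.1 < t.1 + 1 + u) → cnt I t < cnt J t →
      f I J ∈ Usp c f (t.1 + 1 + u) I J := by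
  induction u with
  | zero =>
    intro f I J hI hJ h
    have e : ∀ K : 𝔽 n, (∀ a ∈ K, a.1 < t.1 + 1 + 0) → cnt K t = K.card := by
      intro K hK
      rw [cnt, filter_true_of_mem]
      intro a ha; have := hK a ha; rw [Fin.le_def]; omega
    rw [e I hI, e J hJ] at h
    refine span_push (lemStar hc _ (by omega) f I J hI hJ h.le) ?_
    rintro _ ⟨k, K, L, h1, h2, h3, h4, h5, rfl⟩
    obtain ⟨k, rfl⟩ : ∃ k', k = k' + 1 := ⟨k - 1, by omega⟩
    exact Submodule.subset_span (Or.inl ⟨k, K, L, by omega, by omega, h4, h5, rfl⟩)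
  | succ u ih =>
    have ih := ih (by omega)
    generalize hv : t.1 + 1 + u = v at ih
    have ht' : v < n := by omega
    rw [show t.1 + 1 + (u + 1) = v + 1 by omega]
    intro f I J hI hJ h
    have lt_of : ∀ {K : 𝔽 n}, (∀ a ∈ K, a.1 < v) → ∀ a ∈ K, a < (⟨v, ht'⟩ : Fin n) :=
      fun h a ha => Fin.lt_def.2 (h a ha)
    have wk : ∀ {K : 𝔽 n}, (∀ a ∈ K, a.1 < v) → ∀ a ∈ K, a.1 < v + 1 :=
      fun h a ha => (h a ha).trans (by omega)
    have hcnt : ∀ K : 𝔽 n, cnt (insert ⟨v, ht'⟩ K) t = cnt K t := by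
      intro K
      rw [cnt, filter_insert, if_neg]; · rfl
      rw [Fin.le_def]; simp only; omega
    have hcol : ∀ K : 𝔽 n, (∀ a ∈ K, a.1 < v) → colk (insert ⟨v, ht'⟩ K) = 2 ^ v + colk K := by
      intro K hK
      rw [colk, sum_insert (fun h' => lt_irrefl _ (hK _ h'))]; rfl
    rcases split_top v ht' I hI with hI' | ⟨I0, hI0, rfl, hIc⟩ <;>
      rcases split_top v ht' J hJ with hJ' | ⟨J0, hJ0, rfl, hJc⟩
    · have hih := ih f I J hI' hJ' h
      refine span_push hih ?_
      rintro _ (⟨k, K, L, h2, h3, h4, h5, rfl⟩ | ⟨I', J', h1, h2, h3, h4, h5, h6, rfl⟩)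
      · exact Submodule.subset_span (Or.inl ⟨k, K, L, h2, h3, wk h4, wk h5, rfl⟩)
      · exact Submodule.subset_span (Or.inr ⟨I', J', h1, h2, h3, h4, wk h5, wk h6, rfl⟩)
    · rw [hcnt] at h
      have hih := ih (fun I J => f I (insert ⟨v, ht'⟩ J)) I J0 hI' hJ0 h
      refine span_push hih ?_
      rintro _ (⟨k, K, L, h2, h3, h4, h5, rfl⟩ | ⟨I', J', h1, h2, h3, h4, h5, h6, rfl⟩)
      · obtain ⟨ρc, ec⟩ := Fs_c hc f ⟨v, ht'⟩ (k + 1) K L (lt_of h4) (lt_of h5)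
        rw [ec]
        refine Submodule.smul_mem _ _ (Submodule.subset_span (Or.inl ⟨k, K, _, h2, ?_, wk h4, insert_lt v ht' L h5, rfl⟩))
        rw [card_insert_top v ht' L h5]; omega
      · refine Submodule.subset_span (Or.inr ⟨I', _, h1, ?_, h3, ?_, wk h5, insert_lt v ht' J' h6, rfl⟩)
        · rw [card_insert_top v ht' J' h6]; omega
        · rw [hcol _ h6, hcol _ hJ0]; omega
    · rw [hcnt] at h
      have hih := ih (fun I J => f (insert ⟨v, ht'⟩ I) J) I0 J hI0 hJ' h
      refine span_push hih ?_
      rintro _ (⟨k, K, L, h2, h3, h4, h5, rfl⟩ | ⟨I', J', h1, h2, h3, h4, h5, h6, rfl⟩)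
      · obtain ⟨ρ, ρ', e⟩ := Fs_ab hc f ⟨v, ht'⟩ k K L (lt_of h4) (lt_of h5)
        apply unit_mem ρ
        replace e := eq_sub_of_add_eq e.symm
        rw [e]
        refine Submodule.sub_mem _ (Submodule.subset_span (Or.inl ?_)) (Submodule.smul_mem _ _ (Fs_mem _ _ _ _ _ ?_))
        · refine ⟨k, _, _, ?_, h3, insert_lt v ht' K h4, wk h5, rfl⟩
          rw [card_insert_top v ht' K h4]; omega
        · intro H hH hHc
          obtain ⟨hc1, hc2⟩ := card_facts hH
          have l1 : ∀ a ∈ K \ H, a.1 < v := fun a ha => h4 a (mem_sdiff.1 ha).1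
          have l2 : ∀ a ∈ L ∪ H, a.1 < v := fun a ha => by
            rcases mem_union.1 ha with ha | ha
            · exact h5 a ha
            · exact h4 a (mem_sdiff.1 (hH ha)).1
          refine Submodule.subset_span (Or.inr ⟨K \ H, _, by omega, ?_, ?_, ?_, wk l1, insert_lt v ht' _ l2, rfl⟩)
          · rw [card_insert_top v ht' _ l2]; omega
          · rw [hcol _ hI0]; have := colk_lt v _ l1; omega
          · rw [hcol _ l2]; have := colk_lt v _ hJ'; omega
      · refine Submodule.subset_span (Or.inr ⟨_, _, ?_, h2, ?_, h4, insert_lt v ht' I' h5, wk h6, rfl⟩)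
        · rw [card_insert_top v ht' I' h5]; omega
        · rw [hcol _ h5, hcol _ hI0]; omega
    · rw [hcnt, hcnt] at h
      have hih := ih (fun I J => f (insert ⟨v, ht'⟩ I) (insert ⟨v, ht'⟩ J)) I0 J0 hI0 hJ0 h
      refine span_push hih ?_
      rintro _ (⟨k, K, L, h2, h3, h4, h5, rfl⟩ | ⟨I', J', h1, h2, h3, h4, h5, h6, rfl⟩)
      · obtain ⟨ρ, e⟩ := Fs_d hc f ⟨v, ht'⟩ (k + 1) K L (lt_of h4) (lt_of h5)
        rw [e]
        refine Submodule.smul_mem _ _ (Submodule.subset_span (Or.inl ⟨k, _, _, ?_, ?_, insert_lt v ht' K h4, insert_lt v ht' L h5, rfl⟩))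
        · rw [card_insert_top v ht' K h4]; omega
        · rw [card_insert_top v ht' L h5]; omega
      · refine Submodule.subset_span (Or.inr ⟨_, _, ?_, ?_, ?_, ?_, insert_lt v ht' I' h5, insert_lt v ht' J' h6, rfl⟩)
        · rw [card_insert_top v ht' I' h5]; omega
        · rw [card_insert_top v ht' J' h6]; omega
        · rw [hcol _ h5, hcol _ hI0]; omega
        · rw [hcol _ h6, hcol _ hJ0]; omega

theorem lemTwo (hc : Coef c) (f : 𝔽 n → 𝔽 n → M) (N : Submodule R M)
    (I J : 𝔽 n) (t : Fin n) (h : cnt I t < cnt J t)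
    (h1 : ∀ (k : ℕ) (K L : 𝔽 n), K.card = I.card + (k + 1) →
      L.card + (k + 1) = J.card → Fs c f (k + 1) K L ∈ N)
    (h2 : ∀ I' J' : 𝔽 n, I'.card = I.card → J'.card = J.card → colk I' < colk I →
      colk J < colk J' → f I' J' ∈ N) : f I J ∈ N := by
  have ht := t.2
  refine span_push (lemTwo_aux hc t (n - 1 - t.1) (by omega) f I J (fun a _ => ?_) (fun a _ => ?_) h) ?_
  · have := a.2; omega
  · have := a.2; omega
  · rintro _ (⟨k, K, L, h2, h3, h4, h5, rfl⟩ | ⟨I', J', h1, h2', h3, h4, h5, h6, rfl⟩)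
    · exact h1 k K L h2 h3
    · exact h2 I' J' h1 h2' h3 h4

end four
section five
variable {R : Type*} [CommRing R] {n : ℕ} {B : Type*} [Ring B] [Algebra R B]
variable {M : Type*} [AddCommGroup M] [Module R M]
variable {q : Rˣ} {X : 𝕄 n B}

abbrev mq (q : Rˣ) (X : 𝕄 n B) (I J : 𝔽 n) : B :=
  minor (𝕟 q R) X I J

theorem cl_top (C : 𝔽 n) (t : Fin n) (h : ∀ a ∈ C, a < t) : cl C t = C.card := by
  unfold cl; rw [sum_congr rfl (fun a ha => if_pos (h a ha))]; simp

theorem ninv_top_right (A C : 𝔽 n) (t : Fin n) (h : ∀ a ∈ A, a < t) (ht : t ∉ C) :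
    ninv A (insert t C) = ninv A C := by
  unfold ninv
  refine sum_congr rfl fun a ha => ?_
  rw [cl_insert _ _ _ ht, if_neg (h a ha).not_gt, add_zero]

theorem ninv_top_left (A C : 𝔽 n) (t : Fin n) (h : ∀ a ∈ C, a < t) (ht : t ∉ A) :
    ninv (insert t A) C = C.card + ninv A C := by
  rw [ninv_insert_left _ _ _ ht, cl_top _ _ h]

theorem coefX (q : Rˣ) : Coef (n := n) (R := R)
    (fun K L H => (-q) ^ (ninv L H + ninv H (K \ H))) := by
  constructor <;> intro t K L k hK hL
  all_goals
    have htK : t ∉ K := fun h => lt_irrefl _ (hK _ h)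
    have htL : t ∉ L := fun h => lt_irrefl _ (hL _ h)
  · refine ⟨1, fun H hH hc => ?_⟩
    have hHK : ∀ a ∈ H, a < t := fun a ha => hK a (mem_sdiff.1 (hH ha)).1
    have htH : t ∉ H := fun h => lt_irrefl _ (hHK _ h)
    rw [insert_sdiff_of_notMem _ htH, ninv_top_right _ _ _ hHK
      (fun h => htK (mem_sdiff.1 h).1), one_mul]
  · refine ⟨(-q) ^ (K.card - k), fun H hH hc => ?_⟩
    have hHK : ∀ a ∈ H, a < t := fun a ha => hK a (mem_sdiff.1 (hH ha)).1
    have htH : t ∉ H := fun h => lt_irrefl _ (hHK _ h)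
    have e : insert t K \ insert t H = K \ H := by
      ext a; simp only [mem_sdiff, mem_insert]; grind
    rw [e, ninv_top_right _ _ _ hL htH, ninv_top_left _ _ _
      (fun a ha => hK a (mem_sdiff.1 ha).1) htH, ← pow_add]
    have := card_facts hH
    congr 1; omega
  · refine ⟨(-q) ^ k, fun H hH hc => ?_⟩
    have hHK : ∀ a ∈ H, a < t := fun a ha => hK a (mem_sdiff.1 (hH ha)).1
    rw [ninv_top_left _ _ _ hHK htL, ← pow_add]
    congr 1; omega
  · refine ⟨(-q) ^ k, fun H hH hc => ?_⟩
    have hHK : ∀ a ∈ H, a < t := fun a ha => hK a (mem_sdiff.1 (hH ha)).1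
    have htH : t ∉ H := fun h => lt_irrefl _ (hHK _ h)
    rw [insert_sdiff_of_notMem _ htH, ninv_top_right _ _ _ hHK
      (fun h => htK (mem_sdiff.1 h).1), ninv_top_left _ _ _ hHK htL, ← pow_add]
    congr 1; omega

theorem ninv_compl (K H : 𝔽 n) (t : Fin n) (hK : t ∉ K) (h : ∀ a ∈ H, a < t) :
    ninv Kᶜ H = H.card + ninv (insert t K)ᶜ H := by
  rw [← ninv_top_left _ _ t h (by simp), compl_insert, insert_erase (by simpa using hK)]

theorem ninv_insert_right (A C : 𝔽 n) (t : Fin n) (h : t ∉ C) :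
    ninv A (insert t C) = ninv A C + ninv A {t} := by
  rw [← ninv_union_right _ _ _ (by simpa using h), union_comm]; rfl

theorem coefM (q : Rˣ) (μ : Fin n → Rˣ) : Coef (n := n) (R := R)
    (fun K L H => (∏ h ∈ H, μ h) * (-q) ^ (ninv L H + ninv Kᶜ H)) := by
  have e1 : ∀ a b c : ℕ, a = b + c → (-q) ^ c = ((-q) ^ b)⁻¹ * (-q) ^ a := by
    intro a b c h; rw [h, pow_add, inv_mul_cancel_left]
  constructor <;> intro t K L k hK hL
  all_goals
    have htK : t ∉ K := fun h => lt_irrefl _ (hK _ h)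
    have htL : t ∉ L := fun h => lt_irrefl _ (hL _ h)
  · refine ⟨((-q) ^ k)⁻¹, fun H hH hc => ?_⟩
    have hHK : ∀ a ∈ H, a < t := fun a ha => hK a (mem_sdiff.1 (hH ha)).1
    rw [mul_left_comm, ← e1 _ _ (ninv L H + ninv (insert t K)ᶜ H)]
    rw [ninv_compl _ _ _ htK hHK]; omega
  · refine ⟨μ t * (-q) ^ (ninv (insert t K)ᶜ {t}) * ((-q) ^ k)⁻¹, fun H hH hc => ?_⟩
    have hHK : ∀ a ∈ H, a < t := fun a ha => hK a (mem_sdiff.1 (hH ha)).1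
    have htH : t ∉ H := fun h => lt_irrefl _ (hHK _ h)
    rw [prod_insert htH, ninv_top_right _ _ _ hL htH, ninv_insert_right _ _ _ htH,
      ← add_assoc, pow_add, e1 (ninv L H + ninv Kᶜ H) k (ninv L H + ninv (insert t K)ᶜ H)]
    · ac_rfl
    · rw [ninv_compl _ _ _ htK hHK]; omega
  · refine ⟨(-q) ^ k, fun H hH hc => ?_⟩
    have hHK : ∀ a ∈ H, a < t := fun a ha => hK a (mem_sdiff.1 (hH ha)).1
    rw [ninv_top_left _ _ _ hHK htL, mul_left_comm, ← pow_add]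
    congr 2; omega
  · refine ⟨1, fun H hH hc => ?_⟩
    have hHK : ∀ a ∈ H, a < t := fun a ha => hK a (mem_sdiff.1 (hH ha)).1
    rw [ninv_top_left _ _ _ hHK htL, one_mul, ninv_compl _ _ _ htK hHK]
    congr 2; omega

theorem pairstep (hX : IsQM q X) (g : B →ₗ[R] M) (N : Submodule R M)
    (C C' A A' : 𝔽 n) (t : Fin n) (ht : cnt A t < cnt C t)
    (hC : C.card = C'.card)
    (h1 : ∀ (k : ℕ) (K L B1 E : 𝔽 n), K.card = A.card + (k + 1) →
      L.card + (k + 1) = C.card → L.card = B1.card → K.card = E.card →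
      g (mq q X L B1 * mq q X K E) ∈ N)
    (h2 : ∀ I' J' : 𝔽 n, I'.card = A.card → J'.card = C.card → colk I' < colk A →
      colk C < colk J' → g (mq q X J' C' * mq q X I' A') ∈ N) :
    g (mq q X C C' * mq q X A A') ∈ N := by
  refine lemTwo (coefX q) (fun I J => g (mq q X J C' * mq q X I A')) N A C t ht ?_ h2
  intro k K L hK hL
  have h1 := fun B1 E => h1 k K L B1 E hK hL
  have key : (Fs (fun K L H => (-q) ^ (ninv L H + ninv H (K \ H)))
      (fun I J => g (mq q X J C' * mq q X I A')) (k + 1) K L) =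
      ∑ B1 ∈ C'.powerset, (𝕟 q R) ^ ninv B1 (C' \ B1) •
        g (mq q X L B1 * ∑ H ∈ K.powerset, (𝕟 q R) ^ ninv H (K \ H) •
          (mq q X H (C' \ B1) * mq q X (K \ H) A')) := by
    have e1 : ∀ B1, g (mq q X L B1 * ∑ H ∈ K.powerset, (𝕟 q R) ^ ninv H (K \ H) •
          (mq q X H (C' \ B1) * mq q X (K \ H) A')) = ∑ H ∈ K.powerset, (𝕟 q R) ^ ninv H (K \ H) •
          g ((mq q X L B1 * mq q X H (C' \ B1)) * mq q X (K \ H) A') := by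
      intro B1
      rw [mul_sum, map_sum]
      refine sum_congr rfl fun H _ => ?_
      rw [mul_smul_comm, map_smul, mul_assoc]
    simp_rw [e1, smul_sum]
    rw [sum_comm]
    have e2 : ∀ H, ∑ B1 ∈ C'.powerset, (𝕟 q R) ^ ninv B1 (C' \ B1) • (𝕟 q R) ^ ninv H (K \ H) •
          g ((mq q X L B1 * mq q X H (C' \ B1)) * mq q X (K \ H) A') =
          (𝕟 q R) ^ ninv H (K \ H) • g ((if Disjoint L H then
            (𝕟 q R) ^ ninv L H • minor (𝕟 q R) X (L ∪ H) C' else 0) * mq q X (K \ H) A') := by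
      intro H
      rw [← lapRow hX, sum_mul, map_sum, smul_sum]
      refine sum_congr rfl fun B1 _ => ?_
      rw [smul_mul_assoc, map_smul, smul_comm]
    simp_rw [e2]
    rw [Fs]
    have hsub : (K \ L).powersetCard (k + 1) ⊆ K.powerset := by
      intro H hH
      rw [mem_powersetCard] at hH
      exact mem_powerset.2 (hH.1.trans sdiff_subset)
    rw [← sum_subset hsub]
    · refine sum_congr rfl fun H hH => ?_
      rw [mem_powersetCard] at hH
      have hd : Disjoint L H := by
        rw [disjoint_right]; intro a ha; exact (mem_sdiff.1 (hH.1 ha)).2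
      rw [if_pos hd, smul_mul_assoc, map_smul, smul_smul, ← pow_add, add_comm]
      simp
    · intro H hH hH'
      by_cases hd : Disjoint L H
      · rw [if_pos hd]
        have : H.card ≠ k + 1 := by
          intro hk; apply hH'
          rw [mem_powersetCard]
          refine ⟨?_, hk⟩
          intro a ha
          rw [mem_sdiff]
          exact ⟨mem_powerset.1 hH ha, disjoint_right.1 hd ha⟩
        by_cases hc : (K \ H).card = A'.card
        · by_cases hc' : (L ∪ H).card = C'.card
          · have := card_sdiff_add_card_eq_card (mem_powerset.1 hH)
            have := card_union_of_disjoint hd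
            omega
          · rw [minor_card _ _ _ _ hc']; simp
        · rw [mq, minor_card _ _ _ _ hc]; simp
      · rw [if_neg hd]; simp
  rw [key]
  refine Submodule.sum_mem _ fun B1 _ => Submodule.smul_mem _ _ ?_
  rw [lapCol hX]
  by_cases hd : Disjoint (C' \ B1) A'
  · rw [if_pos hd, mul_smul_comm, map_smul]
    refine Submodule.smul_mem _ _ ?_
    by_cases hL1 : L.card = B1.card
    · by_cases hK1 : K.card = (C' \ B1 ∪ A').card
      · exact h1 _ _ hL1 hK1
      · rw [minor_card _ _ _ _ hK1]; simp
    · rw [mq, minor_card _ _ _ _ hL1]; simp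
  · rw [if_neg hd]; simp

theorem sum_powerset_one (H : 𝔽 n) (g : 𝔽 n → 𝔽 n → M)
    (hg : ∀ I K, K.card ≠ 1 → g I K = 0) :
    ∑ I1 ∈ H.powerset, g I1 (H \ I1) = ∑ h ∈ H, g (H.erase h) {h} := by
  have hsub : H.image (fun h => H.erase h) ⊆ H.powerset := by
    intro K hK
    obtain ⟨h, -, rfl⟩ := mem_image.1 hK
    exact mem_powerset.2 (erase_subset _ _)
  rw [← sum_subset hsub, sum_image]
  · refine sum_congr rfl fun h hh => ?_
    rw [sdiff_erase hh, Finset.sdiff_self, insert_empty_eq]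
  · intro a ha b hb hab
    by_contra hne
    have : a ∈ H.erase b := mem_erase.2 ⟨hne, ha⟩
    simp only at hab
    rw [← hab] at this
    simp at this
  · intro K hK hK'
    apply hg
    intro hc
    obtain ⟨h, hh⟩ := card_eq_one.1 hc
    apply hK'
    have hK := mem_powerset.1 hK
    rw [mem_image]
    have hmem : h ∈ H \ K := by rw [hh]; simp
    refine ⟨h, (mem_sdiff.1 hmem).1, ?_⟩
    rw [erase_eq, ← hh, Finset.sdiff_sdiff_eq_self hK]

theorem minor_one (s : R) (X : 𝕄 n B) (i j : Fin n) :
    minor s X {i} {j} = X i j := by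
  have : cl {i} i = 0 := by simp [cl]
  simp [minor, Dm, this]

theorem minor_last (hX : IsQM q X) (H P' : 𝔽 n) (p : Fin n) (hp : ∀ a ∈ P', a < p) :
    mq q X H (insert p P') = ∑ h ∈ H, (𝕟 q R) ^ ninv (H.erase h) {h} •
      (mq q X (H.erase h) P' * X h p) := by
  have hpp : p ∉ P' := fun h => lt_irrefl _ (hp _ h)
  have := lapCol hX H P' {p}
  rw [sum_powerset_one H (fun I K => (𝕟 q R) ^ ninv I K • (minor (𝕟 q R) X I P' *
    minor (𝕟 q R) X K {p})), if_pos (by simpa using hpp)] at this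
  · have e0 : ninv P' {p} = 0 := by
      have := ninv_top_right P' ∅ p hp (by simp)
      rw [insert_empty_eq] at this
      rw [this]; simp
    rw [e0, pow_zero, one_smul] at this
    rw [mq, insert_eq, union_comm, ← this]
    exact sum_congr rfl fun h _ => by rw [minor_one]
  · intro I K hK
    rw [minor_card _ X K _ (by simpa using hK)]; simp

theorem minor_last_row (hX : IsQM q X) (H Q : 𝔽 n) (h : Fin n) :
    ∑ b ∈ Q, (𝕟 q R) ^ ninv (Q.erase b) {b} • (mq q X H (Q.erase b) * X h b) =
      if h ∈ H then 0 else (𝕟 q R) ^ ninv H {h} • mq q X (insert h H) Q := by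
  have := lapRow hX Q H {h}
  rw [sum_powerset_one Q (fun I K => (𝕟 q R) ^ ninv I K • (minor (𝕟 q R) X H I *
    minor (𝕟 q R) X {h} K))] at this
  · simp_rw [minor_one] at this
    rw [mq, this]
    simp only [disjoint_singleton_right]
    rw [union_comm, ← insert_eq, ite_not]
  · intro I K hK
    rw [minor_card _ X _ K (by simpa using hK.symm)]; simp

theorem mix_aux {x y : 𝕄 n B} (hx : IsQM q x) (hy : IsQM q y)
    (hxy : ∀ i j k l, Commute (x i j) (y k l)) (μ : Fin n → Rˣ)
    (P' Q : 𝔽 n) (p : Fin n) (hp : ∀ a ∈ P', a < p) :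
    ∑ H : 𝔽 n, ((∏ h ∈ H, μ h : Rˣ) : R) • (mq q x H (insert p P') * mq q y H Q) =
    ∑ H : 𝔽 n, ∑ b ∈ Q, (((∏ h ∈ H, μ h : Rˣ) : R) * (𝕟 q R) ^ ninv (Q.erase b) {b}) •
      ((mq q x H P' * mq q y H (Q.erase b)) * ∑ h, (μ h : R) • (x h p * y h b)) := by
  have e1 : ∀ H : 𝔽 n, ∑ b ∈ Q, (((∏ h ∈ H, μ h : Rˣ) : R) * (𝕟 q R) ^ ninv (Q.erase b) {b}) •
      ((mq q x H P' * mq q y H (Q.erase b)) * ∑ h, (μ h : R) • (x h p * y h b)) =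
      ∑ h, if h ∈ H then 0 else (((∏ h ∈ H, μ h : Rˣ) : R) * (μ h : R) * (𝕟 q R) ^ ninv H {h}) •
        (mq q x H P' * x h p * mq q y (insert h H) Q) := by
    intro H
    have : ∀ h, (if h ∈ H then 0 else (((∏ h ∈ H, μ h : Rˣ) : R) * (μ h : R) * (𝕟 q R) ^ ninv H {h}) •
        (mq q x H P' * x h p * mq q y (insert h H) Q)) =
        (((∏ h ∈ H, μ h : Rˣ) : R) * (μ h : R)) • (mq q x H P' * x h p * (if h ∈ H then 0 else
          (𝕟 q R) ^ ninv H {h} • mq q y (insert h H) Q)) := by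
      intro h
      split_ifs
      · simp
      · rw [mul_smul_comm, smul_smul]
    simp_rw [this, ← minor_last_row hy, mul_sum, smul_sum]
    rw [sum_comm]
    refine sum_congr rfl fun h _ => sum_congr rfl fun b _ => ?_
    rw [mul_smul_comm, mul_smul_comm, smul_smul, smul_smul]
    have hcm : mq q y H (Q.erase b) * x h p = x h p * mq q y H (Q.erase b) :=
      ((Dm_commute _ y _ (fun k l => hxy h p k l) _ _).eq).symm
    have e3 : mq q x H P' * mq q y H (Q.erase b) * (x h p * y h b) =
        mq q x H P' * x h p * (mq q y H (Q.erase b) * y h b) := by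
      simp only [mul_assoc]
      rw [← mul_assoc (mq q y H _), hcm, mul_assoc]
    rw [e3]
    congr 1; ring
  simp_rw [e1, minor_last hx _ _ _ hp, sum_mul, smul_sum]
  rw [sum_sigma', sum_sigma']
  symm
  rw [← sum_filter_add_sum_filter_not _ (fun z : (_ : 𝔽 n) × Fin n => z.2 ∈ z.1)]
  rw [sum_eq_zero, zero_add]
  swap
  · rintro ⟨H, h⟩ hh
    simp only [mem_filter] at hh
    rw [if_pos hh.2]
  refine sum_bij' (fun z _ => ⟨insert z.2 z.1, z.2⟩) (fun z _ => ⟨z.1.erase z.2, z.2⟩)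
      ?_ ?_ ?_ ?_ ?_
  · rintro ⟨H, h⟩ hh; simp
  · rintro ⟨H, h⟩ hh; simp
  · rintro ⟨H, h⟩ hh
    simp at hh; simp [hh]
  · rintro ⟨H, h⟩ hh
    simp at hh; simp [hh]
  · rintro ⟨H, h⟩ hh
    simp only [mem_filter, mem_sigma, mem_univ, true_and] at hh
    simp only [if_neg hh, erase_insert hh]
    rw [smul_mul_assoc, smul_smul, prod_insert hh, Units.val_mul]
    congr 1; ring

end five
section six
variable {R : Type*} [CommRing R] {n : ℕ} {B : Type*} [Ring B] [Algebra R B]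
variable {q : Rˣ} {x y : 𝕄 n B}

structure Setup (q : Rˣ) (x y : 𝕄 n B) (Z : Submodule R B) (c : B)
    (μ ν μ' ν' : Fin n → Rˣ) : Prop where
  hx : IsQM q x
  hy : IsQM q y
  hxy : ∀ i j k l, Commute (x i j) (y k l)
  left : ∀ a, ∀ z ∈ Z, a * z ∈ Z
  right : ∀ z ∈ Z, z * c ∈ Z
  H1 : ∀ i j, (∑ k, (μ' k : R) • (x i k * y j k)) - (if i = j then (ν' i : R) • c else 0) ∈ Z
  H2 : ∀ i j, (∑ k, (μ k : R) • (x k i * y k j)) - (if i = j then (ν i : R) • c else 0) ∈ Z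

variable {Z : Submodule R B} {c : B} {μ ν μ' ν' : Fin n → Rˣ}

theorem Setup.transpose (h : Setup q x y Z c μ ν μ' ν') :
    Setup q x.transpose y.transpose Z c μ' ν' μ ν where
  hx := h.hx.transpose
  hy := h.hy.transpose
  hxy _ _ _ _ := h.hxy _ _ _ _
  left := h.left
  right := h.right
  H1 := h.H2
  H2 := h.H1

theorem Setup.rightpow (h : Setup q x y Z c μ ν μ' ν') (m : ℕ) : ∀ z ∈ Z, z * c ^ m ∈ Z := by
  induction m with
  | zero => intro z hz; simpa using hz
  | succ m ih => intro z hz; rw [pow_succ, ← mul_assoc]; exact h.right _ (ih z hz)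

def Wd (x : 𝕄 n B) (u : 𝕃 n) : B :=
  (u.map fun p => x p.1 p.2).prod

def Dg (R : Type*) [CommRing R] [Algebra R B] (x y : 𝕄 n B) (a b : ℕ) :
    Submodule R B :=
  Submodule.span R {m | ∃ u v : 𝕃 n, u.length = a ∧ v.length = b ∧
    m = Wd x u * Wd y v}

theorem Wd_commute (hxy : ∀ i j k l, Commute (x i j) (y k l)) (u v) :
    Commute (Wd x u) (Wd y v) := by
  unfold Wd
  apply Commute.list_prod_left
  intro a ha
  apply Commute.list_prod_right
  intro b hb
  simp only [List.mem_map] at ha hb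
  obtain ⟨p, -, rfl⟩ := ha
  obtain ⟨p', -, rfl⟩ := hb
  exact hxy _ _ _ _

theorem Wd_append (u v) : Wd x (u ++ v) = Wd x u * Wd x v := by
  simp [Wd]

theorem Dg_mul (hxy : ∀ i j k l, Commute (x i j) (y k l)) {a b a' b' : ℕ} {m m' : B}
    (h : m ∈ Dg R x y a b) (h' : m' ∈ Dg R x y a' b') :
    m * m' ∈ Dg R x y (a + a') (b + b') := by
  have := Submodule.mul_mem_mul h h'
  rw [Dg, Dg, Submodule.span_mul_span] at this
  refine Submodule.span_mono ?_ this
  rintro _ ⟨_, ⟨u, v, rfl, rfl, rfl⟩, _, ⟨u', v', rfl, rfl, rfl⟩, rfl⟩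
  refine ⟨u ++ u', v ++ v', by simp, by simp, ?_⟩
  simp only [Wd_append, mul_assoc]
  rw [← mul_assoc (Wd y v), ← (Wd_commute hxy u' v).eq, mul_assoc]

theorem Dg_one : (1 : B) ∈ Dg R x y 0 0 :=
  Submodule.subset_span ⟨[], [], rfl, rfl, by simp [Wd]⟩

theorem Dg_x (i j) : x i j ∈ Dg R x y 1 0 :=
  Submodule.subset_span ⟨[(i, j)], [], rfl, rfl, by simp [Wd]⟩

theorem Dg_y (i j) : y i j ∈ Dg R x y 0 1 :=
  Submodule.subset_span ⟨[], [(i, j)], rfl, rfl, by simp [Wd]⟩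

theorem Dm_mem (T : ℕ → Submodule R B) (h1 : (1 : B) ∈ T 0)
    (hm : ∀ i j a, ∀ m ∈ T a, x i j * m ∈ T (a + 1)) (s : R) (L : List (Fin n)) :
    ∀ I : 𝔽 n, Dm s x I L ∈ T I.card := by
  induction L with
  | nil => intro I; rw [Dm]; split_ifs with h
           · subst h; exact h1
           · exact zero_mem _
  | cons j L ih =>
    intro I; rw [Dm]
    refine Submodule.sum_mem _ fun i hi => Submodule.smul_mem _ _ ?_
    have := hm i j _ _ (ih (I.erase i))
    rwa [card_erase_add_one hi] at this

theorem mq_x (hxy : ∀ i j k l, Commute (x i j) (y k l)) (I J) :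
    mq q x I J ∈ Dg R x y I.card 0 :=
  Dm_mem (fun a => Dg R x y a 0) Dg_one (fun i j a m h => by
    have := Dg_mul hxy (Dg_x (R := R) (y := y) i j) h
    rwa [add_comm] at this) _ _ _

theorem mq_y (hxy : ∀ i j k l, Commute (x i j) (y k l)) (I J) :
    mq q y I J ∈ Dg R x y 0 I.card :=
  Dm_mem (fun a => Dg R x y 0 a) Dg_one (fun i j a m h => by
    have := Dg_mul hxy (Dg_y (R := R) (x := x) i j) h
    rwa [add_comm 1] at this) _ _ _

theorem mq_xy (hxy : ∀ i j k l, Commute (x i j) (y k l)) (H P Q : 𝔽 n) :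
    mq q x H P * mq q y H Q ∈ Dg R x y P.card P.card := by
  by_cases h : H.card = P.card
  · have := Dg_mul hxy (mq_x (q := q) hxy H P) (mq_y (q := q) hxy H Q)
    rwa [h, add_zero, zero_add] at this
  · rw [mq, minor_card _ _ _ _ h, zero_mul]; exact zero_mem _

theorem Setup.mix (h : Setup q x y Z c μ ν μ' ν') (j : ℕ) (P Q : 𝔽 n)
    (hP : P.card = j + 1) : ∃ E ∈ Dg R x y j j,
    (∑ H : 𝔽 n, ((∏ h ∈ H, μ h : Rˣ) : R) • (mq q x H P * mq q y H Q)) - E * c ∈ Z := by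
  have hne : P.Nonempty := by rw [← card_pos]; omega
  set p := P.max' hne with hp
  have hpP : p ∈ P := P.max'_mem hne
  have e : insert p (P.erase p) = P := insert_erase hpP
  have hlt : ∀ a ∈ P.erase p, a < p := by
    intro a ha
    rw [mem_erase] at ha
    exact lt_of_le_of_ne (P.le_max' _ ha.2) ha.1
  have hc : (P.erase p).card = j := by rw [card_erase_of_mem hpP]; omega
  have := mix_aux h.hx h.hy h.hxy μ (P.erase p) Q p hlt
  rw [e] at this
  rw [this]
  refine ⟨∑ H : 𝔽 n, ∑ b ∈ Q,
    (((∏ h ∈ H, μ h : Rˣ) : R) * (𝕟 q R) ^ ninv (Q.erase b) {b}) •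
      ((mq q x H (P.erase p) * mq q y H (Q.erase b)) * (if p = b then (ν p : R) • 1 else 0)), ?_, ?_⟩
  · refine Submodule.sum_mem _ fun H _ => Submodule.sum_mem _ fun b _ => Submodule.smul_mem _ _ ?_
    have := mq_xy (q := q) h.hxy H (P.erase p) (Q.erase b)
    rw [hc] at this
    split_ifs
    · rw [mul_smul_comm, mul_one]; exact Submodule.smul_mem _ _ this
    · simp
  · rw [sum_mul, ← sum_sub_distrib]
    refine Submodule.sum_mem _ fun H _ => ?_
    rw [sum_mul, ← sum_sub_distrib]
    refine Submodule.sum_mem _ fun b _ => ?_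
    rw [smul_mul_assoc, ← smul_sub]
    refine Submodule.smul_mem _ _ ?_
    rw [mul_assoc _ (ite _ _ _), ← mul_sub]
    refine h.left _ _ ?_
    have := h.H2 p b
    rwa [ite_mul, smul_mul_assoc, one_mul, zero_mul]

theorem Setup.mixstep (h : Setup q x y Z c μ ν μ' ν') (N : Submodule R B) (hZ : Z ≤ N)
    (G : B) (g1 g2 m : ℕ) (hG : G ∈ Dg R x y g1 g2) (I J A' B' : 𝔽 n) (t : Fin n)
    (ht : cnt I t < cnt J t) (hJ : J.card = A'.card)
    (hD : ∀ a b, a + 1 = g1 + J.card → b + 1 = g2 + Iᶜ.card →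
      ∀ E ∈ Dg R x y a b, E * c ^ (m + 1) ∈ N)
    (h2 : ∀ I' J' : 𝔽 n, I'.card = I.card → J'.card = J.card → colk I' < colk I →
      colk J < colk J' → G * (mq q x J' A' * mq q y I'ᶜ B') * c ^ m ∈ N) :
    G * (mq q x J A' * mq q y Iᶜ B') * c ^ m ∈ N := by
  refine lemTwo (coefM q μ) (fun I J => G * (mq q x J A' * mq q y Iᶜ B') * c ^ m) N I J t ht ?_ h2
  intro k K L hK hL
  have key : Fs (fun K L H => (∏ h ∈ H, μ h) * (-q) ^ (ninv L H + ninv Kᶜ H))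
      (fun I J => G * (mq q x J A' * mq q y Iᶜ B') * c ^ m) (k + 1) K L =
      ∑ A1 ∈ A'.powerset, ∑ B1 ∈ B'.powerset,
        ((𝕟 q R) ^ ninv A1 (A' \ A1) * (𝕟 q R) ^ ninv B1 (B' \ B1)) •
        (G * ((mq q x L A1 * mq q y Kᶜ B1) * ∑ H : 𝔽 n, ((∏ h ∈ H, μ h : Rˣ) : R) •
          (mq q x H (A' \ A1) * mq q y H (B' \ B1))) * c ^ m) := by
    have e1 : ∀ H, ∑ A1 ∈ A'.powerset, ∑ B1 ∈ B'.powerset,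
        ((𝕟 q R) ^ ninv A1 (A' \ A1) * (𝕟 q R) ^ ninv B1 (B' \ B1)) •
        ((mq q x L A1 * mq q y Kᶜ B1) * (mq q x H (A' \ A1) * mq q y H (B' \ B1))) =
        (if Disjoint L H then (𝕟 q R) ^ ninv L H • minor (𝕟 q R) x (L ∪ H) A' else 0) *
        (if Disjoint Kᶜ H then (𝕟 q R) ^ ninv Kᶜ H • minor (𝕟 q R) y (Kᶜ ∪ H) B' else 0) := by
      intro H
      rw [← lapRow h.hx, ← lapRow h.hy, sum_mul_sum]
      refine sum_congr rfl fun A1 _ => sum_congr rfl fun B1 _ => ?_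
      rw [smul_mul_smul_comm]
      congr 1
      simp only [mul_assoc]
      rw [← mul_assoc (mq q y _ _) (mq q x _ _), ← (minor_commute _ x y h.hxy _ _ _ _).eq, mul_assoc]
    have e2 : ∑ A1 ∈ A'.powerset, ∑ B1 ∈ B'.powerset,
        ((𝕟 q R) ^ ninv A1 (A' \ A1) * (𝕟 q R) ^ ninv B1 (B' \ B1)) •
        (G * ((mq q x L A1 * mq q y Kᶜ B1) * ∑ H : 𝔽 n, ((∏ h ∈ H, μ h : Rˣ) : R) •
          (mq q x H (A' \ A1) * mq q y H (B' \ B1))) * c ^ m) =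
        ∑ H : 𝔽 n, ((∏ h ∈ H, μ h : Rˣ) : R) • (G *
        ((if Disjoint L H then (𝕟 q R) ^ ninv L H • minor (𝕟 q R) x (L ∪ H) A' else 0) *
        (if Disjoint Kᶜ H then (𝕟 q R) ^ ninv Kᶜ H • minor (𝕟 q R) y (Kᶜ ∪ H) B' else 0)) *
          c ^ m) := by
      simp_rw [← e1, mul_sum, sum_mul, smul_sum]
      symm
      rw [sum_comm]
      refine sum_congr rfl fun A1 _ => ?_
      rw [sum_comm]
      refine sum_congr rfl fun B1 _ => sum_congr rfl fun H _ => ?_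
      simp only [mul_smul_comm, smul_mul_assoc]
      rw [smul_comm]
    rw [e2, Fs]
    rw [← sum_subset (subset_univ ((K \ L).powersetCard (k + 1)))]
    · refine sum_congr rfl fun H hH => ?_
      rw [mem_powersetCard] at hH
      have hd : Disjoint L H := by
        rw [disjoint_right]; intro a ha; exact (mem_sdiff.1 (hH.1 ha)).2
      have hd' : Disjoint Kᶜ H := by
        rw [disjoint_right]; intro a ha; simpa using (mem_sdiff.1 (hH.1 ha)).1
      have e3 : (K \ H)ᶜ = Kᶜ ∪ H := by
        ext a; simp only [mem_compl, mem_sdiff, mem_union]; tauto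
      rw [if_pos hd, if_pos hd', e3, smul_mul_smul_comm, mul_smul_comm, smul_mul_assoc, smul_smul,
        ← pow_add]
      simp
    · intro H _ hH
      by_cases hd : Disjoint L H
      · by_cases hd' : Disjoint Kᶜ H
        · have : (L ∪ H).card ≠ A'.card := by
            intro hc
            apply hH
            rw [card_union_of_disjoint hd] at hc
            rw [mem_powersetCard]
            refine ⟨fun a ha => ?_, by omega⟩
            rw [mem_sdiff]
            refine ⟨?_, disjoint_right.1 hd ha⟩
            simpa using disjoint_right.1 hd' ha
          rw [minor_card _ _ _ _ this]; simp
        · rw [if_neg hd']; simp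
      · rw [if_neg hd]; simp
  rw [key]
  refine Submodule.sum_mem _ fun A1 hA1 => Submodule.sum_mem _ fun B1 hB1 =>
    Submodule.smul_mem _ _ ?_
  by_cases hL1 : L.card = A1.card
  swap
  · rw [mq, minor_card _ _ _ _ hL1]; simp
  have hA := card_sdiff_add_card_eq_card (mem_powerset.1 hA1)
  obtain ⟨E, hE, hEZ⟩ := h.mix k (A' \ A1) (B' \ B1) (by omega)
  set S := ∑ H : 𝔽 n, ((∏ h ∈ H, μ h : Rˣ) : R) •
          (mq q x H (A' \ A1) * mq q y H (B' \ B1)) with hS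
  have e4 : G * ((mq q x L A1 * mq q y Kᶜ B1) * S) * c ^ m =
      (G * (mq q x L A1 * mq q y Kᶜ B1)) * (S - E * c) * c ^ m +
      (G * ((mq q x L A1 * mq q y Kᶜ B1) * E)) * c ^ (m + 1) := by
    rw [pow_succ']; noncomm_ring
  rw [e4]
  refine N.add_mem (hZ (h.rightpow m _ (h.left _ _ hEZ))) ?_
  have hKc := card_add_card_compl K
  have hIc := card_add_card_compl I
  refine hD (g1 + (L.card + 0 + k)) (g2 + (0 + Kᶜ.card + k)) (by omega) (by omega) _ ?_
  exact Dg_mul h.hxy hG (Dg_mul h.hxy (Dg_mul h.hxy (mq_x h.hxy _ _) (mq_y h.hxy _ _)) hE)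

end six
section seven
variable {R : Type*} [CommRing R] {n : ℕ} {B : Type*} [Ring B] [Algebra R B]
variable {q : Rˣ} {x y : 𝕄 n B}
variable {Z : Submodule R B} {c : B} {μ ν μ' ν' : Fin n → Rˣ}

abbrev PL (n : ℕ) := List (𝔽 n × 𝔽 n)

def Pm (q : Rˣ) (x : 𝕄 n B) (l : PL n) : B :=
  (l.map fun p => mq q x p.1 p.2).prod

def bst (q : Rˣ) (x y : 𝕄 n B) (c : B) (k : ℕ) (lx ly : PL n) : B :=
  Pm q x lx * Pm q y ly * c ^ k

def tot (l : PL n) : ℕ := (l.map fun p => p.1.card).sum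

def Sq (l : PL n) : Prop := ∀ p ∈ l, p.1.card = p.2.card

structure Valid (r s k : ℕ) (lx ly : PL n) : Prop where
  lenx : lx.length = r
  leny : ly.length = s
  sqx : Sq lx
  sqy : Sq ly
  totx : tot lx + k = r
  toty : tot ly + k = s

def ksh : PL n → ℕ
  | [] => 0
  | a :: l => (n - a.1.card) + 2 * ksh l

def kx : List (𝔽 n) → ℕ
  | [] => 0
  | a :: l => colk a + 2 ^ n * kx l

def ky : List (𝔽 n) → ℕ
  | [] => 0
  | a :: l => colk aᶜ * (2 ^ n) ^ l.length + ky l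

theorem ksh_append (P S : PL n) : ksh (P ++ S) = ksh P + 2 ^ P.length * ksh S := by
  induction P with
  | nil => simp [ksh]
  | cons a P ih => simp only [List.cons_append, ksh, ih, List.length_cons]; ring

theorem kx_append (P S : List (𝔽 n)) :
    kx (P ++ S) = kx P + (2 ^ n) ^ P.length * kx S := by
  induction P with
  | nil => simp [kx]
  | cons a P ih => simp only [List.cons_append, kx, ih, List.length_cons]; ring

theorem ky_append (P S : List (𝔽 n)) :
    ky (P ++ S) = ky P * (2 ^ n) ^ S.length + ky S := by
  induction P with
  | nil => simp [ky]
  | cons a P ih => simp only [List.cons_append, ky, ih, List.length_append]; ring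

theorem colk_lt_top (I : 𝔽 n) : colk I < 2 ^ n := colk_lt n I fun a _ => a.2

theorem colk_compl (I : 𝔽 n) : colk I + colk Iᶜ = ∑ i : Fin n, 2 ^ i.1 := by
  unfold colk; exact sum_add_sum_compl _ _

theorem kx_lt (P : List (𝔽 n)) : kx P < (2 ^ n) ^ P.length := by
  induction P with
  | nil => simp [kx]
  | cons a P ih =>
    simp only [kx, List.length_cons, pow_succ']
    have := colk_lt_top a
    calc _ < 2 ^ n + 2 ^ n * kx P := by omega
      _ = 2 ^ n * (kx P + 1) := by ring
      _ ≤ _ := Nat.mul_le_mul_left _ ih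

def kS (r : ℕ) (lx ly : List (𝔽 n)) : ℕ := ky ly * (2 ^ n) ^ r + kx lx

def kk (r : ℕ) (lx ly : PL n) : ℕ :=
  kS r (lx.map Prod.fst) (ly.map Prod.fst) + kS r (lx.map Prod.snd) (ly.map Prod.snd)

def Less (r k' : ℕ) (lx' ly' : PL n) (k : ℕ) (lx ly : PL n) : Prop :=
  k < k' ∨ (k' = k ∧ (ksh lx' + ksh ly' < ksh lx + ksh ly ∨
    (ksh lx' + ksh ly' = ksh lx + ksh ly ∧ kk r lx' ly' < kk r lx ly)))

def IHp (N : Submodule R B) (q : Rˣ) (x y : 𝕄 n B) (c : B) (r s k : ℕ)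
    (lx ly : PL n) : Prop :=
  ∀ k' lx' ly', Valid r s k' lx' ly' → Less r k' lx' ly' k lx ly → bst q x y c k' lx' ly' ∈ N

theorem tot_append (P S : PL n) : tot (P ++ S) = tot P + tot S := by simp [tot]
theorem tot_cons (a) (S : PL n) : tot (a :: S) = a.1.card + tot S := by simp [tot]
theorem Pm_append (P S : PL n) : Pm q x (P ++ S) = Pm q x P * Pm q x S := by simp [Pm]
theorem Pm_cons (a) (S : PL n) : Pm q x (a :: S) = mq q x a.1 a.2 * Pm q x S := by simp [Pm]
theorem Pm_nil : Pm q x ([] : PL n) = 1 := by simp [Pm]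
theorem Sq_append (P S : PL n) : Sq (P ++ S) ↔ Sq P ∧ Sq S := by
  simp only [Sq, List.mem_append, or_imp, forall_and]
theorem Sq_cons (a) (S : PL n) : Sq (a :: S) ↔ a.1.card = a.2.card ∧ Sq S := by
  simp only [Sq, List.mem_cons, forall_eq_or_imp]

theorem card_le_n (I : 𝔽 n) : I.card ≤ n := by simpa using card_le_univ I

theorem pair_gen (hX : IsQM q x) (g : B →ₗ[R] B) (N : Submodule R B)
    (P S : PL n) (C A : 𝔽 n × 𝔽 n) (t : Fin n)
    (ht : cnt A.1 t < cnt C.1 t) (hs : Sq (P ++ C :: A :: S))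
    (h1 : ∀ l : PL n, l.length = (P ++ C :: A :: S).length → Sq l →
      tot l = tot (P ++ C :: A :: S) → (ksh l < ksh (P ++ C :: A :: S) ∨
        (ksh l = ksh (P ++ C :: A :: S) ∧
          l.map Prod.snd = (P ++ C :: A :: S).map Prod.snd ∧
          kx (l.map Prod.fst) < kx ((P ++ C :: A :: S).map Prod.fst) ∧
          ky (l.map Prod.fst) < ky ((P ++ C :: A :: S).map Prod.fst))) →
      g (Pm q x l) ∈ N) :
    g (Pm q x (P ++ C :: A :: S)) ∈ N := by
  obtain ⟨C, C'⟩ := C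
  obtain ⟨A, A'⟩ := A
  rw [Sq_append, Sq_cons, Sq_cons] at hs
  simp only at hs ht
  let g' : B →ₗ[R] B := g ∘ₗ (LinearMap.mulLeft R (Pm q x P)) ∘ₗ (LinearMap.mulRight R (Pm q x S))
  have hg : ∀ I J I' J', g' (mq q x I J * mq q x I' J') =
      g (Pm q x (P ++ (I, J) :: (I', J') :: S)) := by
    intro I J I' J'
    simp only [g', LinearMap.comp_apply, LinearMap.mulLeft_apply, LinearMap.mulRight_apply,
      Pm_append, Pm_cons, mul_assoc]
  rw [← hg]
  refine pairstep hX g' N C C' A A' t ht hs.2.1 ?_ ?_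
  · intro k K L B1 E h3 h4 h5 h6
    rw [hg]
    refine h1 _ (by simp) ?_ ?_ (Or.inl ?_)
    · rw [Sq_append, Sq_cons, Sq_cons]; exact ⟨hs.1, h5, h6, hs.2.2.2⟩
    · simp only [tot_append, tot_cons]; omega
    · simp only [ksh_append, ksh]
      have a1 := card_le_n K
      have a2 := card_le_n C
      gcongr ?_ + 2 ^ _ * ?_
      omega
  · intro I' J' h3 h4 h5 h6
    rw [hg]
    refine h1 _ (by simp) ?_ ?_ (Or.inr ⟨?_, by simp, ?_, ?_⟩)
    · rw [Sq_append, Sq_cons, Sq_cons]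
      exact ⟨hs.1, h4.trans hs.2.1, h3.trans hs.2.2.1, hs.2.2.2⟩
    · simp only [tot_append, tot_cons]; omega
    · simp only [ksh_append, ksh, h3, h4]
    · simp only [List.map_append, List.map_cons, kx_append, kx]
      have a1 := colk_lt_top J'
      have a2 : 2 ^ n * (colk I' + 1) ≤ 2 ^ n * colk A := Nat.mul_le_mul_left _ h5
      gcongr ?_ + _ ^ _ * ?_
      simp only [mul_add, mul_one] at a2 ⊢
      omega
    · simp only [List.map_append, List.map_cons, ky_append, ky, List.length_cons]
      have b1 := colk_compl J'
      have b2 := colk_compl C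
      have a1 := colk_lt_top I'ᶜ
      have a2 : 2 ^ n * (colk J'ᶜ + 1) ≤ 2 ^ n * colk Cᶜ := Nat.mul_le_mul_left _ (by omega)
      gcongr ?_ + ?_
      simp only [← add_assoc]
      gcongr ?_ + _
      rw [pow_succ', ← mul_assoc, ← mul_assoc, ← add_mul, ← add_mul]
      have : 0 < (2 ^ n) ^ (S.map Prod.fst).length := by positivity
      gcongr ?_ * _
      rw [mul_comm (colk _), mul_comm (colk _)]
      simp only [mul_add, mul_one] at a2 ⊢
      omega

theorem Pm_commute (hxy : ∀ i j k l, Commute (x i j) (y k l)) (l l' : PL n) :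
    Commute (Pm q x l) (Pm q y l') := by
  unfold Pm
  apply Commute.list_prod_left
  intro a ha
  apply Commute.list_prod_right
  intro b hb
  simp only [List.mem_map] at ha hb
  obtain ⟨p, -, rfl⟩ := ha
  obtain ⟨p', -, rfl⟩ := hb
  exact minor_commute _ x y hxy _ _ _ _

theorem stepX (h : Setup q x y Z c μ ν μ' ν') (N : Submodule R B) (r s k : ℕ)
    (P S ly : PL n) (C A : 𝔽 n × 𝔽 n) (t : Fin n)
    (ht : cnt A.1 t < cnt C.1 t) (hv : Valid r s k (P ++ C :: A :: S) ly)
    (ih : IHp N q x y c r s k (P ++ C :: A :: S) ly) :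
    bst q x y c k (P ++ C :: A :: S) ly ∈ N := by
  have := pair_gen h.hx (LinearMap.mulRight R (Pm q y ly * c ^ k)) N P S C A t ht hv.sqx
  simp only [LinearMap.mulRight_apply, ← mul_assoc] at this
  refine this fun l h1 h2 h3 h4 => ?_
  refine ih k l ly ⟨h1.trans hv.lenx, hv.leny, h2, hv.sqy, by rw [h3, hv.totx], hv.toty⟩
    (Or.inr ⟨rfl, ?_⟩)
  rcases h4 with h4 | ⟨h4, h5, h6, h7⟩
  · left; omega
  · right; refine ⟨by omega, ?_⟩
    simp only [kk, h5, kS]; omega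

theorem stepY (h : Setup q x y Z c μ ν μ' ν') (N : Submodule R B) (r s k : ℕ)
    (P S lx : PL n) (C A : 𝔽 n × 𝔽 n) (t : Fin n)
    (ht : cnt A.1 t < cnt C.1 t) (hv : Valid r s k lx (P ++ C :: A :: S))
    (ih : IHp N q x y c r s k lx (P ++ C :: A :: S)) :
    bst q x y c k lx (P ++ C :: A :: S) ∈ N := by
  have := pair_gen h.hy (LinearMap.mulRight R (c ^ k) ∘ₗ LinearMap.mulLeft R (Pm q x lx))
    N P S C A t ht hv.sqy
  simp only [LinearMap.mulRight_apply, LinearMap.comp_apply, LinearMap.mulLeft_apply] at this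
  refine this fun l h1 h2 h3 h4 => ?_
  refine ih k lx l ⟨hv.lenx, h1.trans hv.leny, hv.sqx, h2, hv.totx, by rw [h3, hv.toty]⟩
    (Or.inr ⟨rfl, ?_⟩)
  rcases h4 with h4 | ⟨h4, h5, h6, h7⟩
  · left; omega
  · right; refine ⟨by omega, ?_⟩
    simp only [kk, h5, kS]
    have : 0 < (2 ^ n) ^ r := by positivity
    gcongr

theorem Dg_mul_x (hxy : ∀ i j k l, Commute (x i j) (y k l)) {a a' : ℕ} {m m' : B}
    (h : m ∈ Dg R x y a 0) (h' : m' ∈ Dg R x y a' 0) :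
    m * m' ∈ Dg R x y (a + a') 0 := by
  have := Dg_mul hxy h h'; rwa [add_zero] at this

theorem Dg_mul_y (hxy : ∀ i j k l, Commute (x i j) (y k l)) {a a' : ℕ} {m m' : B}
    (h : m ∈ Dg R x y 0 a) (h' : m' ∈ Dg R x y 0 a') :
    m * m' ∈ Dg R x y 0 (a + a') := by
  have := Dg_mul hxy h h'; rwa [add_zero] at this

theorem Pm_mem_x (hxy : ∀ i j k l, Commute (x i j) (y k l)) (l : PL n) :
    Pm q x l ∈ Dg R x y (tot l) 0 := by
  induction l with
  | nil => rw [Pm_nil]; exact Dg_one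
  | cons a l ih => rw [Pm_cons, tot_cons]; exact Dg_mul_x hxy (mq_x (q := q) hxy a.1 a.2) ih

theorem Pm_mem_y (hxy : ∀ i j k l, Commute (x i j) (y k l)) (l : PL n) :
    Pm q y l ∈ Dg R x y 0 (tot l) := by
  induction l with
  | nil => rw [Pm_nil]; exact Dg_one
  | cons a l ih => rw [Pm_cons, tot_cons]; exact Dg_mul_y hxy (mq_y (q := q) hxy a.1 a.2) ih

def wst (k : ℕ) (u : 𝕃 n) : PL n :=
  List.replicate k (∅, ∅) ++ u.map fun p => ({p.1}, {p.2})

theorem Pm_wst (k : ℕ) (u : 𝕃 n) : Pm q x (wst k u) = Wd x u := by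
  rw [wst, Pm_append]
  have : Pm q x (List.replicate k (∅, ∅)) = 1 := by simp [Pm, mq]
  rw [this, one_mul]
  simp [Pm, Wd, Function.comp_def, mq, minor_one]

theorem Valid_wst (k r s : ℕ) (u v : 𝕃 n) (hu : u.length + k = r)
    (hv : v.length + k = s) : Valid r s k (wst k u) (wst k v) := by
  have e : ∀ w : 𝕃 n, Sq (wst k w) := by
    intro w
    rw [wst, Sq_append]
    constructor
    · intro p hp; rw [List.eq_of_mem_replicate hp]
    · intro p hp
      simp only [List.mem_map] at hp
      obtain ⟨a, -, rfl⟩ := hp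
      simp
  have e' : ∀ w : 𝕃 n, tot (wst k w) = w.length := by
    intro w; rw [wst, tot_append]; simp [tot, Function.comp_def]
  refine ⟨?_, ?_, e u, e v, by rw [e']; exact hu, by rw [e']; exact hv⟩
  · simp [wst]; omega
  · simp [wst]; omega

theorem Dg_le (N : Submodule R B) (r s k a b : ℕ) (ha : a + k = r) (hb : b + k = s)
    (hN : ∀ lx ly, Valid r s k lx ly → bst q x y c k lx ly ∈ N) :
    ∀ E ∈ Dg R x y a b, E * c ^ k ∈ N := by
  intro E hE
  have : Dg R x y a b ≤ N.comap (LinearMap.mulRight R (c ^ k)) := by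
    rw [Dg, Submodule.span_le]
    rintro _ ⟨u, v, hu, hv, rfl⟩
    have := hN _ _ (Valid_wst k r s u v (by omega) (by omega))
    rw [bst, Pm_wst, Pm_wst] at this
    exact this
  exact this hE

theorem cnt_compl (I : 𝔽 n) (t : Fin n) : cnt I t + cnt Iᶜ t = t.1 + 1 := by
  unfold cnt
  rw [← card_union_of_disjoint (disjoint_filter_filter disjoint_compl_right),
    ← filter_union, union_compl]
  have : Finset.univ.filter (· ≤ t) = Finset.Iic t := by ext; simp
  rw [this, Fin.card_Iic]

theorem stepM (h : Setup q x y Z c μ ν μ' ν') (N : Submodule R B) (hZ : Z ≤ N) (r s k : ℕ)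
    (P Q : PL n) (a b : 𝔽 n × 𝔽 n) (t : Fin n)
    (ht : t.1 + 1 < cnt a.1 t + cnt b.1 t) (hv : Valid r s k (P ++ [a]) (Q ++ [b]))
    (ih : IHp N q x y c r s k (P ++ [a]) (Q ++ [b])) :
    bst q x y c k (P ++ [a]) (Q ++ [b]) ∈ N := by
  obtain ⟨a, a'⟩ := a
  obtain ⟨b, b'⟩ := b
  simp only at ht
  have hb : ∀ I J : 𝔽 n, bst q x y c k (P ++ [(J, a')]) (Q ++ [(I, b')]) =
      Pm q x P * Pm q y Q * (mq q x J a' * mq q y I b') * c ^ k := by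
    intro I J
    simp only [bst, Pm_append, Pm_cons, Pm_nil, mul_one]
    have : mq q x J a' * Pm q y Q = Pm q y Q * mq q x J a' := by
      have := (Pm_commute (q := q) h.hxy [(J, a')] Q).eq
      simpa [Pm_cons, Pm_nil] using this
    congr 1
    rw [mul_assoc, ← mul_assoc (mq q x J a'), this]; simp only [mul_assoc]
  have hcc := cnt_compl b t
  have hx1 := hv.totx
  have hy1 := hv.toty
  have hsx := hv.sqx
  have hsy := hv.sqy
  have hlx := hv.lenx
  have hly := hv.leny
  simp only [tot_append, tot_cons, Sq_append, Sq_cons, List.length_append, List.length_cons,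
    List.length_nil] at hx1 hy1 hsx hsy hlx hly
  simp only [tot, List.map_nil, List.sum_nil] at hx1 hy1
  have := h.mixstep N hZ (Pm q x P * Pm q y Q) (tot P) (tot Q) k ?_ bᶜ a a' b' t (by omega)
    hsx.2.1 ?_ ?_
  · rw [compl_compl, ← hb] at this; exact this
  · have := Dg_mul h.hxy (Pm_mem_x (q := q) h.hxy P) (Pm_mem_y (q := q) h.hxy Q)
    simpa using this
  · intro d1 d2 h1 h2
    rw [compl_compl] at h2
    refine Dg_le (q := q) N r s (k + 1) d1 d2 ?_ ?_ ?_
    · simp only [tot] at *; omega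
    · simp only [tot] at *; omega
    · intro lx ly hv'
      exact ih _ _ _ hv' (Or.inl (by omega))
  · intro I' J' h1 h2 h3 h4
    rw [← hb]
    have hI : I'ᶜ.card = b.card := by
      have := card_add_card_compl I'
      have := card_add_card_compl b
      omega
    refine ih _ _ _ ⟨by simpa using hlx, by simpa using hly, ?_, ?_, ?_, ?_⟩ (Or.inr ⟨rfl, Or.inr ⟨?_, ?_⟩⟩)
    · rw [Sq_append, Sq_cons]; exact ⟨hsx.1, h2.trans hsx.2.1, hsx.2.2⟩
    · rw [Sq_append, Sq_cons]; exact ⟨hsy.1, hI.trans hsy.2.1, hsy.2.2⟩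
    · rw [tot_append, tot_cons]; simp only [tot, List.map_nil, List.sum_nil]; omega
    · rw [tot_append, tot_cons]; simp only [tot, List.map_nil, List.sum_nil]; omega
    · simp only [ksh_append, ksh, h2, hI]
    · simp only [kk, List.map_append, List.map_cons, List.map_nil]
      gcongr ?_ + _
      simp only [kS]
      have hP : (P.map Prod.fst ++ [J']).length = r := by simpa using hlx
      have b1 := kx_lt (P.map Prod.fst ++ [J'])
      rw [hP] at b1
      have b2 : ky (Q.map Prod.fst ++ [I'ᶜ]) + 1 ≤ ky (Q.map Prod.fst ++ [b]) := by
        simp only [ky_append, ky, compl_compl, List.length_cons, List.length_nil, pow_zero, mul_one]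
        omega
      have b3 := Nat.mul_le_mul_right ((2 ^ n) ^ r) b2
      rw [add_mul, one_mul] at b3
      omega

structure Std1 (lx ly : List (𝔽 n)) : Prop where
  cx : lx.IsChain (fun b a => ∀ t, cnt b t ≤ cnt a t)
  cy : ly.IsChain (fun b a => ∀ t, cnt b t ≤ cnt a t)
  cm : ∀ P Q a b, lx = P ++ [a] → ly = Q ++ [b] → ∀ t, cnt a t + cnt b t ≤ t.1 + 1

theorem chain_fail (l : PL n)
    (h : ¬ (l.map Prod.fst).IsChain (fun b a => ∀ t, cnt b t ≤ cnt a t)) :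
    ∃ P C A S t, l = P ++ C :: A :: S ∧ cnt A.1 t < cnt C.1 t := by
  rw [List.isChain_map, List.isChain_iff_forall_rel_of_append_cons_cons] at h
  push Not at h
  obtain ⟨C, A, P, S, h1, t, h2⟩ := h
  exact ⟨P, C, A, S, t, h1, h2⟩

theorem map_concat (l : PL n) (P a) (h : l.map Prod.fst = P ++ [a]) :
    ∃ P' a', l = P' ++ [a'] ∧ a'.1 = a := by
  obtain ⟨l1, l2, rfl, h1, h2⟩ := List.map_eq_append_iff.1 h
  obtain ⟨a', rfl, h3⟩ := List.map_eq_singleton_iff.1 h2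
  exact ⟨l1, a', rfl, h3⟩

theorem step_left (h : Setup q x y Z c μ ν μ' ν') (N : Submodule R B) (hZ : Z ≤ N) (r s k : ℕ)
    (lx ly : PL n) (hv : Valid r s k lx ly) (ih : IHp N q x y c r s k lx ly)
    (hn : ¬ Std1 (lx.map Prod.fst) (ly.map Prod.fst)) : bst q x y c k lx ly ∈ N := by
  by_cases h1 : (lx.map Prod.fst).IsChain (fun b a => ∀ t, cnt b t ≤ cnt a t)
  · by_cases h2 : (ly.map Prod.fst).IsChain (fun b a => ∀ t, cnt b t ≤ cnt a t)
    · have h3 : ¬ ∀ P Q a b, lx.map Prod.fst = P ++ [a] → ly.map Prod.fst = Q ++ [b] →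
        ∀ t, cnt a t + cnt b t ≤ t.1 + 1 := fun h3 => hn ⟨h1, h2, h3⟩
      push Not at h3
      obtain ⟨P, Q, a, b, ha, hb, t, ht⟩ := h3
      obtain ⟨P, a, rfl, rfl⟩ := map_concat _ _ _ ha
      obtain ⟨Q, b, rfl, rfl⟩ := map_concat _ _ _ hb
      exact stepM h N hZ r s k P Q a b t ht hv ih
    · obtain ⟨P, C, A, S, t, rfl, ht⟩ := chain_fail _ h2
      exact stepY h N r s k P S lx C A t ht hv ih
  · obtain ⟨P, C, A, S, t, rfl, ht⟩ := chain_fail _ h1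
    exact stepX h N r s k P S ly C A t ht hv ih

def sw (l : PL n) : PL n := l.map Prod.swap

theorem sw_sw (l : PL n) : sw (sw l) = l := by simp [sw, Function.comp_def]

theorem Pm_sw (hx : IsQM q x) (l : PL n) : Pm q x.transpose (sw l) = Pm q x l := by
  simp only [Pm, sw, List.map_map, Function.comp_def, Prod.fst_swap, Prod.snd_swap, mq,
    ← minor_transpose hx]

theorem Sq_sw (l : PL n) (h : Sq l) : Sq (sw l) := by
  intro p hp
  simp only [sw, List.mem_map] at hp
  obtain ⟨a, ha, rfl⟩ := hp
  exact (h a ha).symm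

theorem tot_sw (l : PL n) (h : Sq l) : tot (sw l) = tot l := by
  induction l with
  | nil => rfl
  | cons a l ih =>
    rw [Sq_cons] at h
    rw [sw, List.map_cons, tot_cons, tot_cons, ← sw, ih h.2, Prod.fst_swap, h.1]

theorem ksh_sw (l : PL n) (h : Sq l) : ksh (sw l) = ksh l := by
  induction l with
  | nil => rfl
  | cons a l ih =>
    rw [Sq_cons] at h
    rw [sw, List.map_cons, ksh, ksh, ← sw, ih h.2, Prod.fst_swap, h.1]

theorem fst_sw (l : PL n) : (sw l).map Prod.fst = l.map Prod.snd := by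
  simp [sw, Function.comp_def]

theorem snd_sw (l : PL n) : (sw l).map Prod.snd = l.map Prod.fst := by
  simp [sw, Function.comp_def]

theorem kk_sw (r : ℕ) (lx ly : PL n) : kk r (sw lx) (sw ly) = kk r lx ly := by
  simp only [kk, fst_sw, snd_sw]; omega

theorem Valid.sw {r s k : ℕ} {lx ly : PL n} (h : Valid r s k lx ly) :
    Valid r s k (sw lx) (sw ly) :=
  ⟨by simpa [QM.sw] using h.lenx, by simpa [QM.sw] using h.leny, Sq_sw _ h.sqx, Sq_sw _ h.sqy,
    by rw [tot_sw _ h.sqx]; exact h.totx, by rw [tot_sw _ h.sqy]; exact h.toty⟩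

theorem step_right (h : Setup q x y Z c μ ν μ' ν') (N : Submodule R B) (hZ : Z ≤ N) (r s k : ℕ)
    (lx ly : PL n) (hv : Valid r s k lx ly) (ih : IHp N q x y c r s k lx ly)
    (hn : ¬ Std1 (lx.map Prod.snd) (ly.map Prod.snd)) : bst q x y c k lx ly ∈ N := by
  have hb : ∀ k lx ly, bst q x.transpose y.transpose c k (sw lx) (sw ly) = bst q x y c k lx ly := by
    intro k lx ly
    rw [bst, bst, Pm_sw h.hx, Pm_sw h.hy]
  rw [← hb]
  refine step_left h.transpose N hZ r s k (sw lx) (sw ly) hv.sw ?_ (by rwa [fst_sw, fst_sw])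
  intro k' lx' ly' hv' hl
  have := ih k' (sw lx') (sw ly') hv'.sw ?_
  · rw [← hb, sw_sw, sw_sw] at this; exact this
  · unfold Less at hl ⊢
    rw [ksh_sw _ hv'.sqx, ksh_sw _ hv'.sqy, kk_sw]
    rwa [ksh_sw _ hv.sqx, ksh_sw _ hv.sqy, kk_sw] at hl

structure Stnd (r s k : ℕ) (lx ly : PL n) : Prop where
  v : Valid r s k lx ly
  l : Std1 (lx.map Prod.fst) (ly.map Prod.fst)
  r : Std1 (lx.map Prod.snd) (ly.map Prod.snd)

theorem straighten (h : Setup q x y Z c μ ν μ' ν') (N : Submodule R B) (hZ : Z ≤ N) (r s : ℕ)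
    (hN : ∀ k lx ly, Stnd r s k lx ly → bst q x y c k lx ly ∈ N) :
    ∀ k lx ly, Valid r s k lx ly → bst q x y c k lx ly ∈ N := by
  suffices H : ∀ (z : ℕ ×ₗ ℕ ×ₗ ℕ) k lx ly, z = toLex (r - k, toLex (ksh lx + ksh ly, kk r lx ly)) →
      Valid r s k lx ly → bst q x y c k lx ly ∈ N from fun k lx ly hv => H _ k lx ly rfl hv
  intro z
  induction z using WellFoundedLT.induction with
  | ind z ih =>
    intro k lx ly hz hv
    subst hz
    have ih' : IHp N q x y c r s k lx ly := by
      intro k' lx' ly' hv' hl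
      refine ih _ ?_ k' lx' ly' rfl hv'
      rw [Prod.Lex.toLex_lt_toLex, Prod.Lex.toLex_lt_toLex]
      have := hv'.totx
      have := hv.totx
      rcases hl with hl | ⟨rfl, hl⟩
      · left; simp only; omega
      · right; exact ⟨rfl, hl⟩
    by_cases h1 : Std1 (lx.map Prod.fst) (ly.map Prod.fst)
    · by_cases h2 : Std1 (lx.map Prod.snd) (ly.map Prod.snd)
      · exact hN _ _ _ ⟨hv, h1, h2⟩
      · exact step_right h N hZ r s k lx ly hv ih' h2
    · exact step_left h N hZ r s k lx ly hv ih' h1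

theorem straighten_words (h : Setup q x y Z c μ ν μ' ν') (N : Submodule R B) (hZ : Z ≤ N) (r s : ℕ)
    (hN : ∀ k lx ly, Stnd r s k lx ly → bst q x y c k lx ly ∈ N)
    (u v : 𝕃 n) (hu : u.length = r) (hv : v.length = s) :
    Wd x u * Wd y v ∈ N := by
  have := straighten h N hZ r s hN 0 _ _ (Valid_wst 0 r s u v hu hv)
  simpa [bst, Pm_wst] using this

end seven
section eight
variable {R : Type*} [CommRing R] {n : ℕ} {B : Type*} [Ring B] [Algebra R B]
variable {q : Rˣ} {x y : 𝕄 n B}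

def T1 (x y : 𝕄 n B) : 𝕄 n B :=
  fun i j => ∑ k, x i k * y j k

def T2 (q : Rˣ) (x y : 𝕄 n B) : 𝕄 n B :=
  fun i j => ∑ k : Fin n, ((q ^ (2 * k.1) : Rˣ) : R) • (x k i * y k j)

theorem IsQM.scale {X : 𝕄 n B} (h : IsQM q X) (w : Fin n → R) :
    IsQM q (fun i j => w i • X i j) where
  col i j k hij := by
    simp only [smul_mul_smul_comm, h.col i j k hij, smul_smul]; congr 1; ring
  row k i j hij := by
    simp only [smul_mul_smul_comm, h.row k i j hij, smul_smul]; congr 1; ring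
  comm i j k l h1 h2 := by
    simp only [smul_mul_smul_comm, h.comm i j k l h1 h2]; rw [mul_comm]
  qcomm i j k l h1 h2 := by
    simp only [smul_mul_smul_comm, h.qcomm i j k l h1 h2]; module

theorem T1_qm (hx : IsQM q x) (hy : IsQM q y) (hxy : ∀ i j k l, Commute (x i j) (y k l)) :
    IsQM q (T1 x y) := by
  have := hx.mul hy.transpose (fun i j k l => hxy i j l k)
  have e : x * y.transpose = T1 x y := by ext i j; simp [Matrix.mul_apply, T1]
  rwa [e] at this

theorem T2_qm (hx : IsQM q x) (hy : IsQM q y) (hxy : ∀ i j k l, Commute (x i j) (y k l)) :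
    IsQM q (T2 q x y) := by
  have := hx.transpose.mul (hy.scale (fun k => ((q ^ (2 * k.1) : Rˣ) : R)))
    (fun i j k l => (hxy j i k l).smul_right _)
  have e : x.transpose * (Matrix.of fun i j => ((q ^ (2 * i.1) : Rˣ) : R) • y i j) = T2 q x y := by
    ext i j; simp [Matrix.mul_apply, T2]
  rw [← e]; exact this

def cT (q : Rˣ) (x y : 𝕄 n B) (i : Fin n) : B :=
  (((q ^ (2 * i.1))⁻¹ : Rˣ) : R) • T2 q x y i i

inductive Zg (q : Rˣ) (x y : 𝕄 n B) : B → Prop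
  | g1 (i j : Fin n) (h : i ≠ j) : Zg q x y (T1 x y i j)
  | g2 (i j : Fin n) (h : i ≠ j) : Zg q x y (T2 q x y i j)
  | g3 (i j : Fin n) : Zg q x y (cT q x y i - T1 x y j j)

def Zq (q : Rˣ) (x y : 𝕄 n B) : Submodule R B :=
  Submodule.span R {m | ∃ a g, Zg q x y g ∧ m = a * g}

theorem Zq_left (a : B) : ∀ z ∈ Zq q x y, a * z ∈ Zq q x y := by
  intro z hz
  have : Zq q x y ≤ (Zq q x y).comap (LinearMap.mulLeft R a) := by
    conv_lhs => rw [Zq]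
    rw [Submodule.span_le]
    rintro _ ⟨b, g, hg, rfl⟩
    refine Submodule.subset_span ⟨a * b, g, hg, ?_⟩
    simp [mul_assoc]
  exact this hz

theorem Zq_gen {g : B} (h : Zg q x y g) : g ∈ Zq q x y :=
  Submodule.subset_span ⟨1, g, h, by simp⟩

theorem qm_unit {T : 𝕄 n B} (hT : IsQM q T) (i j : Fin n) (h : i ≠ j) :
    ∃ u : R, T i j * T i i = u • (T i i * T i j) := by
  rcases lt_or_gt_of_ne h with h | h
  · refine ⟨((q⁻¹ : Rˣ) : R), ?_⟩
    rw [hT.row i i j h, smul_smul, Units.inv_mul, one_smul]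
  · exact ⟨q, hT.row i j i h⟩

theorem qm_diag {T : 𝕄 n B} (hT : IsQM q T) (Z : Submodule R B)
    (hl : ∀ a, ∀ z ∈ Z, a * z ∈ Z) (hZ : ∀ i j, i ≠ j → T i j ∈ Z) (i j : Fin n) :
    T i i * T j j - T j j * T i i ∈ Z := by
  have : ∀ i j : Fin n, i < j → T i i * T j j - T j j * T i i ∈ Z := by
    intro i j h
    rw [hT.qcomm i i j j h h, add_sub_cancel_left]
    exact Z.smul_mem _ (hl _ _ (hZ _ _ h.ne'))
  rcases lt_trichotomy i j with h | rfl | h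
  · exact this i j h
  · simp
  · rw [← neg_sub]; exact Z.neg_mem (this j i h)

theorem sum_split (o : Fin n) (f : Fin n → B) :
    ∑ i, f i = f o + ∑ i ∈ Finset.univ.erase o, f i :=
  (add_sum_erase _ _ (mem_univ o)).symm

theorem corner (hx : IsQM q x) (hy : IsQM q y) (hxy : ∀ i j k l, Commute (x i j) (y k l))
    (o : Fin n) (ho : o.1 = 0) :
    cT q x y o * T1 x y o o - T1 x y o o * T1 x y o o ∈ Zq q x y := by
  have ho' : ∀ b : Fin n, b ∈ Finset.univ.erase o → o < b := by
    intro b hb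
    have := ne_of_mem_erase hb
    rw [Fin.lt_def, ho]
    have : b.1 ≠ o.1 := fun h => this (Fin.ext h)
    omega
  have hsw : ∀ i j k l i' j' k' l', x i j * y k l * (x i' j' * y k' l') =
      (x i j * x i' j') * (y k l * y k' l') := by
    intro i j k l i' j' k' l'
    simp only [mul_assoc]
    rw [← mul_assoc (y k l), ← (hxy i' j' k l).eq, mul_assoc]
  set c := T1 x y o o with hc
  set d := cT q x y o with hd
  set W : Fin n → R := fun l => ((q ^ (2 * l.1) : Rˣ) : R) with hW
  have ec : c = ∑ b, x o b * y o b := rfl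
  have ed : d = ∑ l, W l • (x l o * y l o) := by
    rw [hd, cT, T2, ho]; simp [hW]
  have hdc : d - c ∈ Zq q x y := Zq_gen (Zg.g3 o o)
  set p := x o o * y o o with hp
  have ec' : c = p + ∑ b ∈ Finset.univ.erase o, x o b * y o b := by rw [ec, sum_split o]
  have ed' : d = p + ∑ l ∈ Finset.univ.erase o, W l • (x l o * y l o) := by
    rw [ed, sum_split o]; simp [hW, ho, hp]
  set c' := ∑ b ∈ Finset.univ.erase o, x o b * y o b with hc'
  set d' := ∑ l ∈ Finset.univ.erase o, W l • (x l o * y l o) with hd'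
  have k1 : c' * d' = d' * c' := by
    rw [hc', hd', sum_mul_sum, sum_mul_sum, sum_comm]
    refine sum_congr rfl fun l hl => sum_congr rfl fun b hb => ?_
    rw [mul_smul_comm, smul_mul_assoc, hsw, hsw, hx.comm o b l o (ho' l hl) (ho' b hb),
      hy.comm o b l o (ho' l hl) (ho' b hb)]
  have q1 : ((q⁻¹ : Rˣ) : R) * (q : R) = 1 := Units.inv_mul q
  set v : R := ((q⁻¹ : Rˣ) : R) * ((q⁻¹ : Rˣ) : R) with hv
  have k2 : c' * p = v • (p * c') := by
    rw [hc', hp, mul_sum, sum_mul, smul_sum]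
    refine sum_congr rfl fun b hb => ?_
    rw [hsw, hsw, hx.row o o b (ho' b hb), hy.row o o b (ho' b hb), smul_mul_smul_comm, smul_smul]
    rw [show v * ((q : R) * q) = 1 by rw [hv]; linear_combination (((q⁻¹ : Rˣ) : R) * q + 1) * q1,
      one_smul]
  have k3 : d' * p = v • (p * d') := by
    rw [hd', hp, mul_sum, sum_mul, smul_sum]
    refine sum_congr rfl fun b hb => ?_
    rw [smul_mul_assoc, mul_smul_comm, smul_comm v, hsw, hsw, hx.col o b o (ho' b hb),
      hy.col o b o (ho' b hb), smul_mul_smul_comm, smul_smul v]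
    rw [show v * ((q : R) * q) = 1 by rw [hv]; linear_combination (((q⁻¹ : Rˣ) : R) * q + 1) * q1,
      one_smul]
  have fin : d * c - c * c = v • (p * (d - c)) + c' * (d - c) := by
    rw [ec', ed']
    have : (p + d') * (p + c') - (p + c') * (p + c') =
       d' * p + d' * c' - c' * p - c' * c' := by noncomm_ring
    rw [this, k3, k2, ← k1]
    simp only [mul_add, mul_sub, smul_add, smul_sub]
    abel
  rw [fin]
  exact Submodule.add_mem _ (Submodule.smul_mem _ _ (Zq_left _ _ hdc)) (Zq_left _ _ hdc)

theorem setup (hx : IsQM q x) (hy : IsQM q y) (hxy : ∀ i j k l, Commute (x i j) (y k l))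
    (o : Fin n) (ho : o.1 = 0) :
    Setup q x y (Zq q x y) (T1 x y o o) (fun k => q ^ (2 * k.1)) (fun k => q ^ (2 * k.1))
      (fun _ => 1) (fun _ => 1) := by
  have g1 : ∀ i j, i ≠ j → T1 x y i j ∈ Zq q x y := fun i j h => Zq_gen (Zg.g1 i j h)
  have g2 : ∀ i j, i ≠ j → T2 q x y i j ∈ Zq q x y := fun i j h => Zq_gen (Zg.g2 i j h)
  have g3 : ∀ i j, cT q x y i - T1 x y j j ∈ Zq q x y := fun i j => Zq_gen (Zg.g3 i j)
  set c := T1 x y o o with hc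
  have d1 : ∀ i, c - T1 x y i i ∈ Zq q x y := fun i => by
    have := Submodule.sub_mem _ (g3 o i) (g3 o o)
    simpa using this
  have hT2 : ∀ i, T2 q x y i i = ((q ^ (2 * i.1) : Rˣ) : R) • cT q x y i := by
    intro i; rw [cT, smul_smul, Units.mul_inv, one_smul]
  have d2 : ∀ i, c - cT q x y i ∈ Zq q x y := fun i => by
    rw [← neg_sub]; exact Submodule.neg_mem _ (g3 i o)
  have r1 : ∀ i j, T1 x y i i * c - T1 x y j j * c ∈ Zq q x y := by
    intro i j
    have e : T1 x y i i * c - T1 x y j j * c = T1 x y i i * (c - T1 x y j j) -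
      T1 x y j j * (c - T1 x y i i) + (T1 x y i i * T1 x y j j - T1 x y j j * T1 x y i i) := by
      noncomm_ring
    rw [e]
    exact Submodule.add_mem _ (Submodule.sub_mem _ (Zq_left _ _ (d1 _)) (Zq_left _ _ (d1 _)))
      (qm_diag (T1_qm hx hy hxy) _ Zq_left g1 i j)
  have r2 : ∀ i j, cT q x y i * c - cT q x y j * c ∈ Zq q x y := by
    intro i j
    have e : cT q x y i * c - cT q x y j * c = cT q x y i * (c - cT q x y j) -
      cT q x y j * (c - cT q x y i) + (cT q x y i * cT q x y j - cT q x y j * cT q x y i) := by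
      noncomm_ring
    rw [e]
    refine Submodule.add_mem _ (Submodule.sub_mem _ (Zq_left _ _ (d2 _)) (Zq_left _ _ (d2 _))) ?_
    rw [cT, cT, smul_mul_smul_comm, smul_mul_smul_comm, mul_comm (((q ^ (2 * j.1))⁻¹ : Rˣ) : R),
      ← smul_sub]
    exact Submodule.smul_mem _ _ (qm_diag (T2_qm hx hy hxy) _ Zq_left g2 i j)
  have hg : ∀ g, Zg q x y g → g * c ∈ Zq q x y := by
    intro g hg
    cases hg with
    | g1 i j h =>
      obtain ⟨u, hu⟩ := qm_unit (T1_qm hx hy hxy) i j h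
      have e : T1 x y i j * c = T1 x y i j * (c - T1 x y i i) + u • (T1 x y i i * T1 x y i j) := by
        rw [← hu]; noncomm_ring
      rw [e]
      exact Submodule.add_mem _ (Zq_left _ _ (d1 _)) (Submodule.smul_mem _ _ (Zq_left _ _ (g1 i j h)))
    | g2 i j h =>
      obtain ⟨u, hu⟩ := qm_unit (T2_qm hx hy hxy) i j h
      have e : T2 q x y i j * c = T2 q x y i j * (c - cT q x y i) +
          (((q ^ (2 * i.1))⁻¹ : Rˣ) : R) • u • (T2 q x y i i * T2 q x y i j) := by
        rw [← hu, cT, mul_sub, mul_smul_comm]; abel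
      rw [e]
      exact Submodule.add_mem _ (Zq_left _ _ (d2 _)) (Submodule.smul_mem _ _
        (Submodule.smul_mem _ _ (Zq_left _ _ (g2 i j h))))
    | g3 i j =>
      have e : (cT q x y i - T1 x y j j) * c = (cT q x y i * c - cT q x y o * c) +
        (cT q x y o * c - c * c) + (c * c - T1 x y j j * c) := by noncomm_ring
      rw [e]
      exact Submodule.add_mem _ (Submodule.add_mem _ (r2 _ _) (corner hx hy hxy o ho)) (r1 _ _)
  refine ⟨hx, hy, hxy, Zq_left, ?_, ?_, ?_⟩
  · intro z hz
    have : Zq q x y ≤ (Zq q x y).comap (LinearMap.mulRight R c) := by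
      conv_lhs => rw [Zq]
      rw [Submodule.span_le]
      rintro _ ⟨b, g, h, rfl⟩
      have := Zq_left b _ (hg g h)
      simpa [mul_assoc] using this
    exact this hz
  · intro i j
    simp only [Units.val_one, one_smul]
    split_ifs with h
    · subst h
      rw [← neg_sub]
      exact Submodule.neg_mem _ (d1 i)
    · rw [sub_zero]; exact g1 i j h
  · intro i j
    change T2 q x y i j - _ ∈ _
    split_ifs with h
    · subst h
      rw [hT2, ← smul_sub]
      exact Submodule.smul_mem _ _ (g3 i o)
    · rw [sub_zero]; exact g2 i j h

end eight
section nine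
variable {R : Type*} [CommRing R]

abbrev DD (R : Type*) [CommRing R] := Module.End R ((ℕ → ℕ) →₀ R)

noncomputable def mop (c : (ℕ → ℕ) → R) (w : ℕ → ℕ) : DD R :=
  Finsupp.lsum R fun m => (c m) • Finsupp.lsingle (m + w)

theorem mop_single (c : (ℕ → ℕ) → R) (w m : ℕ → ℕ) (b : R) :
    mop c w (Finsupp.single m b) = Finsupp.single (m + w) (c m * b) := by
  simp [mop]

theorem DD_ext {f g : DD R} (h : ∀ m, f (Finsupp.single m 1) = g (Finsupp.single m 1)) : f = g :=
  Finsupp.lhom_ext' fun m => LinearMap.ext_ring (h m)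

theorem mop_mul (c c' : (ℕ → ℕ) → R) (w w' : ℕ → ℕ) :
    mop c w * mop c' w' = mop (fun m => c (m + w') * c' m) (w + w') := by
  apply DD_ext; intro m
  simp only [Module.End.mul_apply, mop_single, mul_one]
  rw [add_assoc, add_comm w' w]

theorem mop_one : mop (fun _ => (1 : R)) 0 = 1 := by
  apply DD_ext; intro m; simp [mop_single]

theorem mop_smul (a : R) (c : (ℕ → ℕ) → R) (w) : a • mop c w = mop (fun m => a * c m) w := by
  apply DD_ext; intro m; simp [mop_single]

theorem mop_comm {c c' : (ℕ → ℕ) → R} {w w' : ℕ → ℕ} (h : ∀ m, c (m + w') = c m)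
    (h' : ∀ m, c' (m + w) = c' m) : Commute (mop c w) (mop c' w') := by
  unfold Commute SemiconjBy
  rw [mop_mul, mop_mul, add_comm w w']
  congr 1; ext m; rw [h, h', mul_comm]

noncomputable def Sp (R : Type*) [CommRing R] (m : ℕ → ℕ) (P : (ℕ → ℕ) → Prop) :
    Submodule R ((ℕ → ℕ) →₀ R) :=
  Submodule.span R ((fun w => Finsupp.single (m + w) (1 : R)) '' {w | P w})

theorem Sp_single {m : ℕ → ℕ} {P : (ℕ → ℕ) → Prop} {w : ℕ → ℕ} (h : P w) (a : R) :
    Finsupp.single (m + w) a ∈ Sp R m P := by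
  have : Finsupp.single (m + w) a = a • Finsupp.single (m + w) (1 : R) := by simp
  rw [this]
  exact Submodule.smul_mem _ _ (Submodule.subset_span ⟨w, h, rfl⟩)

theorem Sp_mono {m : ℕ → ℕ} {P P' : (ℕ → ℕ) → Prop} (h : ∀ w, P w → P' w) : Sp R m P ≤ Sp R m P' :=
  Submodule.span_mono (Set.image_mono h)

def Lt (a b : ℕ → ℕ) : Prop := toLex a < toLex b

theorem Lt.add_right {a b : ℕ → ℕ} (h : Lt a b) (c : ℕ → ℕ) : Lt (a + c) (b + c) := by
  obtain ⟨i, h1, h2⟩ := h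
  refine ⟨i, fun j hj => ?_, ?_⟩
  · have := h1 j hj
    simp only [Pi.toLex_apply, Pi.add_apply] at this ⊢; rw [this]
  · simp only [Pi.toLex_apply, Pi.add_apply] at h2 ⊢; omega

theorem Lt.add_left {a b : ℕ → ℕ} (h : Lt a b) (c : ℕ → ℕ) : Lt (c + a) (c + b) := by
  rw [add_comm c a, add_comm c b]; exact h.add_right c

theorem Lt.trans {a b c : ℕ → ℕ} (h : Lt a b) (h' : Lt b c) : Lt a c := lt_trans h h'

def Sup (f : DD R) (P : (ℕ → ℕ) → Prop) : Prop := ∀ m, f (Finsupp.single m 1) ∈ Sp R m P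

def Tri (f : DD R) (w : ℕ → ℕ) : Prop :=
  ∀ m, ∃ u : Rˣ, f (Finsupp.single m 1) - Finsupp.single (m + w) (u : R) ∈ Sp R m (fun w' => Lt w' w)

theorem Sp_shift {P P' : (ℕ → ℕ) → Prop} (m b : ℕ → ℕ) (h : ∀ a, P a → P' (a + b)) :
    Sp R (m + b) P ≤ Sp R m P' := by
  conv_lhs => unfold Sp
  rw [Submodule.span_le]
  rintro _ ⟨a, ha, rfl⟩
  have e : m + b + a = m + (a + b) := by rw [add_assoc, add_comm b a]
  have := Sp_single (R := R) (m := m) (h a ha) 1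
  rw [← e] at this
  exact this

theorem Sup.apply {f : DD R} {P P' P'' : (ℕ → ℕ) → Prop} (h : Sup f P) {m : ℕ → ℕ}
    {v} (hv : v ∈ Sp R m P') (h2 : ∀ a b, P a → P' b → P'' (a + b)) : f v ∈ Sp R m P'' := by
  have : Sp R m P' ≤ (Sp R m P'').comap f := by
    unfold Sp; rw [Submodule.span_le]
    rintro _ ⟨b, hb, rfl⟩
    exact Sp_shift m b (fun a ha => h2 a b ha hb) (h (m + b))
  exact this hv

theorem Sup.mul {f g : DD R} {P P' P'' : (ℕ → ℕ) → Prop} (h : Sup f P) (h' : Sup g P')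
    (h2 : ∀ a b, P a → P' b → P'' (a + b)) : Sup (f * g) P'' := fun m => h.apply (h' m) h2

theorem Sup.add {f g : DD R} {P : (ℕ → ℕ) → Prop} (h : Sup f P) (h' : Sup g P) : Sup (f + g) P :=
  fun m => Submodule.add_mem _ (h m) (h' m)

theorem Sup.mono {f : DD R} {P P' : (ℕ → ℕ) → Prop} (h : Sup f P) (h' : ∀ w, P w → P' w) :
    Sup f P' := fun m => Sp_mono h' (h m)

theorem Sup_zero {P : (ℕ → ℕ) → Prop} : Sup (0 : DD R) P := fun _ => Submodule.zero_mem _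

theorem Sup_sum {ι : Type*} (s : Finset ι) (f : ι → DD R) {P : (ℕ → ℕ) → Prop}
    (h : ∀ i ∈ s, Sup (f i) P) : Sup (∑ i ∈ s, f i) P := by
  classical
  induction s using Finset.induction_on with
  | empty => simpa using Sup_zero
  | insert a s ha ih =>
    rw [sum_insert ha]
    exact (h a (mem_insert_self _ _)).add (ih fun i hi => h i (mem_insert_of_mem hi))

theorem Sup.smul {f : DD R} {P : (ℕ → ℕ) → Prop} (h : Sup f P) (a : R) : Sup (a • f) P :=
  fun m => Submodule.smul_mem _ a (h m)

theorem Tri.sup {f : DD R} {w} (h : Tri f w) : Sup f (fun w' => Lt w' w ∨ w' = w) := by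
  intro m
  obtain ⟨u, hu⟩ := h m
  have := Submodule.add_mem _ (Sp_mono (fun _ h => Or.inl h) hu)
    (Sp_single (m := m) (P := fun w' => Lt w' w ∨ w' = w) (Or.inr rfl) (u : R))
  simpa using this

theorem Tri.mul {f g : DD R} {w w'} (h : Tri f w) (h' : Tri g w') : Tri (f * g) (w + w') := by
  intro m
  obtain ⟨u', hu'⟩ := h' m
  obtain ⟨u, hu⟩ := h (m + w')
  refine ⟨u * u', ?_⟩
  have h1 : f (g (Finsupp.single m 1) - Finsupp.single (m + w') (u' : R)) ∈
      Sp R m (fun a => Lt a (w + w')) := h.sup.apply hu' (by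
    rintro a b (ha | rfl) hb
    · exact (hb.add_left a).trans (ha.add_right _)
    · exact hb.add_left a)
  have h2 : (u' : R) • (f (Finsupp.single (m + w') 1) - Finsupp.single (m + w' + w) (u : R)) ∈
      Sp R m (fun a => Lt a (w + w')) := by
    refine Submodule.smul_mem (Sp R m (fun a => Lt a (w + w'))) (u' : R) ?_
    exact Sp_shift (P := fun a => Lt a w) (P' := fun a => Lt a (w + w')) m w'
      (fun a (ha : Lt a w) => Lt.add_right ha w') hu
  have h3 := Submodule.add_mem _ h1 h2
  have e : Finsupp.single (m + w') (u' : R) = (u' : R) • Finsupp.single (m + w') (1 : R) := by simp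
  have e2 : (f * g) (Finsupp.single m 1) - Finsupp.single (m + (w + w')) ((u * u' : Rˣ) : R) =
      f (g (Finsupp.single m 1) - Finsupp.single (m + w') (u' : R)) +
      (u' : R) • (f (Finsupp.single (m + w') 1) - Finsupp.single (m + w' + w) (u : R)) := by
    rw [map_sub, e, map_smul, smul_sub, Module.End.mul_apply, Finsupp.smul_single, smul_eq_mul,
      Units.val_mul, add_assoc, add_comm w' w, mul_comm (u : R)]
    abel
  rw [e2]; exact h3

theorem Tri.add {f g : DD R} {w} (h : Tri f w) (h' : Sup g (fun w' => Lt w' w)) : Tri (f + g) w := by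
  intro m
  obtain ⟨u, hu⟩ := h m
  refine ⟨u, ?_⟩
  have := Submodule.add_mem _ hu (h' m)
  convert this using 1
  rw [LinearMap.add_apply]; abel

theorem Tri_mop (c : (ℕ → ℕ) → R) (w) (h : ∀ m, IsUnit (c m)) : Tri (mop c w) w := by
  intro m
  obtain ⟨u, hu⟩ := h m
  refine ⟨u, ?_⟩
  rw [mop_single, mul_one, hu, sub_self]; exact Submodule.zero_mem _

theorem Sup_mop (c : (ℕ → ℕ) → R) (w) (P : (ℕ → ℕ) → Prop) (h : P w) : Sup (mop c w) P := by
  intro m; rw [mop_single]; exact Sp_single h _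

theorem Tri_one : Tri (1 : DD R) 0 := by
  rw [← mop_one]; exact Tri_mop _ _ fun _ => isUnit_one

theorem Tri.smul {f : DD R} {w} (h : Tri f w) (a : Rˣ) : Tri ((a : R) • f) w := by
  intro m
  obtain ⟨u, hu⟩ := h m
  refine ⟨a * u, ?_⟩
  have := Submodule.smul_mem _ (a : R) hu
  convert this using 1
  rw [smul_sub, LinearMap.smul_apply, Finsupp.smul_single, smul_eq_mul, Units.val_mul]

end nine
section ten
variable {n : ℕ}

def cc (J : 𝔽 n) (i : ℕ) : ℕ := (J.filter (fun j => j.1 < i)).card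

theorem cc_zero (J : 𝔽 n) : cc J 0 = 0 := by simp [cc]

theorem cc_succ (J : 𝔽 n) (i : Fin n) :
    cc J (i.1 + 1) = cc J i.1 + if i ∈ J then 1 else 0 := by
  unfold cc
  have : J.filter (fun j => j.1 < i.1 + 1) = J.filter (fun j => j.1 < i.1) ∪ J.filter (fun j => j = i) := by
    ext j; simp only [mem_filter, mem_union, Fin.ext_iff]
    constructor
    · rintro ⟨a, b⟩; by_cases j.1 = i.1 <;> [right; left] <;> exact ⟨a, by omega⟩
    · rintro (⟨a, b⟩ | ⟨a, b⟩) <;> exact ⟨a, by omega⟩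
  rw [this, card_union_of_disjoint, filter_eq']
  · split_ifs <;> simp
  · rw [disjoint_left]; simp only [mem_filter, Fin.ext_iff]; omega

theorem cc_n (J : 𝔽 n) : cc J n = J.card := by
  unfold cc; rw [filter_true_of_mem]; intro j _; exact j.2

theorem cc_mono (J : 𝔽 n) {i j : ℕ} (h : i ≤ j) : cc J i ≤ cc J j :=
  card_le_card fun x hx => by
    simp only [mem_filter] at hx ⊢; exact ⟨hx.1, by omega⟩

theorem cc_le (J : 𝔽 n) (i : ℕ) : cc J i ≤ i := by
  have : cc J i ≤ (Finset.range i).card := by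
    unfold cc
    apply card_le_card_of_injOn (fun j => j.1)
    · intro j hj; simp only [coe_filter, Set.mem_ofPred_eq] at hj; simpa using hj.2
    · intro a _ b _ h; exact Fin.ext h
  simpa using this

theorem cc_le_card (J : 𝔽 n) (i : ℕ) : cc J i ≤ J.card := card_filter_le _ _

def St (J : 𝔽 n) (a p : ℕ) : 𝔽 n :=
  Finset.univ.filter fun i => (i.1 < a ∧ i.1 < J.card) ∨ (i ∈ J ∧ a < cc J i) ∨
    (a < J.card ∧ ((i.1 = p ∧ cc J p ≤ a) ∨ (i ∈ J ∧ cc J i = a ∧ i.1 < p)))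

theorem mem_St (J : 𝔽 n) (a p : ℕ) (i : Fin n) : i ∈ St J a p ↔
  ((i.1 < a ∧ i.1 < J.card) ∨ (i ∈ J ∧ a < cc J i) ∨
    (a < J.card ∧ ((i.1 = p ∧ cc J p ≤ a) ∨ (i ∈ J ∧ cc J i = a ∧ i.1 < p)))) := by
  simp [St]

theorem St_move (J : 𝔽 n) (a : ℕ) (p p' : Fin n) (hp : p'.1 = p.1 + 1) (hap : a ≤ p.1)
    (hk : a < J.card) (hc : cc J (p.1 + 1) ≤ a) :
    p' ∈ St J a (p.1 + 1) ∧ p ∉ St J a (p.1 + 1) ∧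
      St J a p.1 = insert p ((St J a (p.1 + 1)).erase p') := by
  have h1 := cc_succ J p
  have h2 : cc J p'.1 = cc J (p.1 + 1) := by rw [hp]
  refine ⟨?_, ?_, ?_⟩
  · rw [mem_St]; right; right; exact ⟨hk, Or.inl ⟨hp, hc⟩⟩
  · rw [mem_St]
    split_ifs at h1 with h
    · rintro (h3 | h3 | ⟨-, h3 | h3⟩) <;> omega
    · rintro (h3 | h3 | ⟨-, h3 | h3⟩)
      · omega
      · exact h h3.1
      · omega
      · exact h h3.1
  · ext i
    rw [mem_insert, mem_erase, mem_St, mem_St, Fin.ext_iff, Ne, Fin.ext_iff]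
    by_cases e : i.1 = p.1
    · have : i = p := Fin.ext e
      subst this
      constructor
      · intro _; left; rfl
      · intro _; right; right; refine ⟨hk, Or.inl ⟨rfl, ?_⟩⟩; omega
    · by_cases e' : i.1 = p'.1
      · have h3 : cc J i.1 = cc J (p.1 + 1) := by rw [e', hp]
        constructor
        · rintro (h | h | ⟨-, h | h⟩) <;> omega
        · rintro (h | h) <;> omega
      · constructor
        · rintro (h | h | ⟨h0, h | h⟩)
          · exact Or.inr ⟨e', Or.inl h⟩
          · exact Or.inr ⟨e', Or.inr (Or.inl h)⟩
          · omega
          · exact Or.inr ⟨e', Or.inr (Or.inr ⟨h0, Or.inr ⟨h.1, h.2.1, by omega⟩⟩)⟩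
        · rintro (h | ⟨-, h | h | ⟨h0, h | h⟩⟩)
          · omega
          · exact Or.inl h
          · exact Or.inr (Or.inl h)
          · omega
          · exact Or.inr (Or.inr ⟨h0, Or.inr ⟨h.1, h.2.1, by omega⟩⟩)

theorem St_stay (J : 𝔽 n) (a : ℕ) (p : Fin n)
    (hc : ¬ (a < J.card ∧ cc J (p.1 + 1) ≤ a)) : St J a (p.1 + 1) = St J a p.1 := by
  have h1 := cc_succ J p
  ext i
  rw [mem_St, mem_St]
  by_cases hk : a < J.card
  · have hc' : a < cc J (p.1 + 1) := by by_contra hh; exact hc ⟨hk, by omega⟩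
    constructor
    · rintro (h | h | ⟨h0, h | h⟩)
      · exact Or.inl h
      · exact Or.inr (Or.inl h)
      · omega
      · refine Or.inr (Or.inr ⟨h0, ?_⟩)
        by_cases e : i.1 = p.1
        · left; rw [e] at h; omega
        · right; exact ⟨h.1, h.2.1, by omega⟩
    · rintro (h | h | ⟨h0, h | h⟩)
      · exact Or.inl h
      · exact Or.inr (Or.inl h)
      · have : i = p := Fin.ext h.1
        subst this
        split_ifs at h1 with hi
        · exact Or.inr (Or.inr ⟨h0, Or.inr ⟨hi, by omega, by omega⟩⟩)
        · omega
      · exact Or.inr (Or.inr ⟨h0, Or.inr ⟨h.1, h.2.1, by omega⟩⟩)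
  · simp only [hk, false_and]

theorem St_last (J : 𝔽 n) (a : ℕ) (i : Fin n) :
    i ∈ St J a (n - 1) ↔ (i.1 < a ∧ i.1 < J.card) ∨ (i ∈ J ∧ a ≤ cc J i) := by
  rw [mem_St]
  have hi := i.2
  have h1 := cc_succ J ⟨n - 1, by omega⟩
  have h2 := cc_n J
  have h3 : n - 1 + 1 = n := by omega
  simp only [h3, h2] at h1
  have h4 := cc_succ J i
  have h5 := cc_le_card J (i.1 + 1)
  constructor
  · rintro (h | h | ⟨h0, h | h⟩)
    · exact Or.inl h
    · exact Or.inr ⟨h.1, h.2.le⟩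
    · right
      have : i = ⟨n - 1, by omega⟩ := Fin.ext h.1
      rw [← this] at h1
      rw [h.1]
      split_ifs at h1 with hh
      · exact ⟨hh, by omega⟩
      · omega
    · exact Or.inr ⟨h.1, h.2.1.ge⟩
  · rintro (h | ⟨h, h'⟩)
    · exact Or.inl h
    · rw [if_pos h] at h4
      right
      rcases h'.lt_or_eq with h' | h'
      · exact Or.inl ⟨h, h'⟩
      · right
        refine ⟨by omega, ?_⟩
        by_cases e : i.1 = n - 1
        · left; rw [← e]; exact ⟨rfl, h'.ge⟩
        · right; exact ⟨h, h'.symm, by omega⟩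

theorem St_first (J : 𝔽 n) (a : ℕ) (i : Fin n) :
    i ∈ St J a a ↔ (i.1 < a + 1 ∧ i.1 < J.card) ∨ (i ∈ J ∧ a < cc J i) := by
  rw [mem_St]
  have h1 := cc_le J i
  have h2 := cc_le J a
  constructor
  · rintro (h | h | ⟨h0, h | h⟩)
    · left; omega
    · exact Or.inr h
    · left; omega
    · omega
  · rintro (h | h)
    · by_cases e : i.1 = a
      · right; right; exact ⟨by omega, Or.inl ⟨e, h2⟩⟩
      · left; omega
    · exact Or.inr (Or.inl h)

def ini (n k : ℕ) : 𝔽 n := Finset.univ.filter fun i => i.1 < k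

theorem St_init (J : 𝔽 n) : St J (n - 1) (n - 1) = ini n J.card := by
  ext i
  rw [St_first]
  have h1 := cc_le J i
  have hi := i.2
  simp only [ini, mem_filter, mem_univ, true_and]
  constructor
  · rintro (h | h) <;> omega
  · intro h; left; omega

theorem St_next (J : 𝔽 n) (a : ℕ) : St J (a + 1) (n - 1) = St J a a := by
  ext i; rw [St_first, St_last]; rfl

theorem St_final (J : 𝔽 n) : St J 0 (n - 1) = J := by
  ext i; rw [St_last]; simp

def ab (J : 𝔽 n) (p : Fin n) : ℕ := (J.filter (fun j => p < j)).card

theorem ab_mv (J : 𝔽 n) (p p' t : Fin n) (hp : p'.1 = p.1 + 1) (h1 : p' ∈ J)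
    (h2 : p ∉ J) : ab (insert p (J.erase p')) t ≤ ab J t := by
  unfold ab
  apply card_le_card_of_injOn (fun j => if j = p then p' else j)
  · intro j hj
    simp only [coe_filter, Set.mem_ofPred_eq, mem_insert, mem_erase,
      Fin.lt_def] at hj ⊢
    split_ifs with h
    · subst h; exact ⟨h1, by omega⟩
    · refine ⟨?_, hj.2⟩; tauto
  · intro a ha b hb
    simp only [coe_filter, Set.mem_ofPred_eq, mem_insert, mem_erase] at ha hb
    dsimp only
    split_ifs <;> grind

theorem St_vanish (J K : 𝔽 n) (a : ℕ) (p p' : Fin n) (hp : p'.1 = p.1 + 1)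
    (hap : a ≤ p.1) (hc : ¬ (a < J.card ∧ cc J (p.1 + 1) ≤ a)) (h1 : p' ∈ K) (h2 : p ∉ K)
    (hS : St J a p.1 = insert p (K.erase p')) : ab J p < ab K p := by
  have hk : a < J.card := by
    by_contra hk
    have : p ∈ St J a p.1 := by rw [hS]; exact mem_insert_self _ _
    rw [mem_St] at this
    have := cc_le_card J p.1
    omega
  have hc' : a < cc J (p.1 + 1) := by by_contra hh; exact hc ⟨hk, by omega⟩
  have key : ∀ i ∈ J, p < i → i ∈ St J a p.1 := by
    intro i hi hpi
    rw [mem_St]; right; left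
    refine ⟨hi, ?_⟩
    have := cc_mono J (i := p.1 + 1) (j := i.1) hpi
    omega
  unfold ab
  apply card_lt_card
  rw [ssubset_iff_of_subset]
  · refine ⟨p', ?_, ?_⟩
    · simp only [mem_filter, Fin.lt_def]; exact ⟨h1, by omega⟩
    · intro h
      simp only [mem_filter] at h
      have := key p' h.1 h.2
      rw [hS] at this
      simp only [mem_insert, mem_erase, ne_eq, not_true_eq_false, false_and,
        or_false, Fin.ext_iff] at this
      omega
  · intro i hi
    simp only [mem_filter] at hi ⊢
    have := key i hi.1 hi.2
    rw [hS, mem_insert, mem_erase] at this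
    refine ⟨?_, hi.2⟩
    rcases this with h | h
    · rw [h] at hi; exact absurd hi.2 (lt_irrefl _)
    · exact h.2

end ten
section eleven
variable {R : Type*} [CommRing R] {n : ℕ} {D : Type*} [Ring D] [Algebra R D]

structure Mlt (e : D →ₗ[R] DD R) : Prop where
  one : e 1 = 1
  mul : (∀ a b, e (a * b) = e a * e b) ∨ (∀ a b, e (a * b) = e b * e a)

variable {e : D →ₗ[R] DD R}

theorem Mlt.tri (h : Mlt e) {a b : D} {w w'} (ha : Tri (e a) w) (hb : Tri (e b) w') :
    Tri (e (a * b)) (w + w') := by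
  rcases h.mul with h | h
  · rw [h]; exact ha.mul hb
  · rw [h, add_comm]; exact hb.mul ha

theorem Mlt.sup (h : Mlt e) {a b : D} {P P' P'' : (ℕ → ℕ) → Prop} (ha : Sup (e a) P)
    (hb : Sup (e b) P') (h2 : ∀ a b, P a → P' b → P'' (a + b)) : Sup (e (a * b)) P'' := by
  rcases h.mul with h | h
  · rw [h]; exact ha.mul hb h2
  · rw [h]; exact hb.mul ha fun a b ha hb => by rw [add_comm]; exact h2 b a hb ha

structure Stp (e : D →ₗ[R] DD R) (M : 𝔽 n → 𝔽 n → D) (p p' : Fin n)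
    (σ : ℕ) : Prop where
  diag : ∀ I, Tri (e (M I I)) 0 ∧ Sup (e (M I I)) (fun w => w = 0)
  mv : ∀ J, p' ∈ J → p ∉ J → Tri (e (M (insert p (J.erase p')) J)) (Pi.single σ 1) ∧
    Sup (e (M (insert p (J.erase p')) J)) (fun w => w = Pi.single σ 1)
  zero : ∀ I J, I ≠ J → ¬ (p' ∈ J ∧ p ∉ J ∧ I = insert p (J.erase p')) → M I J = 0

structure Net (e : D →ₗ[R] DD R) (M : ℕ → 𝔽 n → 𝔽 n → D) (σ : ℕ → ℕ) :
    Prop where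
  real : ∀ t (p p' : Fin n), p.1 = t % n → p'.1 = p.1 + 1 → n - 1 - t / n ≤ p.1 →
    Stp e (M t) p p' (σ t)
  skip : ∀ t, ¬ (n - 1 - t / n ≤ t % n ∧ t % n + 1 < n) → ∀ I J, M t I J = if I = J then 1 else 0
  mono : StrictMono σ

def Comp (M : ℕ → 𝔽 n → 𝔽 n → D) :
    ℕ → ℕ → 𝔽 n → 𝔽 n → D
  | _, 0, I, J => if I = J then 1 else 0
  | t, m + 1, I, J => ∑ K, M t I K * Comp M (t + 1) m K J

def Wc (J : 𝔽 n) (t : ℕ) : Prop :=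
  n - 1 - t / n ≤ t % n ∧ t % n + 1 < n ∧ n - 1 - t / n < J.card ∧ cc J (t % n + 1) ≤ n - 1 - t / n

instance (J : 𝔽 n) (t : ℕ) : Decidable (Wc J t) := by unfold Wc; infer_instance

def Wv (σ : ℕ → ℕ) (J : 𝔽 n) : ℕ → ℕ → (ℕ → ℕ)
  | _, 0 => 0
  | t, m + 1 => (if Wc J t then Pi.single (σ t) 1 else 0) + Wv σ J (t + 1) m

def Stt (J : 𝔽 n) (t : ℕ) : 𝔽 n :=
  St J (n - 1 - t / n) (max (t % n) (n - 1 - t / n))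

variable {M : ℕ → 𝔽 n → 𝔽 n → D} {σ : ℕ → ℕ}

theorem Net.cases (hM : Net e M σ) (t : ℕ) :
    (∀ I J, M t I J = if I = J then 1 else 0) ∧ ¬ (n - 1 - t / n ≤ t % n ∧ t % n + 1 < n) ∨
    ∃ p p' : Fin n, p.1 = t % n ∧ p'.1 = p.1 + 1 ∧ n - 1 - t / n ≤ p.1 ∧ Stp e (M t) p p' (σ t) := by
  by_cases h : n - 1 - t / n ≤ t % n ∧ t % n + 1 < n
  · right
    exact ⟨⟨t % n, by omega⟩, ⟨t % n + 1, h.2⟩, rfl, rfl, h.1, hM.real t _ _ rfl rfl h.1⟩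
  · exact Or.inl ⟨hM.skip t h, h⟩

theorem Net.ab_zero (hM : Net e M σ) (t : ℕ) (I J : 𝔽 n) (u : Fin n)
    (h : ab J u < ab I u) : M t I J = 0 := by
  have hne : I ≠ J := by rintro rfl; omega
  rcases hM.cases t with ⟨h1, -⟩ | ⟨p, p', h1, h2, -, h3⟩
  · rw [h1, if_neg hne]
  · apply h3.zero I J hne
    rintro ⟨h4, h5, rfl⟩
    have := ab_mv J p p' u h2 h4 h5
    omega

theorem Comp_vanish (hM : Net e M σ) (u : Fin n) (J : 𝔽 n) (m : ℕ) : ∀ t I,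
    ab J u < ab I u → Comp M t m I J = 0 := by
  induction m with
  | zero => intro t I h; rw [Comp, if_neg]; rintro rfl; omega
  | succ m ih =>
    intro t I h
    rw [Comp]
    refine sum_eq_zero fun K _ => ?_
    by_cases hK : ab K u < ab I u
    · rw [hM.ab_zero t I K u hK, zero_mul]
    · rw [ih _ _ (by omega), mul_zero]

theorem Net.step_sup (hM : Net e M σ) (he : Mlt e) (t : ℕ) (I J : 𝔽 n) :
    Sup (e (M t I J)) (fun w => w = 0 ∨ w = Pi.single (σ t) 1) := by
  rcases hM.cases t with ⟨h1, -⟩ | ⟨p, p', h1, h2, -, h3⟩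
  · rw [h1]; split_ifs
    · rw [he.one, ← mop_one]; exact Sup_mop _ _ _ (Or.inl rfl)
    · rw [map_zero]; exact Sup_zero
  · by_cases hne : I = J
    · subst hne; exact (h3.diag I).2.mono fun w hw => Or.inl hw
    · by_cases hm : p' ∈ J ∧ p ∉ J ∧ I = insert p (J.erase p')
      · obtain ⟨h4, h5, rfl⟩ := hm
        exact (h3.mv J h4 h5).2.mono fun w hw => Or.inr hw
      · rw [h3.zero I J hne hm, map_zero]; exact Sup_zero

theorem Comp_sup (hM : Net e M σ) (he : Mlt e) (J : 𝔽 n) (m : ℕ) : ∀ t I,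
    Sup (e (Comp M t m I J)) (fun w => ∀ i, w i ≠ 0 → ∃ t' ≥ t, i = σ t') := by
  induction m with
  | zero =>
    intro t I; rw [Comp]; split_ifs
    · rw [he.one, ← mop_one]; exact Sup_mop _ _ _ (fun i hi => absurd rfl hi)
    · rw [map_zero]; exact Sup_zero
  | succ m ih =>
    intro t I
    rw [Comp, map_sum]
    refine Sup_sum _ _ fun K _ => he.sup (hM.step_sup he t I K) (ih (t + 1) K) ?_
    rintro a b (rfl | rfl) hb i hi
    · obtain ⟨t', h, h'⟩ := hb i (by simpa using hi)
      exact ⟨t', by omega, h'⟩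
    · by_cases hb' : b i = 0
      · refine ⟨t, le_rfl, ?_⟩
        by_contra hne
        exact hi (by simp [hb', Pi.single_eq_of_ne hne])
      · obtain ⟨t', h, h'⟩ := hb i hb'
        exact ⟨t', by omega, h'⟩

theorem Wv_supp (J : 𝔽 n) (m : ℕ) : ∀ t i, Wv σ J t m i ≠ 0 → ∃ t' ≥ t, i = σ t' := by
  induction m with
  | zero => intro t i h; exact absurd rfl h
  | succ m ih =>
    intro t i hi
    by_cases hb : Wv σ J (t + 1) m i = 0
    · refine ⟨t, le_rfl, ?_⟩
      by_contra hne
      apply hi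
      rw [Wv]; split_ifs <;> simp [hb, Pi.single_eq_of_ne hne]
    · obtain ⟨t', h, h'⟩ := ih _ i hb
      exact ⟨t', by omega, h'⟩

theorem Wv_apply (hσ : StrictMono σ) (J : 𝔽 n) (m : ℕ) : ∀ t t0, t ≤ t0 → t0 < t + m →
    Wv σ J t m (σ t0) = if Wc J t0 then 1 else 0 := by
  induction m with
  | zero => intro t t0 h h'; omega
  | succ m ih =>
    intro t t0 h h'
    rw [Wv, Pi.add_apply]
    by_cases e : t = t0
    · subst e
      have : Wv σ J (t + 1) m (σ t) = 0 := by
        by_contra hne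
        obtain ⟨t', h, h'⟩ := Wv_supp J m (t + 1) _ hne
        have := hσ.injective h'
        omega
      rw [this]; split_ifs <;> simp
    · rw [ih (t + 1) t0 (by omega) (by omega)]
      have : (if Wc J t then Pi.single (σ t) 1 else 0 : ℕ → ℕ) (σ t0) = 0 := by
        split_ifs
        · rw [Pi.single_eq_of_ne]; exact fun h => e (hσ.injective h).symm
        · rfl
      rw [this, zero_add]

theorem tsucc (t n : ℕ) (hn : 0 < n) :
    (t % n + 1 < n → (t + 1) / n = t / n ∧ (t + 1) % n = t % n + 1) ∧
    (t % n + 1 = n → (t + 1) / n = t / n + 1 ∧ (t + 1) % n = 0) := by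
  have h0 := Nat.div_add_mod t n
  refine ⟨fun h => (Nat.div_mod_unique hn).2 ⟨by omega, h⟩,
    fun h => (Nat.div_mod_unique hn).2 ⟨?_, hn⟩⟩
  rw [Nat.mul_add]; omega

theorem Comp_tri (hM : Net e M σ) (he : Mlt e) (hn : 0 < n) (J : 𝔽 n) (m : ℕ) : ∀ t,
    t + m = n * n - 1 → Tri (e (Comp M t m (Stt J t) J)) (Wv σ J t m) := by
  induction m with
  | zero =>
    intro t ht
    have h1 : t / n = n - 1 ∧ t % n = n - 1 := (Nat.div_mod_unique hn).2 ⟨by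
      rw [Nat.mul_sub, Nat.mul_one]
      have : n ≤ n * n := Nat.le_mul_self n
      omega, by omega⟩
    rw [Comp, Stt, h1.1, h1.2, Nat.sub_self, Nat.max_eq_left (Nat.zero_le _), St_final, if_pos rfl,
      he.one]
    exact Tri_one
  | succ m ih =>
    intro t ht
    have ih' := ih (t + 1) (by omega)
    have h1 : t / n < n := Nat.div_lt_of_lt_mul (by omega)
    have h1' : (t + 1) / n < n := Nat.div_lt_of_lt_mul (by omega)
    have hmod := Nat.mod_lt t hn
    rw [Comp, Wv]
    rcases hM.cases t with ⟨h2, h3⟩ | ⟨p, p', hp, hp', hap, hS⟩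
    · rw [if_neg (fun h : Wc J t => h3 ⟨h.1, h.2.1⟩), zero_add]
      have hst : Stt J (t + 1) = Stt J t := by
        unfold Stt
        by_cases hpn : t % n + 1 < n
        · obtain ⟨e1, e2⟩ := (tsucc t n hn).1 hpn
          rw [e1, e2, Nat.max_eq_right (by omega), Nat.max_eq_right (by omega)]
        · obtain ⟨e1, e2⟩ := (tsucc t n hn).2 (by omega)
          rw [e1] at h1'
          rw [e1, e2, Nat.max_eq_right (Nat.zero_le _),
            Nat.max_eq_left (le_trans (Nat.sub_le _ _) (by omega : n - 1 ≤ t % n))]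
          have e3 : n - 1 - t / n = n - 1 - (t / n + 1) + 1 := by omega
          have e4 : t % n = n - 1 := by omega
          rw [e3, e4, St_next]
      rw [sum_eq_single (Stt J t)]
      · rw [h2, if_pos rfl, one_mul, ← hst]; exact ih'
      · intro K _ hK; rw [h2, if_neg (Ne.symm hK), zero_mul]
      · intro h; exact absurd (mem_univ _) h
    · obtain ⟨e1, e2⟩ := (tsucc t n hn).1 (by have := p'.2; omega)
      have hs1 : Stt J t = St J (n - 1 - t / n) p.1 := by
        unfold Stt; rw [Nat.max_eq_left (by omega), hp]
      have hs2 : Stt J (t + 1) = St J (n - 1 - t / n) (p.1 + 1) := by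
        unfold Stt; rw [e1, e2, Nat.max_eq_left (by omega), hp]
      rw [hs2] at ih'
      rw [hs1, map_sum]
      by_cases hw : n - 1 - t / n < J.card ∧ cc J (p.1 + 1) ≤ n - 1 - t / n
      · obtain ⟨m1, m2, m3⟩ := St_move J _ p p' hp' hap hw.1 hw.2
        rw [if_pos (show Wc J t from ⟨by omega, by have := p'.2; omega, hw.1, by rw [← hp]; exact hw.2⟩)]
        rw [← add_sum_erase _ _ (mem_univ (St J (n - 1 - t / n) (p.1 + 1)))]
        apply Tri.add
        · apply he.tri _ ih'
          rw [m3]; exact (hS.mv _ m1 m2).1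
        · refine Sup_sum _ _ fun K hK => ?_
          have hlow : ∀ b : ℕ → ℕ, (∀ i, b i ≠ 0 → ∃ t' ≥ t + 1, i = σ t') →
              Lt b (Pi.single (σ t) 1 + Wv σ J (t + 1) m) := by
            intro b hb
            have hz : ∀ c : ℕ → ℕ, (∀ i, c i ≠ 0 → ∃ t' ≥ t + 1, i = σ t') → ∀ j ≤ σ t, c j = 0 := by
              intro c hc j hj
              by_contra hne
              obtain ⟨t', h, h'⟩ := hc j hne
              have := hM.mono (show t < t' by omega)
              omega
            refine ⟨σ t, fun j hj => ?_, ?_⟩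
            · simp only [Pi.toLex_apply, Pi.add_apply]
              rw [hz b hb j hj.le, hz _ (Wv_supp J m (t + 1)) j hj.le, Pi.single_eq_of_ne hj.ne]
            · simp only [Pi.toLex_apply, Pi.add_apply, Pi.single_eq_same]
              rw [hz b hb _ le_rfl]; omega
          by_cases hKI : K = St J (n - 1 - t / n) p.1
          · rw [← hKI]
            refine he.sup (hS.diag K).2 (Comp_sup hM he J m (t + 1) K) ?_
            rintro a b rfl hb
            rw [zero_add]; exact hlow b hb
          · rw [hS.zero _ _ (Ne.symm hKI), zero_mul, map_zero]
            · exact Sup_zero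
            · rintro ⟨k1, k2, k3⟩
              apply (mem_erase.1 hK).1
              rw [m3] at k3
              have k4 := congrArg (fun s => insert p' (s.erase p)) k3
              have hpp : p ≠ p' := fun h => by rw [h] at hp'; omega
              simp only [erase_insert_eq_erase] at k4
              rw [erase_eq_of_notMem (fun h => m2 (mem_of_mem_erase h)),
                erase_eq_of_notMem (fun h => k2 (mem_of_mem_erase h)),
                insert_erase m1, insert_erase k1] at k4
              exact k4.symm
      · rw [if_neg (fun h : Wc J t => hw ⟨h.2.2.1, by rw [hp]; exact h.2.2.2⟩), zero_add]
        rw [St_stay J _ p hw] at ih'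
        rw [sum_eq_single (St J (n - 1 - t / n) p.1)]
        · have := he.tri (hS.diag (St J (n - 1 - t / n) p.1)).1 ih'
          rwa [zero_add] at this
        · intro K _ hK
          by_cases hmv : p' ∈ K ∧ p ∉ K ∧ St J (n - 1 - t / n) p.1 = insert p (K.erase p')
          · rw [Comp_vanish hM p J m (t + 1) K, mul_zero, map_zero]
            exact St_vanish J K _ p p' hp' hap hw hmv.1 hmv.2.1 hmv.2.2
          · rw [hS.zero _ _ (Ne.symm hK) hmv, zero_mul, map_zero]
        · intro h; exact absurd (mem_univ _) h

def WV (σ : ℕ → ℕ) (J : 𝔽 n) : ℕ → ℕ := Wv σ J 0 (n * n - 1)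

theorem Net.main (hM : Net e M σ) (he : Mlt e) (hn : 0 < n) (J : 𝔽 n) :
    Tri (e (Comp M 0 (n * n - 1) (ini n J.card) J)) (WV σ J) := by
  have := Comp_tri hM he hn J (n * n - 1) 0 (by omega)
  rwa [Stt, Nat.zero_div, Nat.zero_mod, Nat.sub_zero, Nat.max_eq_right (Nat.zero_le _), St_init] at this

end eleven
section twelve
variable {R : Type*} [CommRing R] {n : ℕ} {D : Type*} [Ring D] [Algebra R D] {q : Rˣ}

structure Trip (q : Rˣ) (Q Q' S : D) : Prop where
  a : Q * Q' = 1
  b : Q' * Q = 1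
  c : Q * S = (q : R) • (S * Q)

def Ele (p p' : Fin n) (Q Q' S : D) : 𝕄 n D := fun i j =>
  if i = j then (if i = p then Q else if i = p' then Q' else 1) else if i = p ∧ j = p' then S else 0

theorem Trip.d {Q Q' S : D} (h : Trip q Q Q' S) : S * Q' = (q : R) • (Q' * S) := by
  calc S * Q' = Q' * (Q * S) * Q' := by rw [← mul_assoc, h.b, one_mul]
    _ = (q : R) • (Q' * S * (Q * Q')) := by
      rw [h.c, mul_smul_comm, smul_mul_assoc]; simp only [mul_assoc]
    _ = _ := by rw [h.a, mul_one]

theorem Ele_qm {Q Q' S : D} (h : Trip q Q Q' S) (p p' : Fin n) (hp : p'.1 = p.1 + 1) :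
    IsQM q (Ele p p' Q Q' S) := by
  have hd := h.d
  have hc := h.c
  have hab : Q * Q' = Q' * Q := by rw [h.a, h.b]
  constructor
  · intro i j k hij
    have hij' : i ≠ j := hij.ne
    unfold Ele
    by_cases h1 : j = k
    · subst h1
      by_cases h2 : i = p ∧ j = p'
      · obtain ⟨rfl, rfl⟩ := h2
        simp [hij', hij'.symm, hd]
      · simp [hij', h2]
    · by_cases h2 : j = p ∧ k = p'
      · have h3 : i ≠ k := by rintro rfl; rw [h2.1, h2.2] at hij; simp only [Fin.lt_def] at hij; omega
        have h4 : i ≠ p := by rw [← h2.1]; exact hij'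
        simp [h3, h4]
      · simp [h1, h2]
  · intro k i j hij
    have hij' : i ≠ j := hij.ne
    unfold Ele
    by_cases h1 : k = i
    · subst h1
      by_cases h2 : k = p ∧ j = p'
      · obtain ⟨rfl, rfl⟩ := h2
        simp [hij', hc]
      · simp [hij', h2]
    · by_cases h2 : k = p ∧ i = p'
      · have h3 : k ≠ j := by rintro rfl; rw [h2.1, h2.2] at hij; simp only [Fin.lt_def] at hij; omega
        have h4 : j ≠ p' := by rw [← h2.2]; exact hij'.symm
        simp [h3, h4]
      · simp [h1, h2]
  · intro i j k l hik hlj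
    have key : Ele p p' Q Q' S i j = 0 ∨ Ele p p' Q Q' S k l = 0 := by
      unfold Ele
      simp only [Fin.lt_def] at hik hlj
      by_cases h1 : i = j
      · right
        subst h1
        rw [if_neg, if_neg]
        · rintro ⟨rfl, rfl⟩; omega
        · rintro rfl; omega
      · by_cases h2 : i = p ∧ j = p'
        · obtain ⟨rfl, rfl⟩ := h2
          right
          rw [if_neg, if_neg]
          · rintro ⟨rfl, rfl⟩; omega
          · rintro rfl; omega
        · left; rw [if_neg h1, if_neg h2]
    rcases key with k | k <;> rw [k] <;> simp
  · intro i j k l hik hjl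
    have key : Ele p p' Q Q' S i l * Ele p p' Q Q' S k j = 0 := by
      unfold Ele
      simp only [Fin.lt_def] at hik hjl
      by_cases h1 : k = j
      · subst h1
        rw [if_neg (by rintro rfl; omega), if_neg (by rintro ⟨rfl, rfl⟩; omega), zero_mul]
      · by_cases h2 : k = p ∧ j = p'
        · obtain ⟨rfl, rfl⟩ := h2
          rw [if_neg (by rintro rfl; omega), if_neg (by rintro ⟨rfl, rfl⟩; omega), zero_mul]
        · rw [if_neg h1, if_neg h2, mul_zero]
    rw [key, smul_zero, add_zero]
    unfold Ele
    simp only [Fin.lt_def] at hik hjl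
    by_cases h1 : i = j
    · subst h1
      by_cases h2 : k = l
      · subst h2
        rw [if_pos rfl, if_pos rfl]
        split_ifs <;> simp [hab]
      · rw [if_neg h2]
        by_cases h3 : k = p ∧ l = p'
        · obtain ⟨rfl, rfl⟩ := h3
          rw [if_pos rfl, if_neg (by rintro rfl; omega), if_neg (by rintro rfl; omega)]; simp
        · rw [if_neg h3]; simp
    · rw [if_neg h1]
      by_cases h3 : i = p ∧ j = p'
      · obtain ⟨rfl, rfl⟩ := h3
        by_cases h2 : k = l
        · subst h2
          rw [if_pos ⟨rfl, rfl⟩, if_pos rfl, if_neg (by rintro rfl; omega),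
            if_neg (by rintro rfl; omega)]; simp
        · rw [if_pos ⟨rfl, rfl⟩, if_neg h2, if_neg (by rintro ⟨rfl, rfl⟩; omega)]; simp
      · rw [if_neg h3]; simp

theorem cl_insert_min (J : 𝔽 n) (j : Fin n) (h : ∀ b ∈ J, j < b) :
    cl (insert j J) j = 0 := cl_eq_zero _ _ (by
  intro b hb
  rcases mem_insert.1 hb with rfl | hb
  · exact le_rfl
  · exact (h b hb).le)

theorem Ele_minor (s : R) (Q Q' S : D) (p p' : Fin n) (hp : p'.1 = p.1 + 1) (J : 𝔽 n) :
    ∀ I, minor s (Ele p p' Q Q' S) I J =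
      if I = J then (if p ∈ I then Q else 1) * (if p' ∈ I then Q' else 1)
      else if p' ∈ J ∧ p ∉ J ∧ I = insert p (J.erase p') then S else 0 := by
  have hpp : p ≠ p' := by rintro rfl; omega
  induction J using induction_on_min with
  | empty =>
    intro I
    by_cases h : I = ∅
    · subst h; simp [minor, Dm]
    · simp [minor, Dm, h]
  | insert j J' hj ih =>
    intro I
    have hjJ : j ∉ J' := fun h => lt_irrefl _ (hj j h)
    rw [minor_insert s _ I J' j hj]
    by_cases hjp : j = p'
    · subst hjp
      have hpJ : p ∉ J' := fun h => by have := hj p h; simp only [Fin.lt_def] at this; omega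
      have ih' : ∀ I, minor s (Ele p j Q Q' S) I J' = if I = J' then 1 else 0 := by
        intro I
        rw [ih]
        by_cases h : I = J'
        · subst h; simp [hpJ, hjJ]
        · simp [h, hjJ]
      simp only [ih']
      by_cases h1 : I = insert j J'
      · subst h1
        rw [if_pos rfl, sum_eq_single j]
        · rw [cl_insert_min J' j hj, erase_insert hjJ]
          simp [Ele, hpp, hpp.symm, hpJ]
        · intro i hi hij
          rw [if_neg]; · simp
          intro h
          have : j ∈ (insert j J').erase i := mem_erase.2 ⟨hij.symm, mem_insert_self _ _⟩
          rw [h] at this; exact hjJ this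
        · intro h; exact absurd (mem_insert_self _ _) h
      · rw [if_neg h1]
        have h0 : j ∈ insert j J' ∧ p ∉ insert j J' :=
          ⟨mem_insert_self _ _, by simp [hpp, hpJ]⟩
        rw [erase_insert hjJ]
        by_cases h2 : I = insert p J'
        · subst h2
          rw [if_pos ⟨h0.1, h0.2, rfl⟩, sum_eq_single p]
          · rw [cl_insert_min J' p (fun b hb => lt_trans (by simp only [Fin.lt_def]; omega) (hj b hb)),
              erase_insert hpJ]
            simp [Ele, hpp]
          · intro i hi hij
            rw [if_neg]; · simp
            intro h
            have : p ∈ (insert p J').erase i := mem_erase.2 ⟨hij.symm, mem_insert_self _ _⟩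
            rw [h] at this; exact hpJ this
          · intro h; exact absurd (mem_insert_self _ _) h
        · rw [if_neg (fun h => h2 h.2.2)]
          refine sum_eq_zero fun i hi => ?_
          by_cases h3 : I.erase i = J'
          · rw [if_pos h3]
            have h4 : I = insert i J' := by rw [← h3, insert_erase hi]
            have h5 : i ≠ j := fun h => h1 (h ▸ h4)
            have h6 : i ≠ p := fun h => h2 (h ▸ h4)
            simp [Ele, h5, h6]
          · rw [if_neg h3]; simp
    · have hX : ∀ i, i ≠ j → Ele p p' Q Q' S i j = 0 := by
        intro i hi; unfold Ele; rw [if_neg hi, if_neg (fun h => hjp h.2)]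
      by_cases hjI : j ∈ I
      · rw [sum_eq_single j (fun i _ hi => by rw [hX i hi]; simp) (fun h => absurd hjI h), ih]
        obtain ⟨I', hI', rfl⟩ : ∃ I', j ∉ I' ∧ I = insert j I' :=
          ⟨I.erase j, notMem_erase _ _, (insert_erase hjI).symm⟩
        rw [erase_insert hI']
        by_cases h1 : I' = J'
        · subst h1
          rw [if_pos rfl, if_pos rfl, cl_insert_min I' j hj, pow_zero, one_smul]
          by_cases e : j = p
          · subst e; simp [Ele, hI', hpp, hpp.symm]
          · simp [Ele, e, hjp, Ne.symm e, Ne.symm hjp]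
        · have h2 : insert j I' ≠ insert j J' := by
            intro h
            apply h1
            rw [← erase_insert hI', h, erase_insert hjJ]
          rw [if_neg h1, if_neg h2]
          by_cases h3 : p' ∈ J' ∧ p ∉ J' ∧ I' = insert p (J'.erase p')
          · rw [if_pos h3]
            obtain ⟨h4, h5, rfl⟩ := h3
            have hjp2 : j ≠ p := fun h => hI' (h ▸ mem_insert_self _ _)
            rw [if_pos ⟨mem_insert_of_mem h4, by simp [h5, Ne.symm hjp2], by
              rw [insert_comm, erase_insert_of_ne hjp]⟩]
            rw [cl_insert_min]
            · simp [Ele, hjp, hjp2]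
            · intro b hb
              rcases mem_insert.1 hb with rfl | hb
              · have := hj _ h4
                simp only [Fin.lt_def] at this ⊢
                have : j.1 ≠ b.1 := fun h => hjp2 (Fin.ext h)
                omega
              · exact hj b (mem_of_mem_erase hb)
          · rw [if_neg h3, mul_zero, smul_zero, if_neg]
            rintro ⟨h4, h5, h6⟩
            apply h3
            have h4' : p' ∈ J' := (mem_insert.1 h4).resolve_left (Ne.symm hjp)
            refine ⟨h4', fun h => h5 (mem_insert_of_mem h), ?_⟩
            rw [erase_insert_of_ne hjp, insert_comm] at h6
            rw [← erase_insert hI', h6, erase_insert]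
            simp only [mem_insert, mem_erase, not_or, not_and]
            exact ⟨fun h => h5 (h ▸ mem_insert_self _ _), fun _ => hjJ⟩
      · rw [sum_eq_zero (fun i hi => by
          rw [hX i (fun h => hjI (h ▸ hi))]; simp)]
        rw [if_neg, if_neg]
        · rintro ⟨-, -, h⟩
          apply hjI; rw [h]
          exact mem_insert_of_mem (mem_erase.2 ⟨hjp, mem_insert_self _ _⟩)
        · intro h; apply hjI; rw [h]; exact mem_insert_self _ _

theorem diag_qm (d : Fin n → D) (hd : ∀ i j, Commute (d i) (d j)) : IsQM q (Matrix.diagonal d) := by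
  constructor
  · intro i j k hij
    by_cases h : i = k
    · subst h; rw [Matrix.diagonal_apply_ne _ hij.ne']; simp
    · rw [Matrix.diagonal_apply_ne _ h]; simp
  · intro k i j hij
    by_cases h : k = i
    · subst h; rw [Matrix.diagonal_apply_ne _ hij.ne]; simp
    · rw [Matrix.diagonal_apply_ne _ h]; simp
  · intro i j k l hik hlj
    by_cases h : i = j
    · subst h; rw [Matrix.diagonal_apply_ne _ (hlj.trans hik).ne']; simp
    · rw [Matrix.diagonal_apply_ne _ h]; simp
  · intro i j k l hik hjl
    have : Matrix.diagonal d i l * Matrix.diagonal d k j = 0 := by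
      by_cases h : k = j
      · subst h; rw [Matrix.diagonal_apply_ne _ (hik.trans hjl).ne]; simp
      · rw [Matrix.diagonal_apply_ne _ h]; simp
    rw [this]
    by_cases h : i = j
    · by_cases h' : k = l
      · subst h h'; simp [(hd i k).eq]
      · rw [Matrix.diagonal_apply_ne _ h']; simp
    · rw [Matrix.diagonal_apply_ne _ h]; simp

theorem diag_minor {A : Type*} [AddCommMonoid A] (sh : A → D) (h0 : sh 0 = 1)
    (hadd : ∀ a b, sh (a + b) = sh a * sh b) (f : Fin n → A) (s : R) (J : 𝔽 n) :
    ∀ I, minor s (Matrix.diagonal fun i => sh (f i)) I J = if I = J then sh (∑ i ∈ I, f i) else 0 := by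
  induction J using induction_on_min with
  | empty =>
    intro I; simp only [minor, sort_empty, Dm]
    split_ifs with h
    · simp [h, h0]
    · rfl
  | insert j J' hj ih =>
    intro I
    have hjJ : j ∉ J' := fun h => lt_irrefl _ (hj j h)
    rw [minor_insert s _ I J' j hj]
    by_cases hjI : j ∈ I
    · rw [sum_eq_single j (fun i _ hi => by rw [Matrix.diagonal_apply_ne _ hi]; simp)
        (fun h => absurd hjI h), ih, Matrix.diagonal_apply_eq]
      by_cases h1 : I.erase j = J'
      · have h2 : I = insert j J' := by rw [← h1, insert_erase hjI]
        rw [if_pos h1, if_pos h2, h2, cl_insert_min J' j hj, pow_zero, one_smul, ← hadd,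
          erase_insert hjJ, sum_insert hjJ]
      · rw [if_neg h1, if_neg, mul_zero, smul_zero]
        rintro rfl; exact h1 (erase_insert hjJ)
    · rw [sum_eq_zero (fun i hi => by
        rw [Matrix.diagonal_apply_ne _ (show i ≠ j by rintro rfl; exact hjI hi)]; simp), if_neg]
      intro h; apply hjI; rw [h]; exact mem_insert_self _ _

theorem one_qm : IsQM q (1 : 𝕄 n D) := by
  have := diag_qm (q := q) (fun _ : Fin n => (1 : D)) (fun _ _ => Commute.refl _)
  simpa using this

theorem one_minor (s : R) (I J : 𝔽 n) :
    minor s (1 : 𝕄 n D) I J = if I = J then 1 else 0 := by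
  have := diag_minor (fun _ : ℕ => (1 : D)) rfl (fun _ _ => (one_mul 1).symm) (fun _ : Fin n => 0) s J I
  rw [← this]; congr 1

end twelve
section thirteen
variable {R : Type*} [CommRing R] {n : ℕ} {D : Type*} [Ring D] [Algebra R D] {q : Rˣ}
open MulOpposite

def cof (q : Rˣ) (X : 𝕄 n D) : 𝕄 n D := fun i j =>
  (((-q) ^ ((j.1 : ℤ) - (i.1 : ℤ)) : Rˣ) : R) • mq q X {i}ᶜ {j}ᶜ

def opM (X : 𝕄 n D) : 𝕄 n Dᵐᵒᵖ := fun i j => op (X i j)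

def Cm (X Y : 𝕄 n D) : Prop := ∀ i j k l, Commute (X i j) (Y k l)

variable {X Y : 𝕄 n D}

theorem Cm.symm (h : Cm X Y) : Cm Y X := fun i j k l => (h k l i j).symm

theorem Cm.transpose (h : Cm X Y) : Cm X.transpose Y := fun i j k l => h j i k l

theorem Cm.mul {Z : 𝕄 n D} (h : Cm X Z) (h' : Cm Y Z) : Cm (X * Y) Z := by
  intro i j k l
  rw [Matrix.mul_apply]
  exact Commute.sum_left _ _ _ fun a _ => (h i a k l).mul_left (h' a j k l)

theorem Cm_one : Cm (1 : 𝕄 n D) X := by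
  intro i j k l
  rw [Matrix.one_apply]; split_ifs; exacts [Commute.one_left _, Commute.zero_left _]

theorem Cm.cof (h : Cm X Y) : Cm (cof q X) (cof q Y) := fun _ _ _ _ =>
  ((minor_commute _ X Y h _ _ _ _).smul_left _).smul_right _

theorem opM_mul (h : Cm X Y) : opM (X * Y) = opM X * opM Y := by
  ext i j
  rw [Matrix.mul_apply]
  simp only [opM, Matrix.mul_apply]
  have : op (∑ k, X i k * Y k j) = opAddEquiv (∑ k, X i k * Y k j) := rfl
  rw [this, map_sum]
  refine sum_congr rfl fun k _ => ?_
  rw [(h i k k j).eq]; rfl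

theorem Cm.op (h : Cm X Y) : Cm (opM X) (opM Y) := fun i j k l => (h i j k l).op

theorem sum_compl {M : Type*} [AddCommMonoid M] (F : 𝔽 n → M)
    (hF : ∀ K, K.card ≠ n - 1 → F K = 0) (hn : 0 < n) : ∑ K, F K = ∑ k : Fin n, F {k}ᶜ := by
  symm
  apply sum_of_injOn (fun k : Fin n => ({k}ᶜ : 𝔽 n))
  · intro a _ b _ h
    exact singleton_injective (compl_injective h)
  · intro a _; exact mem_coe.2 (mem_univ _)
  · intro K _ hK
    apply hF
    intro h
    apply hK
    have h1 : Kᶜ.card = 1 := by rw [card_compl, h, Fintype.card_fin]; omega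
    obtain ⟨k, hk⟩ := card_eq_one.1 h1
    exact ⟨k, by simp, by dsimp only; rw [← hk, compl_compl]⟩
  · intro a _; rfl

theorem card_compl_one (i : Fin n) : ({i}ᶜ : 𝔽 n).card = n - 1 := by
  rw [card_compl]; simp

theorem cof_mul (hX : IsQM q X) (h : Cm X Y) : cof q (X * Y) = cof q X * cof q Y := by
  ext i j
  have hn : 0 < n := i.pos
  rw [Matrix.mul_apply]
  unfold cof
  rw [mq, minor_mul hX Y h, sum_compl _ _ hn, smul_sum]
  · refine sum_congr rfl fun k _ => ?_
    rw [smul_mul_smul_comm, ← Units.val_mul, ← zpow_add]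
    congr 3; ring
  · intro K hK
    rw [minor_card _ X {i}ᶜ K (by rw [card_compl_one]; exact hK.symm), zero_mul]

theorem cof_transpose (hX : IsQM q X) (i j : Fin n) : cof q X.transpose i j =
    (((q ^ (2 * j.1) : Rˣ) : R) * (((q ^ (2 * i.1))⁻¹ : Rˣ) : R)) • cof q X j i := by
  unfold cof
  rw [mq, mq, minor_transpose hX, smul_smul, ← Units.val_mul, ← Units.val_mul]
  congr 2
  have e : ∀ k : ℕ, q ^ (2 * k) = (-q) ^ (2 * (k : ℤ)) := by
    intro k; rw [zpow_mul, zpow_natCast]; norm_cast; rw [pow_mul, neg_sq]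
  rw [e, e, ← zpow_neg, ← zpow_add, ← zpow_add]
  congr 1; ring

structure Dbl (q : Rˣ) (X : 𝕄 n D) : Prop where
  x : IsQM q X
  y : IsQM q (opM (cof q X))

theorem Dbl.mul (hX : Dbl q X) (hY : Dbl q Y) (h : Cm X Y) : Dbl q (X * Y) where
  x := hX.x.mul hY.x h
  y := by rw [cof_mul hX.x h, opM_mul h.cof]; exact hX.y.mul hY.y h.cof.op

theorem Dbl.minor_mul (hX : Dbl q X) (h : Cm X Y) (I J) : mq q (opM (cof q (X * Y))) I J =
    ∑ K, mq q (opM (cof q X)) I K * mq q (opM (cof q Y)) K J := by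
  rw [cof_mul hX.x h, opM_mul h.cof, mq, QM.minor_mul hX.y _ h.cof.op]

def scl (w : Fin n → Rˣ) (X : 𝕄 n D) : 𝕄 n D :=
  fun i j => ((w i : Rˣ) : R) • X i j

theorem Dm_scale (s : R) (w : Fin n → Rˣ) (X : 𝕄 n D) (L : List (Fin n)) :
    ∀ I : 𝔽 n, Dm s (scl w X) I L = ((∏ i ∈ I, w i : Rˣ) : R) • Dm s X I L := by
  induction L with
  | nil => intro I; rw [Dm, Dm]; split_ifs with h
           · subst h; simp
           · simp
  | cons j L ih =>
    intro I
    rw [Dm, Dm, smul_sum]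
    refine sum_congr rfl fun i hi => ?_
    rw [ih, scl, smul_mul_smul_comm, smul_smul, smul_smul, ← mul_prod_erase I w hi,
      Units.val_mul, mul_comm]

theorem minor_scale (s : R) (w : Fin n → Rˣ) (X : 𝕄 n D) (I J) :
    minor s (scl w X) I J = ((∏ i ∈ I, w i : Rˣ) : R) • minor s X I J := Dm_scale s w X _ I

theorem opcof_transpose (hX : IsQM q X) : opM (cof q X.transpose) =
    scl (fun i => (q ^ (2 * i.1))⁻¹) (scl (fun j => q ^ (2 * j.1)) (opM (cof q X))).transpose := by
  ext i j
  have h := cof_transpose hX i j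
  rw [mul_comm, ← smul_smul] at h
  exact congrArg op h

theorem Dbl.transpose (hX : Dbl q X) : Dbl q X.transpose where
  x := hX.x.transpose
  y := by
    rw [opcof_transpose hX.x]
    exact IsQM.scale (IsQM.transpose (IsQM.scale hX.y _)) _

theorem Dbl.minor_transpose (hX : Dbl q X) (I J) : ∃ u : Rˣ, mq q (opM (cof q X.transpose)) I J =
    (u : R) • mq q (opM (cof q X)) J I := by
  have h : IsQM q (scl (fun j => q ^ (2 * j.1)) (opM (cof q X))) := hX.y.scale _
  rw [opcof_transpose hX.x, mq, minor_scale, ← QM.minor_transpose h, minor_scale, smul_smul,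
    ← Units.val_mul]
  exact ⟨_, rfl⟩

theorem Ele_cof {Q Q' S : D} (h : Trip q Q Q' S) (p p' : Fin n) (hp : p'.1 = p.1 + 1) :
    cof q (Ele p p' Q Q' S) = (Ele p p' Q' Q (-(((q⁻¹ : Rˣ) : R) • S))).transpose := by
  have hpp : p ≠ p' := by rintro rfl; omega
  ext i j
  rw [Matrix.transpose_apply]
  unfold cof
  rw [mq, Ele_minor _ _ _ _ p p' hp]
  by_cases hij : i = j
  · subst hij
    rw [if_pos rfl, sub_self, zpow_zero, Units.val_one, one_smul]
    by_cases h1 : i = p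
    · subst h1; simp [Ele, hpp.symm]
    · by_cases h2 : i = p'
      · subst h2; simp [Ele, hpp, hpp.symm]
      · simp [Ele, h1, h2, Ne.symm h1, Ne.symm h2, h.a]
  · have h1 : ¬ ({i}ᶜ : 𝔽 n) = {j}ᶜ := by
      intro h; exact hij (singleton_injective (compl_injective h))
    rw [if_neg h1]
    by_cases h2 : j = p ∧ i = p'
    · obtain ⟨rfl, rfl⟩ := h2
      rw [if_pos]
      · have e : ((j.1 : ℤ) - (i.1 : ℤ)) = -1 := by omega
        rw [e, zpow_neg_one]
        simp [Ele, hpp]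
      · refine ⟨by simp [hpp.symm], by simp, ?_⟩
        ext a; simp only [mem_compl, mem_singleton, mem_insert, mem_erase]
        constructor
        · intro h; by_cases a = j <;> tauto
        · rintro (h | h)
          · rw [h]; exact hpp
          · exact h.1
    · rw [if_neg]
      · simp [Ele, Ne.symm hij, h2]
      · rintro ⟨-, h4, h5⟩
        have h6 : j = p := by by_contra hne; exact h4 (by simp [Ne.symm hne])
        subst h6
        apply h2
        refine ⟨rfl, ?_⟩
        by_contra hne
        have : p' ∈ ({i}ᶜ : 𝔽 n) := by simp [Ne.symm hne]
        rw [h5] at this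
        simp [hpp.symm] at this

theorem Ele_opcof {Q Q' S : D} (h : Trip q Q Q' S) (p p' : Fin n) (hp : p'.1 = p.1 + 1) :
    opM (cof q (Ele p p' Q Q' S)) =
      (Ele p p' (op Q') (op Q) (op (-(((q⁻¹ : Rˣ) : R) • S)))).transpose := by
  rw [Ele_cof h p p' hp]
  ext i j
  simp only [opM, Matrix.transpose_apply, Ele]
  split_ifs <;> rfl

theorem Trip.op {Q Q' S : D} (h : Trip q Q Q' S) :
    Trip q (op Q') (op Q) (op (-(((q⁻¹ : Rˣ) : R) • S))) where
  a := by rw [← op_mul, h.a, op_one]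
  b := by rw [← op_mul, h.b, op_one]
  c := by
    rw [← op_mul, ← op_mul, ← op_smul]
    congr 1
    rw [neg_mul, smul_mul_assoc, h.d, mul_neg, mul_smul_comm, smul_neg, smul_comm]

theorem Ele_dbl {Q Q' S : D} (h : Trip q Q Q' S) (p p' : Fin n) (hp : p'.1 = p.1 + 1) :
    Dbl q (Ele p p' Q Q' S) where
  x := Ele_qm h p p' hp
  y := by rw [Ele_opcof h p p' hp]; exact (Ele_qm h.op p p' hp).transpose

theorem diag_cof {A : Type*} [AddCommMonoid A] (sh : A → D) (h0 : sh 0 = 1)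
    (hadd : ∀ a b, sh (a + b) = sh a * sh b) (f : Fin n → A) :
    cof q (Matrix.diagonal fun i => sh (f i)) =
      Matrix.diagonal fun i => sh (∑ k ∈ {i}ᶜ, f k) := by
  ext i j
  unfold cof
  rw [mq, diag_minor sh h0 hadd]
  by_cases h : i = j
  · subst h; simp
  · rw [if_neg, Matrix.diagonal_apply_ne _ h, smul_zero]
    intro h'; exact h (singleton_injective (compl_injective h'))

theorem diag_opcof {A : Type*} [AddCommMonoid A] (sh : A → D) (h0 : sh 0 = 1)
    (hadd : ∀ a b, sh (a + b) = sh a * sh b) (f : Fin n → A) :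
    opM (cof q (Matrix.diagonal fun i => sh (f i))) =
      Matrix.diagonal fun i => op (sh (∑ k ∈ {i}ᶜ, f k)) := by
  rw [diag_cof sh h0 hadd]
  ext i j
  unfold opM
  by_cases h : i = j
  · subst h; simp
  · rw [Matrix.diagonal_apply_ne _ h, Matrix.diagonal_apply_ne _ h]; rfl

theorem diag_dbl {A : Type*} [AddCommMonoid A] (sh : A → D) (h0 : sh 0 = 1)
    (hadd : ∀ a b, sh (a + b) = sh a * sh b) (f : Fin n → A) :
    Dbl q (Matrix.diagonal fun i => sh (f i)) := by
  have hc : ∀ a b, Commute (sh a) (sh b) := fun a b => by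
    unfold Commute SemiconjBy; rw [← hadd, ← hadd, add_comm]
  exact ⟨diag_qm _ fun i j => hc _ _, by
    rw [diag_opcof sh h0 hadd]; exact diag_qm _ fun i j => (hc _ _).op⟩

theorem diag_opminor {A : Type*} [AddCommMonoid A] (sh : A → D) (h0 : sh 0 = 1)
    (hadd : ∀ a b, sh (a + b) = sh a * sh b) (f : Fin n → A) (I J : 𝔽 n) :
    mq q (opM (cof q (Matrix.diagonal fun i => sh (f i)))) I J =
      if I = J then op (sh (∑ i ∈ I, ∑ k ∈ {i}ᶜ, f k)) else 0 := by
  rw [diag_opcof sh h0 hadd, mq]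
  exact diag_minor (fun a => op (sh a)) (by rw [h0]; rfl)
    (fun a b => by rw [add_comm, hadd]; rfl) (fun i => ∑ k ∈ {i}ᶜ, f k) _ J I

theorem one_dbl : Dbl q (1 : 𝕄 n D) :=
  diag_dbl (fun _ : ℕ => (1 : D)) rfl (fun _ _ => (one_mul 1).symm) (fun _ : Fin n => 0)

theorem one_opminor (I J : 𝔽 n) :
    mq q (opM (cof q (1 : 𝕄 n D))) I J = if I = J then 1 else 0 :=
  diag_opminor (fun _ : ℕ => (1 : D)) rfl (fun _ _ => (one_mul 1).symm) (fun _ : Fin n => 0) I J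

theorem ninv_single_compl (k : Fin n) : ninv {k} ({k}ᶜ : 𝔽 n) = k.1 := by
  rw [ninv_singleton_left, cl, sum_boole]
  have : (({k}ᶜ : 𝔽 n).filter (fun b => b < k)) = Finset.Iio k := by
    ext b; simp only [mem_filter, mem_compl, mem_singleton, mem_Iio]
    exact ⟨fun h => h.2, fun h => ⟨h.ne, h⟩⟩
  rw [this]; simp

theorem sum_powerset_single {M : Type*} [AddCommMonoid M] (g : 𝔽 n → M)
    (hg : ∀ K, K.card ≠ 1 → g K = 0) :
    ∑ K ∈ (Finset.univ : 𝔽 n).powerset, g K = ∑ k : Fin n, g {k} := by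
  symm
  apply sum_of_injOn (fun k : Fin n => ({k} : 𝔽 n))
  · intro a _ b _ h; exact singleton_injective h
  · intro a _; simp
  · intro K _ hK
    apply hg
    intro h
    obtain ⟨k, hk⟩ := card_eq_one.1 h
    exact hK ⟨k, by simp, hk.symm⟩
  · intro a _; rfl

theorem contr_row (hX : IsQM q X) (i j : Fin n) :
    T1 X (cof q X) i j = if i = j then mq q X Finset.univ Finset.univ else 0 := by
  have h := lapRow hX Finset.univ {i} {j}ᶜ
  rw [sum_powerset_single] at h
  · simp only [← compl_eq_univ_sdiff, ninv_single_compl, minor_one] at h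
    have h2 : T1 X (cof q X) i j = (((-q) ^ (-(j.1 : ℤ)) : Rˣ) : R) •
        ∑ k : Fin n, (𝕟 q R) ^ k.1 • (X i k * minor (𝕟 q R) X {j}ᶜ {k}ᶜ) := by
      rw [T1, smul_sum]
      refine sum_congr rfl fun k _ => ?_
      rw [cof, mul_smul_comm, smul_smul]
      congr 1
      rw [← Units.val_neg, ← Units.val_pow_eq_pow_val, ← Units.val_mul, ← zpow_natCast, ← zpow_add]
      congr 2; ring
    rw [h2, h]
    by_cases hij : i = j
    · subst hij
      rw [if_pos rfl, if_pos disjoint_compl_right, ninv_single_compl, union_compl, smul_smul,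
        ← Units.val_neg, ← Units.val_pow_eq_pow_val, ← Units.val_mul, ← zpow_natCast, ← zpow_add]
      simp
    · rw [if_neg hij, if_neg, smul_zero]
      simp [hij]
  · intro K hK
    rw [minor_card _ X {i} K (by simpa using Ne.symm hK), zero_mul, smul_zero]

theorem contr_col (hX : IsQM q X) (i j : Fin n) : T2 q X (cof q X) i j =
    if i = j then ((q ^ (2 * i.1) : Rˣ) : R) • mq q X Finset.univ Finset.univ else 0 := by
  have h := lapCol hX Finset.univ {i} {j}ᶜ
  have e : ∀ k : ℕ, q ^ (2 * k) = (-q) ^ (2 * (k : ℤ)) := by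
    intro k; rw [zpow_mul, zpow_natCast]; norm_cast; rw [pow_mul, neg_sq]
  rw [sum_powerset_single] at h
  · simp only [← compl_eq_univ_sdiff, ninv_single_compl, minor_one] at h
    have h2 : T2 q X (cof q X) i j = (((-q) ^ ((j.1 : ℤ)) : Rˣ) : R) •
        ∑ k : Fin n, (𝕟 q R) ^ k.1 • (X k i * minor (𝕟 q R) X {k}ᶜ {j}ᶜ) := by
      rw [T2, smul_sum]
      refine sum_congr rfl fun k _ => ?_
      rw [cof, mul_smul_comm, smul_smul, smul_smul]
      congr 1
      rw [← Units.val_neg, ← Units.val_pow_eq_pow_val, ← Units.val_mul, ← Units.val_mul, e,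
        ← zpow_natCast, ← zpow_add, ← zpow_add]
      congr 2; ring
    rw [h2, h]
    by_cases hij : i = j
    · subst hij
      rw [if_pos rfl, if_pos disjoint_compl_right, ninv_single_compl, union_compl, smul_smul,
        ← Units.val_neg, ← Units.val_pow_eq_pow_val, ← Units.val_mul, ← zpow_natCast, ← zpow_add, e]
      congr 4; ring
    · rw [if_neg hij, if_neg, smul_zero]
      simp [hij]
  · intro K hK
    rw [minor_card _ X K {i} (by simpa using hK), zero_mul, smul_zero]

end thirteen
section fourteen
variable {R : Type*} [CommRing R] {n : ℕ} {q : Rˣ}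
open MulOpposite

def Nic (f : DD R) (w : ℕ → ℕ) : Prop := ∃ c : (ℕ → ℕ) → R, (∀ m, IsUnit (c m)) ∧ f = mop c w

theorem Nic.mul {f g : DD R} {w w'} (h : Nic f w) (h' : Nic g w') : Nic (f * g) (w + w') := by
  obtain ⟨c, hc, rfl⟩ := h
  obtain ⟨c', hc', rfl⟩ := h'
  rw [mop_mul]
  exact ⟨_, fun m => (hc _).mul (hc' _), rfl⟩

theorem Nic_one : Nic (1 : DD R) 0 := ⟨_, fun _ => isUnit_one, mop_one.symm⟩

theorem Nic.smul {f : DD R} {w} (h : Nic f w) (a : Rˣ) : Nic ((a : R) • f) w := by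
  obtain ⟨c, hc, rfl⟩ := h
  rw [mop_smul]
  exact ⟨_, fun m => a.isUnit.mul (hc _), rfl⟩

theorem Nic.both {f : DD R} {w} (h : Nic f w) : Tri f w ∧ Sup f (fun w' => w' = w) := by
  obtain ⟨c, hc, rfl⟩ := h
  exact ⟨Tri_mop _ _ hc, Sup_mop _ _ _ rfl⟩

noncomputable def Qm (q : Rˣ) (a : ℕ) : DD R := mop (fun m => ((q ^ (m a) : Rˣ) : R)) 0
noncomputable def Sm (R : Type*) [CommRing R] (w : ℕ → ℕ) : DD R := mop (fun _ => 1) w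

theorem Qm_nic (q : Rˣ) (a : ℕ) : Nic (Qm q a) 0 := ⟨_, fun _ => Units.isUnit _, rfl⟩
theorem Sm_nic (w : ℕ → ℕ) : Nic (Sm R w) w := ⟨_, fun _ => isUnit_one, rfl⟩

theorem Sm_zero : Sm R 0 = 1 := mop_one
theorem Sm_add (a b : ℕ → ℕ) : Sm R (a + b) = Sm R a * Sm R b := by
  unfold Sm; rw [mop_mul]; simp

theorem Qm_mul (q : Rˣ) (a : ℕ) : Qm q a * Qm q⁻¹ a = 1 := by
  unfold Qm; rw [mop_mul, ← mop_one]
  congr 1; ext m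
  rw [← Units.val_mul, add_zero, inv_pow, mul_inv_cancel, Units.val_one]

theorem trip (q : Rˣ) (a : ℕ) : Trip q (Qm q a) (Qm q⁻¹ a) (Sm R (Pi.single a 1)) where
  a := Qm_mul q a
  b := by have := Qm_mul q⁻¹ a; rwa [inv_inv] at this
  c := by
    unfold Qm Sm; rw [mop_mul, mop_mul, mop_smul]
    simp [pow_succ, mul_comm]

theorem Qm_comm (q q' : Rˣ) (a b : ℕ) : Commute (Qm q a) (Qm q' b) :=
  mop_comm (fun m => by simp) (fun m => by simp)
theorem Sm_comm (w w' : ℕ → ℕ) : Commute (Sm R w) (Sm R w') :=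
  mop_comm (fun _ => rfl) (fun _ => rfl)
theorem QS_comm (q : Rˣ) (a : ℕ) (w : ℕ → ℕ) (h : w a = 0) : Commute (Qm q a) (Sm R w) :=
  mop_comm (fun m => by simp [h]) (fun m => rfl)

noncomputable def step (q : Rˣ) (n : ℕ) (σ : ℕ → ℕ) (t : ℕ) : 𝕄 n (DD R) :=
  if h : n - 1 - t / n ≤ t % n ∧ t % n + 1 < n then
    Ele ⟨t % n, lt_trans (Nat.lt_succ_self _) h.2⟩ ⟨t % n + 1, h.2⟩ (Qm q (σ t)) (Qm q⁻¹ (σ t))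
      (Sm R (Pi.single (σ t) 1))
  else 1

noncomputable def Um (q : Rˣ) (n : ℕ) (σ : ℕ → ℕ) : ℕ → ℕ → 𝕄 n (DD R)
  | _, 0 => 1
  | t, m + 1 => step q n σ t * Um q n σ (t + 1) m

theorem step_dbl (σ : ℕ → ℕ) (t : ℕ) : Dbl q (step q n σ t) := by
  unfold step; split_ifs with h
  · exact Ele_dbl (trip q _) _ _ rfl
  · exact one_dbl

theorem step_cm (σ τ : ℕ → ℕ) (t t' : ℕ) (h : σ t ≠ τ t') : Cm (step q n σ t) (step q n τ t') := by
  unfold step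
  split_ifs with h1 h2 h2
  · intro i j k l
    have c1 := Sm_comm (R := R) (Pi.single (σ t) 1) (Pi.single (τ t') 1)
    have c2 : ∀ q : Rˣ, Commute (Qm q (σ t)) (Sm R (Pi.single (τ t') 1)) := fun q =>
      QS_comm q _ _ (by simp [h])
    have c3 : ∀ q : Rˣ, Commute (Sm R (Pi.single (σ t) 1)) (Qm q (τ t')) := fun q =>
      (QS_comm q _ _ (by simp [h.symm])).symm
    have c4 := fun q q' : Rˣ => Qm_comm q q' (σ t) (τ t')
    unfold Ele
    split_ifs <;> simp only [Commute.one_left, Commute.one_right, Commute.zero_left,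
      Commute.zero_right, c1, c2, c3, c4]
  · exact Cm_one.symm
  · exact Cm_one
  · exact Cm_one

theorem Um_cm_of {Z : 𝕄 n (DD R)} (σ : ℕ → ℕ) (m : ℕ) : ∀ t,
    (∀ t' ≥ t, Cm (step q n σ t') Z) → Cm (Um q n σ t m) Z := by
  induction m with
  | zero => intro t _; exact Cm_one
  | succ m ih => intro t h; exact (h t le_rfl).mul (ih (t + 1) fun t' ht => h t' (by omega))

theorem step_Um_cm {σ : ℕ → ℕ} (hσ : StrictMono σ) (t m : ℕ) :
    Cm (step q n σ t) (Um q n σ (t + 1) m) :=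
  (Um_cm_of σ m (t + 1) fun t' ht => step_cm _ _ _ _ (hσ.injective.ne (by omega))).symm

theorem Um_dbl {σ : ℕ → ℕ} (hσ : StrictMono σ) (m : ℕ) : ∀ t, Dbl q (Um q n σ t m) := by
  induction m with
  | zero => intro t; exact one_dbl
  | succ m ih => intro t; exact (step_dbl σ t).mul (ih _) (step_Um_cm hσ t m)

noncomputable def Mx (q : Rˣ) (n : ℕ) (σ : ℕ → ℕ) (t : ℕ) (I J : 𝔽 n) : DD R :=
  mq q (step q n σ t) I J
noncomputable def My (q : Rˣ) (n : ℕ) (σ : ℕ → ℕ) (t : ℕ) (I J : 𝔽 n) : (DD R)ᵐᵒᵖ :=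
  mq q (opM (cof q (step q n σ t))) Iᶜ Jᶜ

theorem Um_mx {σ : ℕ → ℕ} (hσ : StrictMono σ) (m : ℕ) : ∀ t I J,
    mq q (Um q n σ t m : Matrix _ _ (DD R)) I J = Comp (Mx q n σ) t m I J := by
  induction m with
  | zero => intro t I J; exact one_minor _ I J
  | succ m ih =>
    intro t I J
    rw [Um, mq, minor_mul (step_dbl (q := q) σ t).x _ (step_Um_cm (q := q) hσ t m), Comp]
    exact sum_congr rfl fun K _ => by rw [← ih]; rfl

theorem Um_my {σ : ℕ → ℕ} (hσ : StrictMono σ) (m : ℕ) : ∀ t (I J : 𝔽 n),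
    mq q (opM (cof q (Um q n σ t m : Matrix _ _ (DD R)))) Iᶜ Jᶜ = Comp (My q n σ) t m I J := by
  induction m with
  | zero => intro t I J; rw [Um, one_opminor, Comp]; simp only [compl_inj_iff]
  | succ m ih =>
    intro t I J
    rw [Um, (step_dbl (q := q) σ t).minor_mul (step_Um_cm (q := q) hσ t m), Comp,
      ← Equiv.sum_comp (Function.Involutive.toPerm _ (compl_involutive (α := 𝔽 n)))]
    exact sum_congr rfl fun K _ => by rw [← ih]; rfl

theorem Stp_of {D : Type*} [Ring D] [Algebra R D] (e : D →ₗ[R] DD R)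
    (M : 𝔽 n → 𝔽 n → D) (p p' : Fin n) (σ : ℕ) (A : 𝔽 n → D) (B : D)
    (hM : ∀ I J, M I J = if I = J then A I else
      if p' ∈ J ∧ p ∉ J ∧ I = insert p (J.erase p') then B else 0)
    (hA : ∀ I, Nic (e (A I)) 0) (hB : Nic (e B) (Pi.single σ 1)) : Stp e M p p' σ where
  diag I := by rw [hM, if_pos rfl]; exact (hA I).both
  mv J h1 h2 := by
    rw [hM, if_neg, if_pos ⟨h1, h2, rfl⟩]
    · exact hB.both
    · intro h; rw [← h] at h2; simp at h2
  zero I J h1 h2 := by rw [hM, if_neg h1, if_neg h2]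

theorem mlt_id : Mlt (R := R) (D := DD R) LinearMap.id := ⟨rfl, Or.inl fun _ _ => rfl⟩

noncomputable def uo (R : Type*) [CommRing R] : (DD R)ᵐᵒᵖ →ₗ[R] DD R :=
  (opLinearEquiv R).symm.toLinearMap

theorem mlt_uo : Mlt (R := R) (D := (DD R)ᵐᵒᵖ) (uo R) := ⟨rfl, Or.inr fun _ _ => rfl⟩

theorem mx_net {σ : ℕ → ℕ} (hσ : StrictMono σ) : Net (R := R) (D := DD R) LinearMap.id (Mx q n σ) σ where
  real t p p' hp hp' h := by
    have hp'2 := p'.2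
    have hs : step q n σ t = Ele p p' (Qm q (σ t)) (Qm q⁻¹ (σ t)) (Sm R (Pi.single (σ t) 1)) := by
      unfold step
      rw [dif_pos ⟨hp ▸ h, by rw [← hp]; omega⟩]
      congr 1 <;> apply Fin.ext
      · exact hp.symm
      · simp only; omega
    refine Stp_of _ _ p p' _ _ _ (fun I J => by rw [Mx, hs]; exact Ele_minor _ _ _ _ p p' hp' J I) ?_ ?_
    · intro I
      rw [← add_zero (0 : ℕ → ℕ)]
      apply Nic.mul <;> split_ifs <;> first | exact Nic_one | exact Qm_nic _ _
    · exact Sm_nic _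
  skip t h I J := by
    have hs : step q n σ t = 1 := by unfold step; rw [dif_neg h]
    rw [Mx, hs]; exact one_minor _ I J
  mono := hσ

theorem my_net {σ : ℕ → ℕ} (hσ : StrictMono σ) : Net (R := R) (D := (DD R)ᵐᵒᵖ) (uo R) (My q n σ) σ where
  real t p p' hp hp' h := by
    have hp'2 := p'.2
    have hpp : p ≠ p' := by rintro rfl; omega
    have hs : step q n σ t = Ele p p' (Qm q (σ t)) (Qm q⁻¹ (σ t)) (Sm R (Pi.single (σ t) 1)) := by
      unfold step
      rw [dif_pos ⟨hp ▸ h, by rw [← hp]; omega⟩]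
      congr 1 <;> apply Fin.ext
      · exact hp.symm
      · simp only; omega
    have T := trip q (σ t)
    refine Stp_of _ _ p p' _ (fun I => (if p ∈ Iᶜ then op (Qm q⁻¹ (σ t)) else 1) *
        (if p' ∈ Iᶜ then op (Qm q (σ t)) else 1))
      (op (-(((q⁻¹ : Rˣ) : R) • Sm R (Pi.single (σ t) 1)))) (fun I J => ?_) ?_ ?_
    · rw [My, hs, Ele_opcof T p p' hp', mq, ← minor_transpose (Ele_qm T.op p p' hp'),
        Ele_minor _ _ _ _ p p' hp']
      by_cases hIJ : I = J
      · subst hIJ; simp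
      · rw [if_neg (by rw [compl_inj_iff]; exact Ne.symm hIJ), if_neg hIJ]
        congr 1
        rw [eq_iff_iff]
        constructor
        · rintro ⟨h1, h2, h3⟩
          have hJ : J = insert p' (I.erase p) := by
            ext a
            have := congrArg (a ∈ ·) h3
            simp only [mem_compl, mem_insert, mem_erase, eq_iff_iff] at this h1 h2 ⊢
            by_cases e1 : a = p
            · subst e1; simp [hpp] at this ⊢; exact this
            · by_cases e2 : a = p'
              · simp_all
              · simp [e1, e2] at this ⊢; exact not_iff_not.1 this
          simp only [mem_compl, not_not] at h1 h2
          subst hJ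
          refine ⟨by simp, by simp [hpp], ?_⟩
          rw [erase_insert (by simp [h1]), insert_erase h2]
        · rintro ⟨h1, h2, rfl⟩
          refine ⟨by simp [hpp.symm], by simp, ?_⟩
          ext a
          simp only [mem_compl, mem_insert, mem_erase]
          by_cases e1 : a = p
          · subst e1; simp [h2]
          · by_cases e2 : a = p' <;> simp_all
    · intro I
      have : ∀ a b : (DD R)ᵐᵒᵖ, uo R (a * b) = uo R b * uo R a := fun _ _ => rfl
      rw [this, ← add_zero (0 : ℕ → ℕ)]
      apply Nic.mul <;> split_ifs <;> first | exact Nic_one | exact Qm_nic _ _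
    · have : uo R (op (-(((q⁻¹ : Rˣ) : R) • Sm R (Pi.single (σ t) 1)))) =
        ((-q⁻¹ : Rˣ) : R) • Sm R (Pi.single (σ t) 1) := by
        rw [Units.val_neg]; exact (neg_smul ((q⁻¹ : Rˣ) : R) (Sm R (Pi.single (σ t) 1))).symm
      rw [this]
      exact (Sm_nic _).smul _
  skip t h I J := by
    have hs : step q n σ t = 1 := by unfold step; rw [dif_neg h]
    rw [My, hs, one_opminor]; simp only [compl_inj_iff]
  mono := hσ

end fourteen
section fifteen
variable {R : Type*} [CommRing R] {n : ℕ} {q : Rˣ}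
open MulOpposite

theorem ini_lex (K : 𝔽 n) (h : K ≠ ini n K.card) :
    ∃ i : Fin n, i ∉ K ∧ i ∈ ini n K.card ∧ ∀ j < i, j ∈ K ∧ j ∈ ini n K.card := by
  classical
  have hk : K.card ≤ n := by simpa using card_le_univ K
  have hc : (ini n K.card).card = K.card := by
    unfold ini
    rw [Fin.card_filter_val_lt]
    omega
  have h1 : (ini n K.card \ K).Nonempty := by
    rw [sdiff_nonempty]
    intro hs
    exact h (eq_of_subset_of_card_le hs (by rw [hc])).symm
  have h2 := Finset.min'_mem _ h1
  set i := (ini n K.card \ K).min' h1 with hi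
  rw [mem_sdiff] at h2
  refine ⟨i, h2.2, h2.1, fun j hj => ?_⟩
  have h3 : j ∈ ini n K.card := by
    have := h2.1
    simp only [ini, mem_filter, mem_univ, true_and] at this ⊢
    exact lt_trans hj this
  refine ⟨?_, h3⟩
  by_contra hK
  exact absurd (Finset.min'_le _ j (mem_sdiff.2 ⟨h3, hK⟩)) (not_le.2 hj)

variable {D : Type*} [Ring D] [Algebra R D] {e : D →ₗ[R] DD R}

theorem tri_sum (he : Mlt e) {Ml Mu : ℕ → 𝔽 n → 𝔽 n → D} {σ τ : ℕ → ℕ}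
    (hl : Net e Ml σ) (hu : Net e Mu τ) (hσ : ∀ t, n ≤ σ t) (hτ : ∀ t, n ≤ τ t) (hn : 0 < n)
    (g : 𝔽 n → ℕ → ℕ) (I J : 𝔽 n) (hIJ : J.card = I.card)
    (hg : ∀ K : 𝔽 n, K.card = I.card → K ≠ ini n I.card →
      ∃ i < n, (∀ j < i, g K j = g (ini n I.card) j) ∧ g K i < g (ini n I.card) i)
    (B : 𝔽 n → D) (hB : ∀ K, Nic (e (B K)) (g K)) (u : 𝔽 n → Rˣ) (N : ℕ)
    (hN : N = n * n - 1)
    (hz : ∀ K : 𝔽 n, K.card ≠ I.card → Comp Ml 0 N K I = 0) :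
    Tri (e (∑ K, (u K : R) • (Comp Ml 0 N K I * (B K * Comp Mu 0 N K J))))
      (WV σ I + (g (ini n I.card) + WV τ J)) := by
  classical
  subst hN
  rw [← add_sum_erase _ _ (mem_univ (ini n I.card)), map_add]
  apply Tri.add
  · rw [map_smul]
    apply Tri.smul
    refine he.tri (hl.main he hn I) (he.tri (hB _).both.1 ?_)
    have := hu.main he hn J
    rwa [hIJ] at this
  · rw [map_sum]
    apply Sup_sum
    intro K hK
    rw [map_smul]
    apply Sup.smul
    by_cases hc : K.card = I.card
    · obtain ⟨i, hi, h1, h2⟩ := hg K hc (ne_of_mem_erase hK)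
      have z1 : ∀ w : ℕ → ℕ, (∀ i, w i ≠ 0 → ∃ t' ≥ 0, i = σ t') → ∀ j < n, w j = 0 := by
        intro w hw j hj
        by_contra hne
        obtain ⟨t, -, rfl⟩ := hw j hne
        have := hσ t; omega
      have z2 : ∀ w : ℕ → ℕ, (∀ i, w i ≠ 0 → ∃ t' ≥ 0, i = τ t') → ∀ j < n, w j = 0 := by
        intro w hw j hj
        by_contra hne
        obtain ⟨t, -, rfl⟩ := hw j hne
        have := hτ t; omega
      have z3 := z1 (WV σ I) (fun i hi => Wv_supp I _ 0 i hi)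
      have z4 := z2 (WV τ J) (fun i hi => Wv_supp J _ 0 i hi)
      refine he.sup (P' := fun w => ∀ j < n, w j = g K j) (Comp_sup hl he I _ 0 K)
        (he.sup (hB K).both.2 (Comp_sup hu he J _ 0 K) ?_) ?_
      · intro a b ha hb j hj
        rw [ha, Pi.add_apply, z2 b hb j hj, add_zero]
      · intro a b ha hb
        refine ⟨i, fun j hj => ?_, ?_⟩
        · have hjn := lt_trans hj hi
          simp only [Pi.toLex_apply, Pi.add_apply, z3 j hjn, z4 j hjn, z1 a ha j hjn, hb j hjn, h1 j hj,
            add_zero]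
        · simp only [Pi.toLex_apply, Pi.add_apply, z3 i hi, z4 i hi, z1 a ha i hi, hb i hi, add_zero,
            zero_add]
          exact h2
    · rw [hz K hc, zero_mul, map_zero]; exact Sup_zero

def gx (K : 𝔽 n) : ℕ → ℕ := ∑ i ∈ K, Pi.single i.1 1
def gy (K : 𝔽 n) : ℕ → ℕ := ∑ i ∈ Kᶜ, ∑ k ∈ {i}ᶜ, Pi.single k.1 1

theorem gx_apply (K : 𝔽 n) (t : Fin n) : gx K t.1 = if t ∈ K then 1 else 0 := by
  classical
  simp only [gx, Finset.sum_apply, Pi.single_apply, Fin.val_inj]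
  rw [sum_ite_eq]

theorem gy_apply (K : 𝔽 n) (t : Fin n) :
    gy K t.1 + (if t ∈ K then 0 else 1) = Kᶜ.card := by
  classical
  have h : gy K t.1 = ∑ i ∈ Kᶜ, if i = t then 0 else 1 := by
    simp only [gy, Finset.sum_apply, Pi.single_apply, Fin.val_inj]
    refine sum_congr rfl fun i _ => ?_
    rw [sum_ite_eq]; simp [eq_comm]
  have h2 : (if t ∈ K then 0 else 1) = ∑ i ∈ Kᶜ, if i = t then 1 else 0 := by
    rw [sum_ite_eq']; simp only [mem_compl]; split_ifs <;> simp_all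
  rw [h, h2, ← sum_add_distrib, card_eq_sum_ones]
  refine sum_congr rfl fun i _ => ?_
  split_ifs <;> rfl

theorem gx_lt (K : 𝔽 n) (k : ℕ) (hk : K.card = k) (h : K ≠ ini n k) :
    ∃ i < n, (∀ j < i, gx K j = gx (ini n k) j) ∧ gx K i < gx (ini n k) i := by
  subst hk
  obtain ⟨i, h1, h2, h3⟩ := ini_lex K h
  refine ⟨i.1, i.2, fun j hj => ?_, ?_⟩
  · have := h3 ⟨j, lt_trans hj i.2⟩ hj
    rw [show j = (⟨j, lt_trans hj i.2⟩ : Fin n).1 from rfl, gx_apply, gx_apply, if_pos this.1,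
      if_pos this.2]
  · rw [gx_apply, gx_apply, if_neg h1, if_pos h2]; exact Nat.one_pos

theorem gy_lt (K : 𝔽 n) (k : ℕ) (hk : K.card = k) (h : K ≠ ini n k) :
    ∃ i < n, (∀ j < i, gy K j = gy (ini n k) j) ∧ gy K i < gy (ini n k) i := by
  subst hk
  have hk : K.card ≤ n := by simpa using card_le_univ K
  have hc : (ini n K.card)ᶜ.card = Kᶜ.card := by
    rw [card_compl, card_compl]
    congr 1
    unfold ini
    rw [Fin.card_filter_val_lt]
    omega
  obtain ⟨i, h1, h2, h3⟩ := ini_lex K h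
  refine ⟨i.1, i.2, fun j hj => ?_, ?_⟩
  · have := h3 ⟨j, lt_trans hj i.2⟩ hj
    have a1 := gy_apply K ⟨j, lt_trans hj i.2⟩
    have a2 := gy_apply (ini n K.card) ⟨j, lt_trans hj i.2⟩
    rw [if_pos this.1] at a1
    rw [if_pos this.2] at a2
    simp only at a1 a2; omega
  · have a1 := gy_apply K i
    have a2 := gy_apply (ini n K.card) i
    rw [if_neg h1] at a1
    rw [if_pos h2] at a2
    omega

def sl (n t : ℕ) : ℕ := n + 2 * t
def su (n t : ℕ) : ℕ := n + 2 * t + 1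

theorem sl_mono : StrictMono (sl n) := fun a b h => by unfold sl; omega
theorem su_mono : StrictMono (su n) := fun a b h => by unfold su; omega

noncomputable abbrev UL (q : Rˣ) (n : ℕ) : 𝕄 n (DD R) := Um q n (sl n) 0 (n * n - 1)
noncomputable abbrev UU (q : Rˣ) (n : ℕ) : 𝕄 n (DD R) := Um q n (su n) 0 (n * n - 1)
noncomputable abbrev Dd (R : Type*) [CommRing R] (n : ℕ) : 𝕄 n (DD R) :=
  Matrix.diagonal fun i : Fin n => Sm R (Pi.single i.1 1)
noncomputable def XX (q : Rˣ) (n : ℕ) : 𝕄 n (DD R) :=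
  (UL q n).transpose * (Dd R n * UU q n)

theorem step_diag (σ : ℕ → ℕ) (t : ℕ) (w : Fin n → ℕ → ℕ) (hw : ∀ i, w i (σ t) = 0) :
    Cm (step q n σ t) (Matrix.diagonal fun i => Sm R (w i)) := by
  intro i j k l
  have h1 : ∀ i j, Commute (step q n σ t i j) (Sm R (w k)) := by
    intro i j
    have c2 := fun q : Rˣ => QS_comm q (σ t) (w k) (hw k)
    have c1 := Sm_comm (R := R) (Pi.single (σ t) 1) (w k)
    unfold step
    split_ifs with h
    · unfold Ele
      split_ifs <;> simp only [Commute.one_left, Commute.zero_left, c1, c2]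
    · rw [Matrix.one_apply]; split_ifs <;> simp
  by_cases hkl : k = l
  · subst hkl; rw [Matrix.diagonal_apply_eq]; exact h1 i j
  · rw [Matrix.diagonal_apply_ne _ hkl]; exact Commute.zero_right _

theorem UL_diag (w : Fin n → ℕ → ℕ) (hw : ∀ i, ∀ j ≥ n, w i j = 0) :
    Cm (UL q n) (Matrix.diagonal fun i => Sm R (w i)) :=
  Um_cm_of _ _ _ fun t' _ => step_diag _ _ _ fun i => hw i _ (by unfold sl; omega)

theorem UU_diag (w : Fin n → ℕ → ℕ) (hw : ∀ i, ∀ j ≥ n, w i j = 0) :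
    Cm (UU q n) (Matrix.diagonal fun i => Sm R (w i)) :=
  Um_cm_of _ _ _ fun t' _ => step_diag _ _ _ fun i => hw i _ (by unfold su; omega)

theorem dl_supp (i : Fin n) (j : ℕ) (h : j ≥ n) : (Pi.single i.1 1 : ℕ → ℕ) j = 0 := by
  have := i.2
  rw [Pi.single_apply, if_neg (by omega)]

theorem UL_UU : Cm (UL q n : Matrix _ _ (DD R)) (UU q n) :=
  Um_cm_of _ _ _ fun t' _ => (Um_cm_of _ _ _ fun t'' _ =>
    step_cm (R := R) _ _ _ _ (by unfold sl su; omega)).symm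

theorem cm1 : Cm (Dd R n) (UU q n) := (UU_diag _ fun i j h => dl_supp i j h).symm

theorem cm2 : Cm (UL q n : Matrix _ _ (DD R)).transpose (Dd R n * UU q n) :=
  (((UL_diag (R := R) _ fun i j h => dl_supp i j h).symm.mul (UL_UU (R := R) (q := q)).symm).symm).transpose

theorem UL_dbl : Dbl q (UL q n : Matrix _ _ (DD R)) := Um_dbl sl_mono _ _
theorem UU_dbl : Dbl q (UU q n : Matrix _ _ (DD R)) := Um_dbl su_mono _ _
theorem Dd_dbl : Dbl q (Dd R n) := diag_dbl (Sm R) Sm_zero Sm_add _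

theorem XX_dbl : Dbl q (XX q n : Matrix _ _ (DD R)) :=
  (UL_dbl (R := R)).transpose.mul ((Dd_dbl (R := R)).mul (UU_dbl (R := R)) (cm1 (R := R))) cm2

theorem XX_minor (I J : 𝔽 n) : mq q (XX q n : Matrix _ _ (DD R)) I J =
    ∑ K, mq q (UL q n) K I * (Sm R (gx K) * mq q (UU q n) K J) := by
  rw [XX, mq, minor_mul (UL_dbl (q := q)).transpose.x _ cm2]
  refine sum_congr rfl fun K _ => ?_
  rw [← minor_transpose (UL_dbl (q := q)).x, minor_mul (Dd_dbl (q := q)).x _ cm1]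
  congr 1
  rw [sum_eq_single K]
  · rw [diag_minor (Sm R) Sm_zero Sm_add, if_pos rfl]; rfl
  · intro L _ hL; rw [diag_minor (Sm R) Sm_zero Sm_add, if_neg hL.symm, zero_mul]
  · intro h; exact absurd (mem_univ K) h

theorem XX_opminor (I J : 𝔽 n) : ∃ u : 𝔽 n → Rˣ,
    mq q (opM (cof q (XX q n : Matrix _ _ (DD R)))) Iᶜ Jᶜ =
    ∑ K, (u K : R) • (Comp (My q n (sl n)) 0 (n * n - 1) K I * (op (Sm R (gy K)) *
      Comp (My q n (su n)) 0 (n * n - 1) K J)) := by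
  have h := fun K => (UL_dbl (R := R) (n := n) (q := q)).minor_transpose Iᶜ Kᶜ
  choose u hu using h
  refine ⟨u, ?_⟩
  rw [XX, (UL_dbl (q := q)).transpose.minor_mul cm2,
    ← Equiv.sum_comp (Function.Involutive.toPerm _ (compl_involutive (α := 𝔽 n)))]
  refine sum_congr rfl fun K _ => ?_
  change mq q _ Iᶜ Kᶜ * mq q _ Kᶜ Jᶜ = _
  rw [hu, smul_mul_assoc, Um_my sl_mono, (Dd_dbl (q := q)).minor_mul cm1]
  congr 2
  rw [sum_eq_single Kᶜ]
  · rw [diag_opminor (Sm R) Sm_zero Sm_add, if_pos rfl, Um_my su_mono]; rfl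
  · intro L _ hL; rw [diag_opminor (Sm R) Sm_zero Sm_add, if_neg hL.symm, zero_mul]
  · intro h; exact absurd (mem_univ Kᶜ) h

theorem XX_tri (hn : 0 < n) (I J : 𝔽 n) (hIJ : J.card = I.card) :
    Tri (mq q (XX q n : Matrix _ _ (DD R)) I J) (WV (sl n) I + (gx (ini n I.card) + WV (su n) J)) := by
  have h := tri_sum (e := (LinearMap.id : DD R →ₗ[R] DD R)) mlt_id (mx_net (q := q) (n := n) (sl_mono (n := n)))
    (mx_net (q := q) (su_mono (n := n))) (fun t => by unfold sl; omega) (fun t => by unfold su; omega) hn gx I J hIJ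
    (fun K h1 h2 => gx_lt K _ h1 h2) (fun K => Sm R (gx K)) (fun K => Sm_nic _) (fun _ => 1) _ rfl
    (fun K hK => by rw [← Um_mx sl_mono]; exact minor_card _ _ _ _ hK)
  rw [XX_minor]
  convert h using 1
  refine sum_congr rfl fun K _ => ?_
  rw [Units.val_one, one_smul, ← Um_mx sl_mono, ← Um_mx su_mono]

theorem XX_optri (hn : 0 < n) (I J : 𝔽 n) (hIJ : J.card = I.card) :
    Tri (uo R (mq q (opM (cof q (XX q n : Matrix _ _ (DD R)))) Iᶜ Jᶜ))
      (WV (sl n) I + (gy (ini n I.card) + WV (su n) J)) := by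
  obtain ⟨u, hu⟩ := XX_opminor (R := R) (q := q) I J
  rw [hu]
  exact tri_sum mlt_uo (my_net (q := q) (n := n) (sl_mono (n := n)))
    (my_net (q := q) (su_mono (n := n))) (fun t => by unfold sl; omega) (fun t => by unfold su; omega) hn gy I J hIJ
    (fun K h1 h2 => gy_lt K _ h1 h2) (fun K => op (Sm R (gy K))) (fun K => Sm_nic _) u _ rfl
    (fun K hK => by
      rw [← Um_my sl_mono]
      refine minor_card _ _ _ _ fun h => hK ?_
      have h1 : K.card ≤ n := by simpa using card_le_univ K
      have h2 : I.card ≤ n := by simpa using card_le_univ I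
      rw [card_compl, card_compl, Fintype.card_fin] at h; omega)

theorem det_mul {X Y : 𝕄 n (DD R)} (hX : IsQM q X) (h : Cm X Y) :
    mq q (X * Y) Finset.univ Finset.univ =
      mq q X Finset.univ Finset.univ * mq q Y Finset.univ Finset.univ := by
  rw [mq, minor_mul hX _ h, sum_eq_single Finset.univ]
  · intro K _ hK
    rw [minor_card _ X _ _ (fun h => hK (eq_univ_of_card K (by rw [← h]; simp))), zero_mul]
  · intro h; exact absurd (mem_univ _) h

theorem Um_det {σ : ℕ → ℕ} (hσ : StrictMono σ) (m : ℕ) : ∀ t,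
    mq q (Um q n σ t m : Matrix _ _ (DD R)) Finset.univ Finset.univ = 1 := by
  induction m with
  | zero => intro t; rw [Um, mq, one_minor, if_pos rfl]
  | succ m ih =>
    intro t
    rw [Um, det_mul (step_dbl (q := q) σ t).x (step_Um_cm hσ t m), ih, mul_one]
    unfold step; split_ifs with h
    · rw [mq, Ele_minor _ _ _ _ _ _ rfl]; simp [Qm_mul]
    · rw [mq, one_minor, if_pos rfl]

theorem XX_det : mq q (XX q n : Matrix _ _ (DD R)) Finset.univ Finset.univ =
    Sm R (gx (Finset.univ : 𝔽 n)) := by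
  rw [XX, det_mul (UL_dbl (q := q)).transpose.x cm2, det_mul (Dd_dbl (q := q)).x cm1, mq,
    ← minor_transpose (UL_dbl (q := q)).x]
  rw [show minor (𝕟 q R) (UL q n : Matrix _ _ (DD R)) Finset.univ Finset.univ = 1 from Um_det sl_mono _ _,
    show mq q (UU q n : Matrix _ _ (DD R)) Finset.univ Finset.univ = 1 from Um_det su_mono _ _,
    one_mul, mul_one, mq, diag_minor (Sm R) Sm_zero Sm_add, if_pos rfl]; rfl

theorem XX_det_comm (i j : Fin n) :
    Commute (mq q (XX q n : Matrix _ _ (DD R)) Finset.univ Finset.univ) (XX q n i j) := by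
  rw [XX_det]
  have hw : ∀ j ≥ n, gx (Finset.univ : 𝔽 n) j = 0 := by
    intro j hj; rw [gx, Finset.sum_apply]
    exact sum_eq_zero fun i _ => dl_supp i j hj
  have h1 := UL_diag (R := R) (q := q) (fun _ : Fin n => gx (Finset.univ : 𝔽 n)) fun _ => hw
  have h2 := UU_diag (R := R) (q := q) (fun _ : Fin n => gx (Finset.univ : 𝔽 n)) fun _ => hw
  have h3 : Cm (Dd R n) (Matrix.diagonal fun _ : Fin n => Sm R (gx (Finset.univ : 𝔽 n))) := by
    intro i j k l
    have e1 : Dd R n i j = if i = j then Sm R (Pi.single i.1 1) else 0 := Matrix.diagonal_apply _ _ _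
    rw [Matrix.diagonal_apply, e1]
    split_ifs <;> simp [Sm_comm]
  have := (h1.transpose.mul (h3.mul h2)) i j i i
  rw [Matrix.diagonal_apply_eq] at this
  exact this.symm

end fifteen
section sixteen
variable {R : Type*} [CommRing R] {n : ℕ} {q : Rˣ}
open MulOpposite TensorProduct

def xm (R : Type*) [CommRing R] (q : Rˣ) (n : ℕ) : 𝕄 n (AqAlg R q n) :=
  fun i j => xq R q n i j

theorem xm_qm : IsQM q (xm R q n) where
  col i j k h := by
    have := RingQuot.mkAlgHom_rel R (QMRel.col (R := R) (q := q) (k := k) h)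
    rw [map_smul, map_mul, map_mul] at this; exact this
  row k i j h := by
    have := RingQuot.mkAlgHom_rel R (QMRel.row (R := R) (q := q) (k := k) h)
    rw [map_smul, map_mul, map_mul] at this; exact this
  comm i j k l h h' := by
    have := RingQuot.mkAlgHom_rel R (QMRel.comm (R := R) (q := q) h h')
    rw [map_mul, map_mul] at this; exact this
  qcomm i j k l h h' := by
    have := RingQuot.mkAlgHom_rel R (QMRel.qcomm (R := R) (q := q) h h')
    rw [map_add, map_smul, map_mul, map_mul, map_mul] at this; exact this

variable {D : Type*} [Ring D] [Algebra R D]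

theorem lift_rel {X : 𝕄 n D} (hX : IsQM q X) ⦃a b⦄ (h : QMRel R q n a b) :
    FreeAlgebra.lift R (fun p : Fin n × Fin n => X p.1 p.2) a =
      FreeAlgebra.lift R (fun p : Fin n × Fin n => X p.1 p.2) b := by
  cases h <;> simp only [map_mul, map_smul, map_add, FreeAlgebra.lift_ι_apply]
  · exact hX.col _ _ _ ‹_›
  · exact hX.row _ _ _ ‹_›
  · exact hX.comm _ _ _ _ ‹_› ‹_›
  · exact hX.qcomm _ _ _ _ ‹_› ‹_›

noncomputable def liftA {X : 𝕄 n D} (hX : IsQM q X) : AqAlg R q n →ₐ[R] D :=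
  RingQuot.liftAlgHom R ⟨FreeAlgebra.lift R fun p : Fin n × Fin n => X p.1 p.2, lift_rel hX⟩

theorem liftA_xm {X : 𝕄 n D} (hX : IsQM q X) (i j : Fin n) :
    liftA hX (xm R q n i j) = X i j := by
  unfold liftA xm xq
  rw [RingQuot.liftAlgHom_mkAlgHom_apply, FreeAlgebra.lift_ι_apply]

variable {B : Type*} [Ring B] [Algebra R B]

theorem IsQM.map {X : 𝕄 n D} (hX : IsQM q X) (f : D →ₐ[R] B) :
    IsQM q (fun i j => f (X i j)) where
  col i j k h := by rw [← map_mul, hX.col i j k h, map_smul, map_mul]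
  row i j k h := by rw [← map_mul, hX.row i j k h, map_smul, map_mul]
  comm i j k l h h' := by rw [← map_mul, hX.comm i j k l h h', map_mul]
  qcomm i j k l h h' := by
    rw [← map_mul, hX.qcomm i j k l h h', map_add, map_smul, map_mul, map_mul]

theorem Dm_map (s : R) (X : 𝕄 n D) (Y : 𝕄 n B)
    (f : D →ₐ[R] B) (h : ∀ i j, f (X i j) = Y i j) (L : List (Fin n)) :
    ∀ I, f (Dm s X I L) = Dm s Y I L := by
  induction L with
  | nil => intro I; rw [Dm, Dm]; split_ifs <;> simp
  | cons j L ih =>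
    intro I; rw [Dm, Dm, map_sum]
    exact sum_congr rfl fun i _ => by rw [map_smul, map_mul, ih, h]

theorem mq_map (X : 𝕄 n D) (Y : 𝕄 n B)
    (f : D →ₐ[R] B) (h : ∀ i j, f (X i j) = Y i j) (I J) : f (mq q X I J) = mq q Y I J :=
  Dm_map _ X Y f h _ I

theorem Pm_map (X : 𝕄 n D) (Y : 𝕄 n B)
    (f : D →ₐ[R] B) (h : ∀ i j, f (X i j) = Y i j) (l : PL n) : f (Pm q X l) = Pm q Y l := by
  rw [Pm, map_list_prod, List.map_map]
  congr 2
  ext p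
  exact mq_map X Y f h _ _

theorem Wd_map (X : 𝕄 n D) (Y : 𝕄 n B)
    (f : D →ₐ[R] B) (h : ∀ i j, f (X i j) = Y i j) (l) : f (Wd X l) = Wd Y l := by
  rw [Wd, map_list_prod, List.map_map]
  congr 2
  ext p
  exact h _ _

abbrev BB (R : Type*) [CommRing R] (q : Rˣ) (n : ℕ) := AqAlg R q n ⊗[R] AqAlg R q n

noncomputable def bx (R : Type*) [CommRing R] (q : Rˣ) (n : ℕ) : 𝕄 n (BB R q n) :=
  fun i j => (Algebra.TensorProduct.includeLeft : AqAlg R q n →ₐ[R] BB R q n) (xm R q n i j)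
noncomputable def bY (R : Type*) [CommRing R] (q : Rˣ) (n : ℕ) : 𝕄 n (BB R q n) :=
  fun i j => (Algebra.TensorProduct.includeRight : AqAlg R q n →ₐ[R] BB R q n) (xm R q n i j)

theorem bx_qm : IsQM q (bx R q n) := xm_qm.map _
theorem bY_qm : IsQM q (bY R q n) := xm_qm.map _
theorem bxY (i j k l : Fin n) : Commute (bx R q n i j) (bY R q n k l) := by
  unfold Commute SemiconjBy bx bY
  simp

noncomputable def ps (R : Type*) [CommRing R] (q : Rˣ) (n : ℕ) : AqAlg R q n →ₐ[R] DD R :=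
  liftA (XX_dbl (R := R) (q := q) (n := n)).x
noncomputable def py (R : Type*) [CommRing R] (q : Rˣ) (n : ℕ) : AqAlg R q n →ₐ[R] (DD R)ᵐᵒᵖ :=
  liftA (XX_dbl (R := R) (q := q) (n := n)).y

noncomputable def Ev (R : Type*) [CommRing R] (q : Rˣ) (n : ℕ) : BB R q n →ₗ[R] DD R :=
  LinearMap.mul' R (DD R) ∘ₗ TensorProduct.map (ps R q n).toLinearMap
    (uo R ∘ₗ (py R q n).toLinearMap)

theorem Ev_tmul (a b : AqAlg R q n) : Ev R q n (a ⊗ₜ b) = ps R q n a * unop (py R q n b) := rfl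

theorem bx_mul_bY (i j k l : Fin n) : bx R q n i j * bY R q n k l = xm R q n i j ⊗ₜ xm R q n k l := by
  simp [bx, bY]

noncomputable abbrev dt (R : Type*) [CommRing R] (q : Rˣ) (n : ℕ) : DD R :=
  mq q (XX q n : Matrix _ _ (DD R)) Finset.univ Finset.univ

theorem Ev_xy (a b : AqAlg R q n) (i j k l : Fin n) :
    Ev R q n ((a ⊗ₜ b) * (bx R q n i j * bY R q n k l)) =
      ps R q n a * (XX q n i j * cof q (XX q n) k l) * unop (py R q n b) := by
  rw [bx_mul_bY, Algebra.TensorProduct.tmul_mul_tmul, Ev_tmul, map_mul, map_mul, unop_mul,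
    ps, py, liftA_xm, liftA_xm]
  simp only [opM, unop_op, mul_assoc]

theorem Ev_T1 (a b : AqAlg R q n) (i j : Fin n) :
    Ev R q n ((a ⊗ₜ b) * T1 (bx R q n) (bY R q n) i j) =
      ps R q n a * (if i = j then dt R q n else 0) * unop (py R q n b) := by
  rw [T1, mul_sum, map_sum]
  simp only [Ev_xy]
  rw [← sum_mul, ← mul_sum]
  congr 2
  exact contr_row (XX_dbl (R := R)).x i j

theorem Ev_T2 (a b : AqAlg R q n) (i j : Fin n) :
    Ev R q n ((a ⊗ₜ b) * T2 q (bx R q n) (bY R q n) i j) =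
      ps R q n a * (if i = j then ((q ^ (2 * i.1) : Rˣ) : R) • dt R q n else 0) *
        unop (py R q n b) := by
  rw [T2, mul_sum, map_sum]
  have key : ∀ k : Fin n, Ev R q n ((a ⊗ₜ b) * ((q ^ (2 * k.1) : Rˣ) : R) •
      (bx R q n k i * bY R q n k j)) = ps R q n a * (((q ^ (2 * k.1) : Rˣ) : R) •
        (XX q n k i * cof q (XX q n) k j)) * unop (py R q n b) := fun k => by
    rw [mul_smul_comm, map_smul, Ev_xy, mul_smul_comm, smul_mul_assoc]
  refine (sum_congr rfl fun k _ => key k).trans ?_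
  rw [← sum_mul, ← mul_sum]
  congr 2
  exact contr_col (XX_dbl (R := R)).x i j

theorem Ev_Zq (z : BB R q n) (hz : z ∈ Zq q (bx R q n) (bY R q n)) : Ev R q n z = 0 := by
  have : Zq q (bx R q n) (bY R q n) ≤ LinearMap.ker (Ev R q n) := by
    rw [Zq, Submodule.span_le]
    rintro _ ⟨a, g, hg, rfl⟩
    rw [SetLike.mem_coe, LinearMap.mem_ker]
    induction a using TensorProduct.induction_on with
    | zero => rw [zero_mul, map_zero]
    | add a b ha hb => rw [add_mul, map_add, ha, hb, add_zero]
    | tmul a b =>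
      cases hg with
      | g1 i j h => rw [Ev_T1, if_neg h, mul_zero, zero_mul]
      | g2 i j h => rw [Ev_T2, if_neg h, mul_zero, zero_mul]
      | g3 i j =>
        refine (congrArg (Ev R q n) (mul_sub _ _ _)).trans ?_
        rw [map_sub, Ev_T1, cT, mul_smul_comm, map_smul, Ev_T2, if_pos rfl, if_pos rfl,
          mul_smul_comm, smul_mul_assoc, smul_smul, Units.inv_mul, one_smul, sub_self]
  exact this hz

theorem dt_comm (a : AqAlg R q n) : ps R q n a * dt R q n = dt R q n * ps R q n a := by
  obtain ⟨a, rfl⟩ := RingQuot.mkAlgHom_surjective R (QMRel R q n) a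
  induction a using FreeAlgebra.induction with
  | grade0 r => rw [AlgHom.commutes, AlgHom.commutes]; exact Algebra.commutes _ _
  | grade1 p =>
    have : ps R q n (RingQuot.mkAlgHom R (QMRel R q n) (FreeAlgebra.ι R p)) = XX q n p.1 p.2 :=
      liftA_xm _ p.1 p.2
    rw [this]; exact (XX_det_comm (R := R) p.1 p.2).eq.symm
  | mul a b ha hb => rw [map_mul, map_mul, mul_assoc, hb, ← mul_assoc, ha, mul_assoc]
  | add a b ha hb => rw [map_add, map_add, add_mul, ha, hb, mul_add]

theorem Ev_c (z : BB R q n) (o : Fin n) :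
    Ev R q n (z * T1 (bx R q n) (bY R q n) o o) = dt R q n * Ev R q n z := by
  induction z using TensorProduct.induction_on with
  | zero => rw [zero_mul, map_zero, mul_zero]
  | add a b ha hb => rw [add_mul, map_add, ha, hb, map_add, mul_add]
  | tmul a b => rw [Ev_T1, if_pos rfl, dt_comm, mul_assoc, Ev_tmul]

theorem Ev_ck (z : BB R q n) (o : Fin n) (k : ℕ) :
    Ev R q n (z * T1 (bx R q n) (bY R q n) o o ^ k) = dt R q n ^ k * Ev R q n z := by
  induction k with
  | zero => simp
  | succ k ih => rw [pow_succ, ← mul_assoc, Ev_c, ih, pow_succ', mul_assoc]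

theorem Ev_bst (o : Fin n) (k : ℕ) (lx ly : PL n) :
    Ev R q n (bst q (bx R q n) (bY R q n) (T1 (bx R q n) (bY R q n) o o) k lx ly) =
      dt R q n ^ k * (Pm q (XX q n) lx * unop (Pm q (opM (cof q (XX q n))) ly)) := by
  rw [bst, Ev_ck]
  congr 1
  rw [← Pm_map (xm R q n) (bx R q n) Algebra.TensorProduct.includeLeft (fun _ _ => rfl),
    ← Pm_map (xm R q n) (bY R q n) Algebra.TensorProduct.includeRight (fun _ _ => rfl),
    Algebra.TensorProduct.includeLeft_apply, Algebra.TensorProduct.includeRight_apply,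
    Algebra.TensorProduct.tmul_mul_tmul, one_mul, mul_one, Ev_tmul,
    Pm_map (xm R q n) (XX q n) (ps R q n) (fun i j => liftA_xm _ i j),
    Pm_map (xm R q n) (opM (cof q (XX q n))) (py R q n) (fun i j => liftA_xm _ i j)]

def wx (p : 𝔽 n × 𝔽 n) : ℕ → ℕ :=
  WV (sl n) p.1 + (gx (ini n p.1.card) + WV (su n) p.2)
def wy (p : 𝔽 n × 𝔽 n) : ℕ → ℕ :=
  WV (sl n) p.1ᶜ + (gy (ini n p.1ᶜ.card) + WV (su n) p.2ᶜ)
def wb (k : ℕ) (lx ly : PL n) : ℕ → ℕ :=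
  k • gx (Finset.univ : 𝔽 n) + ((lx.map wx).sum + (ly.map wy).sum)

theorem Pm_tri (hn : 0 < n) (l : PL n) (h : Sq l) :
    Tri (Pm q (XX q n : Matrix _ _ (DD R)) l) (l.map wx).sum := by
  induction l with
  | nil => exact Tri_one
  | cons p l ih =>
    rw [Pm_cons, List.map_cons, List.sum_cons]
    exact (XX_tri hn p.1 p.2 (h p (by simp)).symm).mul (ih fun p hp => h p (by simp [hp]))

theorem Pm_optri (hn : 0 < n) (l : PL n) (h : Sq l) :
    Tri (unop (Pm q (opM (cof q (XX q n : Matrix _ _ (DD R)))) l)) (l.map wy).sum := by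
  induction l with
  | nil => exact Tri_one
  | cons p l ih =>
    rw [Pm_cons, List.map_cons, List.sum_cons, unop_mul, add_comm]
    have h1 := XX_optri (R := R) (q := q) hn p.1ᶜ p.2ᶜ (by
      rw [card_compl, card_compl, h p (by simp)])
    rw [compl_compl, compl_compl] at h1
    exact (ih fun p hp => h p (by simp [hp])).mul h1

theorem dt_tri (k : ℕ) : Tri (dt R q n ^ k) (k • gx (Finset.univ : 𝔽 n)) := by
  induction k with
  | zero => rw [pow_zero, zero_smul]; exact Tri_one
  | succ k ih =>
    rw [pow_succ, succ_nsmul]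
    refine ih.mul ?_
    rw [dt, XX_det]; exact (Sm_nic _).both.1

theorem bst_tri (o : Fin n) (k : ℕ) (lx ly : PL n) (hx : Sq lx) (hy : Sq ly) :
    Tri (Ev R q n (bst q (bx R q n) (bY R q n) (T1 (bx R q n) (bY R q n) o o) k lx ly))
      (wb k lx ly) := by
  rw [Ev_bst]
  exact (dt_tri k).mul ((Pm_tri o.pos lx hx).mul (Pm_optri o.pos ly hy))

end sixteen
section seventeen
variable {n : ℕ}

def isum {α : Type*} (P : α → Prop) [DecidablePred P] (l : List α) : ℕ :=
  (l.map fun z => if P z then 1 else 0).sum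

theorem isum_append {α : Type*} (P : α → Prop) [DecidablePred P] (l l' : List α) :
    isum P (l ++ l') = isum P l + isum P l' := by simp [isum]
theorem isum_cons {α : Type*} (P : α → Prop) [DecidablePred P] (a : α) (l' : List α) :
    isum P (a :: l') = (if P a then 1 else 0) + isum P l' := by simp [isum]
theorem isum_rev {α : Type*} (P : α → Prop) [DecidablePred P] (l : List α) :
    isum P l.reverse = isum P l := by simp [isum, List.sum_reverse]
theorem isum_le {α : Type*} (P : α → Prop) [DecidablePred P] (l : List α) :
    isum P l ≤ l.length := by
  induction l with
  | nil => simp [isum]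
  | cons a l ih => rw [isum_cons, List.length_cons]; split_ifs <;> omega
theorem isum_all {α : Type*} (P : α → Prop) [DecidablePred P] (l : List α) (h : ∀ a ∈ l, P a) :
    isum P l = l.length := by
  induction l with
  | nil => simp [isum]
  | cons a l ih =>
    rw [isum_cons, List.length_cons, ih fun b hb => h b (by simp [hb]), if_pos (h a (by simp))]
    omega

theorem sorted_eq (l : List ℕ) : ∀ l' : List ℕ, l.Pairwise (· ≤ ·) → l'.Pairwise (· ≤ ·) →
    l.length = l'.length → (∀ a, isum (a < ·) l = isum (a < ·) l') → l = l' := by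
  induction l with
  | nil => intro l' _ _ h _; exact (List.length_eq_zero_iff.1 h.symm).symm
  | cons x l ih =>
    intro l' h h' hl hc
    cases l' with
    | nil => simp at hl
    | cons y l' =>
      rw [List.pairwise_cons] at h h'
      simp only [List.length_cons, Nat.add_right_cancel_iff] at hl
      have hxy : x = y := by
        rcases lt_trichotomy x y with hh | hh | hh
        · have := hc x
          rw [isum_cons, isum_cons, if_neg (lt_irrefl _), if_pos hh,
            isum_all _ l' fun a ha => hh.trans_le (h'.1 a ha)] at this
          have := isum_le (x < ·) l
          omega
        · exact hh
        · have := hc y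
          rw [isum_cons, isum_cons, if_neg (lt_irrefl _), if_pos hh,
            isum_all _ l fun a ha => hh.trans_le (h.1 a ha)] at this
          have := isum_le (y < ·) l'
          omega
      subst hxy
      rw [ih l' h.2 h'.2 hl fun a => by have := hc a; rw [isum_cons, isum_cons] at this; omega]

theorem cnt_cc (I : 𝔽 n) (t : Fin n) : cnt I t = cc I (t.1 + 1) := by
  unfold cnt cc
  congr 1; ext i; simp only [mem_filter, Fin.le_def]
  constructor <;> rintro ⟨a, b⟩ <;> exact ⟨a, by omega⟩

theorem cnt_inj (I J : 𝔽 n) (h : ∀ t, cnt I t = cnt J t) : I = J := by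
  have hc : ∀ i ≤ n, cc I i = cc J i := by
    intro i hi
    cases i with
    | zero => rw [cc_zero, cc_zero]
    | succ i => have := h ⟨i, hi⟩; rwa [cnt_cc, cnt_cc] at this
  ext i
  have h1 := hc i.1 i.2.le
  have h2 := hc (i.1 + 1) i.2
  rw [cc_succ, cc_succ] at h2
  by_cases ha : i ∈ I <;> by_cases hb : i ∈ J <;> simp only [ha, hb, if_true, if_false] at h2 ⊢ <;>
    omega

theorem isum_split (c : List (𝔽 n)) (a p : ℕ) :
    isum (fun Z => a < cc Z (p + 1)) c + isum (fun Z : 𝔽 n => a < Z.card ∧ cc Z (p + 1) ≤ a) c =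
      isum (fun Z : 𝔽 n => a < Z.card) c := by
  induction c with
  | nil => simp [isum]
  | cons Z c ih =>
    rw [isum_cons, isum_cons, isum_cons, ← ih]
    have := cc_le_card Z (p + 1)
    split_ifs <;> omega

theorem isum_congr {α : Type*} (P Q : α → Prop) [DecidablePred P] [DecidablePred Q]
    (h : ∀ a, P a ↔ Q a) (l : List α) : isum P l = isum Q l := by
  unfold isum; congr 2; ext a; simp only [h a]

theorem isum_map {α β : Type*} (P : β → Prop) [DecidablePred P] (f : α → β) (l : List α) :
    isum P (l.map f) = isum (fun a => P (f a)) l := by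
  unfold isum; rw [List.map_map]; rfl

theorem isum_zero {α : Type*} (P : α → Prop) [DecidablePred P] (h : ∀ a, ¬ P a) (l : List α) :
    isum P l = 0 := by
  induction l with
  | nil => rfl
  | cons a l ih => rw [isum_cons, ih, if_neg (h a)]

theorem chain_rec (c c' : List (𝔽 n))
    (h : c.IsChain (fun b a => ∀ t, cnt b t ≤ cnt a t))
    (h' : c'.IsChain (fun b a => ∀ t, cnt b t ≤ cnt a t)) (hl : c.length = c'.length)
    (h1 : ∀ a < n, isum (fun Z : 𝔽 n => a < Z.card) c =
      isum (fun Z : 𝔽 n => a < Z.card) c')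
    (h2 : ∀ t < n * n - 1, isum (fun Z => Wc Z t) c = isum (fun Z => Wc Z t) c') : c = c' := by
  have h1' : ∀ a, isum (fun Z : 𝔽 n => a < Z.card) c =
      isum (fun Z : 𝔽 n => a < Z.card) c' := by
    intro a
    by_cases ha : a < n
    · exact h1 a ha
    · have : ∀ Z : 𝔽 n, ¬ a < Z.card := fun Z => by
        have := card_le_univ Z; rw [Fintype.card_fin] at this; omega
      rw [isum_zero _ this, isum_zero _ this]
  have key : ∀ (p : Fin n) a, isum (fun Z => a < cc Z (p.1 + 1)) c = isum (fun Z => a < cc Z (p.1 + 1)) c' := by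
    intro p a
    by_cases hap : p.1 < a
    · have : ∀ Z : 𝔽 n, ¬ a < cc Z (p.1 + 1) := fun Z => by
        have := cc_le Z (p.1 + 1); omega
      rw [isum_zero _ this, isum_zero _ this]
    by_cases hp : p.1 + 1 < n
    · have hs := isum_split c a p.1
      have hs' := isum_split c' a p.1
      have hd : ((n - 1 - a) * n + p.1) / n = n - 1 - a := by
        rw [mul_comm, Nat.mul_add_div (by omega), Nat.div_eq_of_lt p.2, add_zero]
      have hm : ((n - 1 - a) * n + p.1) % n = p.1 := by
        rw [mul_comm, Nat.mul_add_mod, Nat.mod_eq_of_lt p.2]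
      have hw : ∀ Z : 𝔽 n, Wc Z ((n - 1 - a) * n + p.1) ↔ (a < Z.card ∧ cc Z (p.1 + 1) ≤ a) := by
        intro Z
        unfold Wc
        rw [hd, hm, show n - 1 - (n - 1 - a) = a by omega]
        constructor
        · rintro ⟨_, _, h⟩; exact h
        · exact fun h => ⟨by omega, hp, h⟩
      have hlt : (n - 1 - a) * n + p.1 < n * n - 1 := by
        have : (n - 1 - a) * n ≤ (n - 1) * n := Nat.mul_le_mul_right _ (by omega)
        have h4 : (n - 1) * n = n * n - n := by rw [Nat.sub_mul, one_mul]
        have h3 : n ≤ n * n := Nat.le_mul_self n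
        omega
      have := h2 _ hlt
      rw [isum_congr _ _ hw, isum_congr _ _ hw] at this
      have := h1' a
      omega
    · have : p.1 + 1 = n := by have := p.2; omega
      rw [this]; simp only [cc_n]; exact h1' a
  have hmap : ∀ p : Fin n, c.map (fun Z => cnt Z p) = c'.map (fun Z => cnt Z p) := by
    intro p
    refine sorted_eq _ _ ?_ ?_ (by simp [hl]) ?_
    · rw [← List.isChain_iff_pairwise, List.isChain_map]; exact h.imp fun _ _ h => h p
    · rw [← List.isChain_iff_pairwise, List.isChain_map]; exact h'.imp fun _ _ h => h p
    · intro a; rw [isum_map, isum_map]; simp only [cnt_cc]; exact key p a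
  refine List.ext_getElem hl fun i hi hi' => cnt_inj _ _ fun t => ?_
  have := List.getElem_of_eq (hmap t) (i := i) (by simpa using hi)
  simpa using this

def ch (a b : List (𝔽 n)) : List (𝔽 n) := a ++ (b.map compl).reverse

theorem ch_len (a b : List (𝔽 n)) : (ch a b).length = a.length + b.length := by simp [ch]

theorem ch_chain {a b : List (𝔽 n)} (h : Std1 a b) :
    (ch a b).IsChain (fun b a => ∀ t, cnt b t ≤ cnt a t) := by
  unfold ch
  refine List.isChain_append.2 ⟨h.cx, ?_, ?_⟩
  · rw [List.isChain_reverse, List.isChain_map]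
    refine h.cy.imp fun A B hAB t => ?_
    have := hAB t; have := cnt_compl A t; have := cnt_compl B t
    omega
  · intro x hx y hy t
    rw [List.head?_reverse] at hy
    obtain ⟨P, rfl⟩ := List.getLast?_eq_some_iff.1 hx
    obtain ⟨Q, hQ⟩ := List.getLast?_eq_some_iff.1 hy
    obtain ⟨Q', b', rfl, hb1, hb2⟩ := List.map_eq_append_iff.1 hQ
    obtain ⟨b, rfl, rfl⟩ := List.map_eq_singleton_iff.1 hb2
    have := h.cm P Q' x b rfl rfl t
    have := cnt_compl b t
    omega

theorem ch_inj {a b a' b' : List (𝔽 n)} (hl : a.length = a'.length) (h : ch a b = ch a' b') :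
    a = a' ∧ b = b' := by
  obtain ⟨h1, h2⟩ := List.append_inj h hl
  exact ⟨h1, List.map_injective_iff.2 compl_injective (List.reverse_injective h2)⟩

theorem isum_ch (P : 𝔽 n → Prop) [DecidablePred P] (a b : List (𝔽 n)) :
    isum P (ch a b) = isum P a + isum (fun Z => P Zᶜ) b := by
  rw [ch, isum_append, isum_rev, isum_map]

theorem listsum_apply (l : List (ℕ → ℕ)) (i : ℕ) : l.sum i = (l.map fun f => f i).sum := by
  induction l with
  | nil => rfl
  | cons f l ih => simp [ih]

theorem gx_ge (K : 𝔽 n) (j : ℕ) (h : n ≤ j) : gx K j = 0 := by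
  rw [gx, Finset.sum_apply]; exact sum_eq_zero fun i _ => dl_supp i j h
theorem gy_ge (K : 𝔽 n) (j : ℕ) (h : n ≤ j) : gy K j = 0 := by
  rw [gy, Finset.sum_apply]
  refine sum_eq_zero fun i _ => ?_
  rw [Finset.sum_apply]; exact sum_eq_zero fun i _ => dl_supp i j h

theorem WV_zero (σ : ℕ → ℕ) (J : 𝔽 n) (i : ℕ) (h : ∀ t, i ≠ σ t) : WV σ J i = 0 := by
  by_contra hc
  obtain ⟨t, _, ht⟩ := Wv_supp J _ 0 i hc
  exact h t ht

theorem WV_app (σ : ℕ → ℕ) (hσ : StrictMono σ) (J : 𝔽 n) (t : ℕ) (ht : t < n * n - 1) :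
    WV σ J (σ t) = if Wc J t then 1 else 0 := Wv_apply hσ J _ 0 t (by omega) (by omega)

theorem wb_sl (k : ℕ) (lx ly : PL n) (t : ℕ) (ht : t < n * n - 1) :
    wb k lx ly (sl n t) = isum (fun Z => Wc Z t) (ch (lx.map Prod.fst) (ly.map Prod.fst)) := by
  have hn : n ≤ sl n t := by unfold sl; omega
  have hs : ∀ t', sl n t ≠ su n t' := fun t' => by unfold sl su; omega
  rw [isum_ch, isum_map, isum_map, wb, Pi.add_apply, Pi.add_apply, listsum_apply, listsum_apply,
    List.map_map, List.map_map, Pi.smul_apply, gx_ge _ _ hn, smul_zero, zero_add]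
  congr 2 <;> congr 1 <;> ext p
  · simp only [Function.comp, wx, Pi.add_apply, gx_ge _ _ hn, WV_zero _ _ _ hs, WV_app _ sl_mono _ _ ht, add_zero]
  · simp only [Function.comp, wy, Pi.add_apply, gy_ge _ _ hn, WV_zero _ _ _ hs, WV_app _ sl_mono _ _ ht, add_zero]

theorem wb_su (k : ℕ) (lx ly : PL n) (t : ℕ) (ht : t < n * n - 1) :
    wb k lx ly (su n t) = isum (fun Z => Wc Z t) (ch (lx.map Prod.snd) (ly.map Prod.snd)) := by
  have hn : n ≤ su n t := by unfold su; omega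
  have hs : ∀ t', su n t ≠ sl n t' := fun t' => by unfold sl su; omega
  rw [isum_ch, isum_map, isum_map, wb, Pi.add_apply, Pi.add_apply, listsum_apply, listsum_apply,
    List.map_map, List.map_map, Pi.smul_apply, gx_ge _ _ hn, smul_zero, zero_add]
  congr 2 <;> congr 1 <;> ext p
  · simp only [Function.comp, wx, Pi.add_apply, gx_ge _ _ hn, WV_zero _ _ _ hs, WV_app _ su_mono _ _ ht, zero_add]
  · simp only [Function.comp, wy, Pi.add_apply, gy_ge _ _ hn, WV_zero _ _ _ hs, WV_app _ su_mono _ _ ht, zero_add]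

theorem mem_ini (t : Fin n) (k : ℕ) : t ∈ ini n k ↔ t.1 < k := by simp [ini]

theorem wy_sum (ly : PL n) (t : Fin n) : ((ly.map wy).sum : ℕ → ℕ) t.1 + ly.length =
    tot ly + isum (fun p => t.1 < p.1ᶜ.card) ly := by
  have h1 : ∀ t', t.1 ≠ sl n t' := fun t' => by have := t.2; unfold sl; omega
  have h2 : ∀ t', t.1 ≠ su n t' := fun t' => by have := t.2; unfold su; omega
  induction ly with
  | nil => rfl
  | cons p l ih =>
    rw [List.map_cons, List.sum_cons, Pi.add_apply, List.length_cons, tot_cons, isum_cons]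
    have hw : wy p t.1 = gy (ini n p.1ᶜ.card) t.1 := by
      simp only [wy, Pi.add_apply, WV_zero _ _ _ h1, WV_zero _ _ _ h2, add_zero, zero_add]
    have hg := gy_apply (ini n p.1ᶜ.card) t
    have hc : (ini n p.1ᶜ.card)ᶜ.card = p.1.card := by
      have h3 : p.1ᶜ.card ≤ n := by simpa using card_le_univ p.1ᶜ
      have h4 : (ini n p.1ᶜ.card).card = p.1ᶜ.card := by
        have : (ini n p.1ᶜ.card).card = Fintype.card {i : Fin n // i.1 < p.1ᶜ.card} := by
          rw [Fintype.card_subtype]; rfl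
        rw [← cc_n (ini n p.1ᶜ.card)]
        unfold cc ini
        rw [filter_filter]
        have e : (Finset.univ.filter fun a : Fin n => a.1 < p.1ᶜ.card ∧ a.1 < n) =
          Finset.univ.filter fun a : Fin n => a.1 < p.1ᶜ.card := by ext a; simp
        rw [e, Fin.card_filter_val_lt, min_eq_right h3]
      rw [card_compl, h4, card_compl, Fintype.card_fin]
      have : p.1.card ≤ n := by simpa using card_le_univ p.1
      omega
    rw [hc] at hg
    simp only [mem_ini] at hg
    rw [hw]
    split_ifs at hg ⊢ <;> omega

theorem wx_sum (lx : PL n) (t : Fin n) : ((lx.map wx).sum : ℕ → ℕ) t.1 =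
    isum (fun p => t.1 < p.1.card) lx := by
  have h1 : ∀ t', t.1 ≠ sl n t' := fun t' => by have := t.2; unfold sl; omega
  have h2 : ∀ t', t.1 ≠ su n t' := fun t' => by have := t.2; unfold su; omega
  rw [listsum_apply, List.map_map]
  unfold isum
  congr 2; ext p
  simp only [Function.comp, wx, Pi.add_apply, WV_zero _ _ _ h1, WV_zero _ _ _ h2, add_zero, zero_add,
    gx_apply, mem_ini]

theorem wb_dl {r s k : ℕ} {lx ly : PL n} (h : Valid r s k lx ly) (t : Fin n) :
    wb k lx ly t.1 = isum (fun Z : 𝔽 n => t.1 < Z.card) (ch (lx.map Prod.fst) (ly.map Prod.fst)) := by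
  rw [isum_ch, isum_map, isum_map, wb, Pi.add_apply, Pi.add_apply, wx_sum, Pi.smul_apply, gx_apply,
    if_pos (mem_univ _), smul_eq_mul, mul_one]
  have := wy_sum ly t
  have := h.leny
  have := h.toty
  omega

theorem wb_dl' {r s k : ℕ} {lx ly : PL n} (h : Valid r s k lx ly) (t : Fin n) :
    wb k lx ly t.1 = isum (fun Z : 𝔽 n => t.1 < Z.card) (ch (lx.map Prod.snd) (ly.map Prod.snd)) := by
  rw [wb_dl h, isum_ch, isum_ch, isum_map, isum_map, isum_map, isum_map]
  unfold isum
  congr 2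
  · refine List.map_congr_left fun p hp => ?_
    simp only [h.sqx p hp]
  · refine List.map_congr_left fun p hp => ?_
    simp only [card_compl, h.sqy p hp]

theorem map_fs {α β : Type*} (l l' : List (α × β)) (h : l.map Prod.fst = l'.map Prod.fst)
    (h' : l.map Prod.snd = l'.map Prod.snd) : l = l' := by
  rw [← List.zip_unzip l, ← List.zip_unzip l', List.unzip_eq_map, List.unzip_eq_map, h, h']

theorem wb_inj {r s k k' : ℕ} {lx ly lx' ly' : PL n} (h : Stnd r s k lx ly) (h' : Stnd r s k' lx' ly')
    (hw : wb k lx ly = wb k' lx' ly') : k = k' ∧ lx = lx' ∧ ly = ly' := by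
  have lenx : lx.length = lx'.length := h.v.lenx.trans h'.v.lenx.symm
  have leny : ly.length = ly'.length := h.v.leny.trans h'.v.leny.symm
  have e1 := chain_rec _ _ (ch_chain h.l) (ch_chain h'.l) (by simp [ch_len, lenx, leny])
    (fun a ha => by rw [← wb_dl h.v ⟨a, ha⟩, ← wb_dl h'.v ⟨a, ha⟩, hw])
    (fun t ht => by rw [← wb_sl k _ _ t ht, ← wb_sl k' _ _ t ht, hw])
  have e2 := chain_rec _ _ (ch_chain h.r) (ch_chain h'.r) (by simp [ch_len, lenx, leny])
    (fun a ha => by rw [← wb_dl' h.v ⟨a, ha⟩, ← wb_dl' h'.v ⟨a, ha⟩, hw])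
    (fun t ht => by rw [← wb_su k _ _ t ht, ← wb_su k' _ _ t ht, hw])
  obtain ⟨a1, a2⟩ := ch_inj (by simp [lenx]) e1
  obtain ⟨b1, b2⟩ := ch_inj (by simp [lenx]) e2
  have hx := map_fs _ _ a1 b1
  have hy := map_fs _ _ a2 b2
  refine ⟨?_, hx, hy⟩
  have := h.v.totx; have := h'.v.totx
  subst hx
  omega

end seventeen
section eighteen
variable {R : Type*} [CommRing R]

theorem Sp_coeff (w : ℕ → ℕ) (f : (ℕ → ℕ) →₀ R) (hf : f ∈ Sp R 0 (fun w' => Lt w' w)) (w' : ℕ → ℕ)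
    (h : ¬ Lt w' w) : f w' = 0 := by
  classical
  have : Sp R 0 (fun w' => Lt w' w) ≤ LinearMap.ker (Finsupp.lapply (R := R) (M := R) w') := by
    rw [Sp, Submodule.span_le]
    rintro _ ⟨w'', hw, rfl⟩
    rw [SetLike.mem_coe, LinearMap.mem_ker, Finsupp.lapply_apply, Finsupp.single_apply, if_neg]
    rintro rfl
    rw [zero_add] at h
    exact h hw
  exact this hf

theorem retract {ι : Type*} [DecidableEq ι] [Finite ι] (w : ι → (ℕ → ℕ)) (hw : Function.Injective w)
    (v : ι → ((ℕ → ℕ) →₀ R))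
    (hv : ∀ z, ∃ u : Rˣ, v z - Finsupp.single (w z) (u : R) ∈ Sp R 0 (fun w' => Lt w' (w z))) :
    ∃ ρ : ι → (((ℕ → ℕ) →₀ R) →ₗ[R] R), ∀ z z', ρ z' (v z) = if z = z' then 1 else 0 := by
  classical
  have := Fintype.ofFinite ι
  let _ : LinearOrder ι := LinearOrder.lift' (fun z => toLex (w z)) (fun a b h => hw (toLex.injective h))
  have hlt : ∀ a b : ι, a < b ↔ Lt (w a) (w b) := fun a b => Iff.rfl
  choose u hu using hv
  let M : Matrix ι ι R := fun z z' => v z (w z')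
  have hM : ∀ z z', M z z' = (if w z = w z' then (u z : R) else 0) +
      (v z - Finsupp.single (w z) (u z : R)) (w z') := by
    intro z z'
    rw [Finsupp.sub_apply, Finsupp.single_apply]; ring_nf; rfl
  have hT : M.transpose.BlockTriangular id := by
    intro i j hij
    rw [Matrix.transpose_apply, hM, if_neg, Sp_coeff _ _ (hu j), add_zero]
    · exact fun hc => lt_asymm hij ((hlt i j).2 hc)
    · exact fun hc => (ne_of_lt hij) (hw hc)
  have hd : IsUnit M.det := by
    rw [← Matrix.det_transpose, Matrix.det_of_upperTriangular hT]
    have : ∏ i, M.transpose i i = ((∏ i, u i : Rˣ) : R) := by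
      rw [Units.coe_prod]
      refine prod_congr rfl fun i _ => ?_
      rw [Matrix.transpose_apply, hM, if_pos rfl, Sp_coeff _ _ (hu i), add_zero]
      exact fun hc => lt_irrefl i ((hlt i i).2 hc)
    rw [this]; exact Units.isUnit _
  refine ⟨fun z' => ∑ z'', (M⁻¹ z'' z') • Finsupp.lapply (w z''), fun z z' => ?_⟩
  have h1 := congrFun (congrFun (Matrix.mul_nonsing_inv M hd) z) z'
  rw [Matrix.mul_apply, Matrix.one_apply] at h1
  rw [← h1, LinearMap.sum_apply]
  refine sum_congr rfl fun z'' _ => ?_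
  rw [LinearMap.smul_apply, Finsupp.lapply_apply, smul_eq_mul, mul_comm]

variable {n : ℕ}

abbrev SI (n r s : ℕ) := {p : ℕ × PL n × PL n // Stnd r s p.1 p.2.1 p.2.2}

instance SI_fin (r s : ℕ) : Finite (SI n r s) := by
  have h : Set.Finite ((Set.Iic r ×ˢ ({l : PL n | l.length = r} ×ˢ {l : PL n | l.length = s})) :
      Set (ℕ × PL n × PL n)) :=
    (Set.finite_Iic r).prod ((List.finite_length_eq _ r).prod (List.finite_length_eq _ s))
  refine (h.subset (t := {p : ℕ × PL n × PL n | Stnd r s p.1 p.2.1 p.2.2}) ?_).to_subtype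
  rintro ⟨k, lx, ly⟩ hp
  have hv := hp.v
  refine ⟨?_, hv.lenx, hv.leny⟩
  have := hv.totx
  show k ≤ r
  simp only at this
  omega

noncomputable def vac (R : Type*) [CommRing R] (q : Rˣ) (n : ℕ) : BB R q n →ₗ[R] ((ℕ → ℕ) →₀ R) :=
  (LinearMap.applyₗ (Finsupp.single 0 1)) ∘ₗ Ev R q n

noncomputable def bz (R : Type*) [CommRing R] (q : Rˣ) (o : Fin n) (k : ℕ) (lx ly : PL n) : BB R q n :=
  bst q (bx R q n) (bY R q n) (T1 (bx R q n) (bY R q n) o o) k lx ly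

theorem main_exp (q : Rˣ) (o : Fin n) (ho : o.1 = 0) (r s : ℕ) {T : Type*} [AddCommGroup T] [Module R T]
    (Θ : BB R q n →ₗ[R] T) (hΘ : ∀ z ∈ Zq q (bx R q n) (bY R q n), Θ z = 0) :
    ∃ φ : ((ℕ → ℕ) →₀ R) →ₗ[R] T, ∀ u v : 𝕃 n, u.length = r → v.length = s →
      φ (vac R q n (Wd (bx R q n) u * Wd (bY R q n) v)) = Θ (Wd (bx R q n) u * Wd (bY R q n) v) := by
  classical
  have := Fintype.ofFinite (SI n r s)
  obtain ⟨ρ, hρ⟩ := retract (ι := SI n r s) (R := R) (fun p => wb p.1.1 p.1.2.1 p.1.2.2)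
    (by
      rintro ⟨⟨k, lx, ly⟩, h⟩ ⟨⟨k', lx', ly'⟩, h'⟩ he
      obtain ⟨rfl, rfl, rfl⟩ := wb_inj h h' he
      rfl)
    (fun p => vac R q n (bz R q o p.1.1 p.1.2.1 p.1.2.2))
    (fun p => by
      obtain ⟨u, hu⟩ := bst_tri (R := R) (q := q) o p.1.1 p.1.2.1 p.1.2.2 p.2.v.sqx p.2.v.sqy 0
      rw [zero_add] at hu
      exact ⟨u, hu⟩)
  let φ : ((ℕ → ℕ) →₀ R) →ₗ[R] T :=
    ∑ p : SI n r s, (ρ p).smulRight (Θ (bz R q o p.1.1 p.1.2.1 p.1.2.2))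
  refine ⟨φ, fun u v hu hv => ?_⟩
  have hmem := straighten_words (setup bx_qm bY_qm bxY o ho) (LinearMap.ker (φ ∘ₗ vac R q n - Θ))
    (fun z hz => by
      rw [LinearMap.mem_ker, LinearMap.sub_apply, LinearMap.comp_apply, hΘ z hz]
      have : vac R q n z = 0 := by
        rw [vac, LinearMap.comp_apply, Ev_Zq z hz, map_zero]
      rw [this, map_zero, sub_zero]) r s
    (fun k lx ly h => by
      rw [LinearMap.mem_ker, LinearMap.sub_apply, LinearMap.comp_apply, sub_eq_zero]
      have h1 := fun p => hρ ⟨(k, lx, ly), h⟩ p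
      show φ (vac R q n (bz R q o k lx ly)) = _
      simp only [φ, LinearMap.sum_apply, LinearMap.smulRight_apply]
      simp only at h1
      simp only [h1, ite_smul, one_smul, zero_smul]
      rw [sum_ite_eq, if_pos (mem_univ _)]; rfl) u v hu hv
  rw [LinearMap.mem_ker, LinearMap.sub_apply, LinearMap.comp_apply, sub_eq_zero] at hmem
  exact hmem

end eighteen
section nineteen
variable {R : Type*} [CommRing R] {n : ℕ} {B : Type*} [Ring B] [Algebra R B]
open MulOpposite TensorProduct

def cp {k : ℕ} (p : Fin (k + 1)) (e : Equiv.Perm (Fin k)) : Equiv.Perm (Fin (k + 1)) :=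
  (finSuccEquiv' 0).trans ((Equiv.optionCongr e).trans (finSuccEquiv' p).symm)

theorem cp_zero {k : ℕ} (p : Fin (k + 1)) (e : Equiv.Perm (Fin k)) : cp p e 0 = p := by
  simp [cp]
theorem cp_succ {k : ℕ} (p : Fin (k + 1)) (e : Equiv.Perm (Fin k)) (t : Fin k) :
    cp p e t.succ = p.succAbove (e t) := by
  have : finSuccEquiv' (0 : Fin (k + 1)) t.succ = some t := by
    rw [← Fin.succAbove_zero]; exact finSuccEquiv'_succAbove 0 t
  simp [cp, this]

theorem cp_bij (k : ℕ) : Function.Bijective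
    (fun z : Fin (k + 1) × Equiv.Perm (Fin k) => cp z.1 z.2) := by
  rw [Fintype.bijective_iff_injective_and_card]
  constructor
  · rintro ⟨p, e⟩ ⟨p', e'⟩ h
    simp only at h
    have h0 : p = p' := by rw [← cp_zero p e, h, cp_zero]
    subst h0
    have : e = e' := by
      ext1 t
      have := Equiv.congr_fun h t.succ
      rw [cp_succ, cp_succ] at this
      exact Fin.succAbove_right_injective this
    rw [this]
  · rw [Fintype.card_prod, Fintype.card_perm, Fintype.card_perm, Fintype.card_fin, Fintype.card_fin,
      Nat.factorial_succ]

theorem invCount_sum {k : ℕ} (w : Equiv.Perm (Fin k)) :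
    invCount w = ∑ a, ∑ b, if a < b ∧ w b < w a then 1 else 0 := by
  unfold invCount
  rw [card_filter, Fintype.sum_prod_type]

theorem invCount_cp {k : ℕ} (p : Fin (k + 1)) (e : Equiv.Perm (Fin k)) :
    invCount (cp p e) = (∑ t, if p.succAbove t < p then 1 else 0) + invCount e := by
  rw [invCount_sum, invCount_sum, Fin.sum_univ_succ, Fin.sum_univ_succ]
  congr 1
  · rw [if_neg (by simp), zero_add, ← Equiv.sum_comp e (fun t => if p.succAbove t < p then 1 else 0)]
    refine sum_congr rfl fun t _ => ?_
    rw [cp_zero, cp_succ]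
    simp [Fin.succ_pos]
  · refine sum_congr rfl fun t _ => ?_
    rw [Fin.sum_univ_succ, if_neg (by simp), zero_add]
    refine sum_congr rfl fun t' _ => ?_
    simp only [cp_succ, Fin.succ_lt_succ_iff, (Fin.strictMono_succAbove p).lt_iff_lt]

theorem perm_Dm (s : R) (X : 𝕄 n B) (k : ℕ) : ∀ (rows cols : Fin k → Fin n),
    StrictMono rows → ∑ w : Equiv.Perm (Fin k), s ^ invCount w • oprod (fun t => X (rows (w t)) (cols t)) =
      Dm s X (Finset.univ.image rows) (List.ofFn cols) := by
  induction k with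
  | zero =>
    intro rows cols _
    simp [Dm, invCount, oprod]
  | succ k ih =>
    intro rows cols hr
    rw [List.ofFn_succ, Dm, sum_image (fun a _ b _ h => hr.injective h),
      ← (cp_bij k).sum_comp, Fintype.sum_prod_type]
    refine sum_congr rfl fun p _ => ?_
    have hr' : StrictMono (fun t => rows (p.succAbove t)) := hr.comp (Fin.strictMono_succAbove p)
    have hi : (Finset.univ.image rows).erase (rows p) =
        Finset.univ.image (fun t => rows (p.succAbove t)) := by
      ext i
      simp only [mem_erase, mem_image, mem_univ, true_and]
      constructor
      · rintro ⟨h1, t, rfl⟩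
        obtain ⟨t', rfl⟩ := Fin.exists_succAbove_eq (x := t) (y := p) (fun h => h1 (by rw [h]))
        exact ⟨t', rfl⟩
      · rintro ⟨t, rfl⟩
        exact ⟨fun h => Fin.succAbove_ne p t (hr.injective h), _, rfl⟩
    have hc : cl (Finset.univ.image rows) (rows p) = ∑ t, if p.succAbove t < p then 1 else 0 := by
      rw [cl, sum_image (fun a _ b _ h => hr.injective h)]
      simp only [hr.lt_iff_lt]
      rw [Fin.sum_univ_succAbove _ p, if_neg (lt_irrefl _), zero_add]
    rw [hi, ← ih _ _ hr', mul_sum, smul_sum]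
    refine sum_congr rfl fun e _ => ?_
    rw [invCount_cp, hc, pow_add, mul_smul, mul_smul_comm]
    congr 2
    simp only [oprod, List.ofFn_succ, List.prod_cons, cp_zero, cp_succ]

theorem omit_mono (i : Fin n) : StrictMono (omitIdx i) := by
  intro a b h
  unfold omitIdx
  rw [Fin.lt_def] at h
  split_ifs <;> rw [Fin.lt_def] <;> simp only <;> omega

theorem omit_image (i : Fin n) : Finset.univ.image (omitIdx i) = {i}ᶜ := by
  ext j
  simp only [mem_image, mem_univ, true_and, mem_compl, mem_singleton]
  constructor
  · rintro ⟨t, rfl⟩ h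
    unfold omitIdx at h
    split_ifs at h <;> rw [Fin.ext_iff] at h <;> simp only at h <;> omega
  · intro h
    rw [Fin.ext_iff] at h
    have := i.2; have := j.2
    by_cases hj : j.1 < i.1
    · refine ⟨⟨j.1, by omega⟩, ?_⟩
      unfold omitIdx; rw [if_pos hj]
    · refine ⟨⟨j.1 - 1, by omega⟩, ?_⟩
      unfold omitIdx; rw [if_neg (by simp only; omega)]; ext; simp only; omega

theorem omit_sort (i : Fin n) : List.ofFn (omitIdx i) = ({i}ᶜ : 𝔽 n).sort (· ≤ ·) := by
  have h1 : (List.ofFn (omitIdx i)).Pairwise (· < ·) := List.pairwise_ofFn.2 fun a b h => omit_mono i h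
  have h2 : (List.ofFn (omitIdx i)).toFinset = {i}ᶜ := by
    rw [← omit_image i]; ext j; simp
  rw [← h2, (List.toFinset_sort (· ≤ ·) (h1.imp fun h => h.ne)).2 (h1.imp fun h => h.le)]

variable {q : Rˣ}

theorem compMinor_eq (i j : Fin n) : compMinor R q n i j = mq q (xm R q n) {i}ᶜ {j}ᶜ := by
  have := perm_Dm (𝕟 q R) (xm R q n) (n - 1) (omitIdx i) (omitIdx j) (omit_mono i)
  rw [omit_image, omit_sort] at this
  refine Eq.trans ?_ this
  unfold compMinor qMinorR
  refine sum_congr rfl fun w _ => ?_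
  rw [Units.val_pow_eq_pow_val, Units.val_neg]; rfl

theorem ps_xg (i j : Fin n) : ps R q n (iotaHat R q n (Xg R n i j)) = XX q n i j := by
  have : iotaHat R q n (Xg R n i j) = xm R q n i j := by
    unfold iotaHat Xg; rw [FreeAlgebra.lift_ι_apply]; rfl
  rw [this]; exact liftA_xm _ i j

theorem ps_xs (i j : Fin n) : ps R q n (iotaHat R q n (Xs R n i j)) = cof q (XX q n) i j := by
  have : iotaHat R q n (Xs R n i j) = (((-q) ^ ((j : ℤ) - (i : ℤ)) : Rˣ) : R) • compMinor R q n i j := by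
    unfold iotaHat Xs; rw [FreeAlgebra.lift_ι_apply]
  rw [this, compMinor_eq, map_smul, mq_map (xm R q n) (XX q n) (ps R q n) fun i j => liftA_xm _ i j]; rfl

theorem unop_Wd (Y : 𝕄 n B) (w : 𝕃 n) :
    unop (Wd (opM Y) w.reverse) = Wd Y w := by
  induction w with
  | nil => rfl
  | cons p w ih =>
    rw [List.reverse_cons, Wd_append, unop_mul, ih]
    simp [Wd, opM]

theorem ps_word (u w : 𝕃 n) :
    ps R q n (iotaHat R q n (xW R n u * xsW R n w)) =
      Ev R q n (Wd (bx R q n) u * Wd (bY R q n) w.reverse) := by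
  rw [← Wd_map (xm R q n) (bx R q n) Algebra.TensorProduct.includeLeft (fun _ _ => rfl),
    ← Wd_map (xm R q n) (bY R q n) Algebra.TensorProduct.includeRight (fun _ _ => rfl),
    Algebra.TensorProduct.includeLeft_apply, Algebra.TensorProduct.includeRight_apply,
    Algebra.TensorProduct.tmul_mul_tmul, one_mul, mul_one, Ev_tmul,
    Wd_map (xm R q n) (XX q n) (ps R q n) (fun i j => liftA_xm _ i j),
    Wd_map (xm R q n) (opM (cof q (XX q n))) (py R q n) (fun i j => liftA_xm _ i j),
    unop_Wd, map_mul, map_mul, xW, xsW, map_list_prod, map_list_prod, map_list_prod, map_list_prod,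
    List.map_map, List.map_map, List.map_map, List.map_map, Wd, Wd]
  congr 3 <;> ext1 p
  · exact ps_xg p.1 p.2
  · exact ps_xs p.1 p.2

end nineteen
section twenty
variable {R : Type*} [CommRing R] {n : ℕ} {q : Rˣ}
open MulOpposite TensorProduct

abbrev FA (R : Type*) [CommRing R] (n : ℕ) := FreeAlgebra R (Fin n × Fin n)

def fw (R : Type*) [CommRing R] (n : ℕ) (l : 𝕃 n) : FA R n :=
  (l.map (FreeAlgebra.ι R)).prod

theorem fw_append (u v : 𝕃 n) : fw R n (u ++ v) = fw R n u * fw R n v := by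
  simp [fw]

theorem basis_fw (l : 𝕃 n) :
    FreeAlgebra.basisFreeMonoid R (Fin n × Fin n) (FreeMonoid.ofList l) = fw R n l := by
  simp [FreeAlgebra.basisFreeMonoid, FreeAlgebra.equivMonoidAlgebraFreeMonoid, FreeMonoid.lift_apply, fw]

theorem fa_ext {M : Type*} [AddCommGroup M] [Module R M] {f g : FA R n →ₗ[R] M}
    (h : ∀ l, f (fw R n l) = g (fw R n l)) : f = g :=
  (FreeAlgebra.basisFreeMonoid R (Fin n × Fin n)).ext fun l => by
    have := h l.toList
    rwa [← basis_fw] at this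

noncomputable def wl {M : Type*} [AddCommGroup M] [Module R M] (g : 𝕃 n → M) :
    FA R n →ₗ[R] M := (FreeAlgebra.basisFreeMonoid R (Fin n × Fin n)).constr R fun l => g l.toList

theorem wl_fw {M : Type*} [AddCommGroup M] [Module R M] (g : 𝕃 n → M) (l) :
    wl (R := R) g (fw R n l) = g l := by
  rw [← basis_fw, wl, Module.Basis.constr_basis]; rfl

theorem desc {M : Type*} [AddCommGroup M] [Module R M] (f : FA R n →ₗ[R] M)
    (h : ∀ u v x y, QMRel R q n x y → f (fw R n u * (x - y) * fw R n v) = 0) :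
    ∃ g : AqAlg R q n →ₗ[R] M, ∀ a, g (RingQuot.mkAlgHom R (QMRel R q n) a) = f a := by
  have h1 : ∀ x y, QMRel R q n x y → ∀ a b, f (a * (x - y) * b) = 0 := by
    intro x y hxy a b
    have e1 : ∀ u, (f ∘ₗ LinearMap.mulLeft R (fw R n u * (x - y))) = 0 := fun u =>
      fa_ext fun v => h u v x y hxy
    have e2 : ∀ b, (f ∘ₗ LinearMap.mulRight R b ∘ₗ LinearMap.mulRight R (x - y)) = 0 := fun b =>
      fa_ext fun u => LinearMap.congr_fun (e1 u) b
    exact LinearMap.congr_fun (e2 b) a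
  have h2 : ∀ x y, RingQuot.Rel (QMRel R q n) x y → ∀ a b, f (a * (x - y) * b) = 0 := by
    intro x y hxy
    induction hxy with
    | of h => exact h1 _ _ h
    | add_left _ ih => intro a b; rw [add_sub_add_right_eq_sub]; exact ih a b
    | mul_left _ ih => intro a b; rw [← sub_mul, ← mul_assoc, mul_assoc]; exact ih a _
    | mul_right _ ih => intro a b; rw [← mul_sub, ← mul_assoc]; exact ih _ b
  have h3 : ∀ x y, Relation.EqvGen (RingQuot.Rel (QMRel R q n)) x y → f x = f y := by
    intro x y hxy
    induction hxy with
    | rel x y h =>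
      have := h2 x y h 1 1
      rwa [one_mul, mul_one, map_sub, sub_eq_zero] at this
    | refl x => rfl
    | symm x y _ ih => exact ih.symm
    | trans x y z _ _ h1 h2 => exact h1.trans h2
  have h4 : ∀ x y, RingQuot.mkAlgHom R (QMRel R q n) x = RingQuot.mkAlgHom R (QMRel R q n) y → f x = f y := by
    intro x y hxy
    refine h3 x y ?_
    have e : RingQuot.mkRingHom (QMRel R q n) x = RingQuot.mkRingHom (QMRel R q n) y := by
      rw [← RingQuot.mkAlgHom_coe R]; exact hxy
    simp only [RingQuot.mkRingHom_def, RingHom.coe_mk, MonoidHom.coe_mk, OneHom.coe_mk,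
      RingQuot.mk.injEq] at e
    exact Quot.eqvGen_exact e
  let π := (RingQuot.mkAlgHom R (QMRel R q n)).toLinearMap
  have hs : Function.Surjective π := RingQuot.mkAlgHom_surjective R (QMRel R q n)
  have hk : LinearMap.ker π ≤ LinearMap.ker f := fun x hx => by
    rw [LinearMap.mem_ker] at hx ⊢
    rw [← map_zero f]
    refine h4 x 0 ?_
    rw [map_zero]; exact hx
  refine ⟨(LinearMap.ker π).liftQ f hk ∘ₗ (π.quotKerEquivOfSurjective hs).symm.toLinearMap, fun a => ?_⟩
  have : (π.quotKerEquivOfSurjective hs).symm (π a) = Submodule.Quotient.mk a := by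
    rw [LinearEquiv.symm_apply_eq]; rfl
  show (LinearMap.ker π).liftQ f hk ((π.quotKerEquivOfSurjective hs).symm (π a)) = f a
  rw [this]; rfl

theorem xW_append (u v : 𝕃 n) : xW R n (u ++ v) = xW R n u * xW R n v := by
  simp [xW]
theorem xsW_append (u v : 𝕃 n) : xsW R n (u ++ v) = xsW R n u * xsW R n v := by
  simp [xsW]
theorem xW_two (i j k l : Fin n) : xW R n [(i, j), (k, l)] = Xg R n i j * Xg R n k l := by
  simp [xW]
theorem xsW_two (i j k l : Fin n) : xsW R n [(i, j), (k, l)] = Xs R n i j * Xs R n k l := by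
  simp [xsW]
theorem xW_one (i j : Fin n) : xW R n [(i, j)] = Xg R n i j := by simp [xW]
theorem xsW_one (i j : Fin n) : xsW R n [(i, j)] = Xs R n i j := by simp [xsW]

noncomputable def fe (R : Type*) [CommRing R] (n r s : ℕ) (u w : 𝕃 n) : Frs R n r s :=
  if h : u.length = r ∧ w.length = s then
    ⟨xW R n u * xsW R n w.reverse,
      Submodule.subset_span ⟨u, w.reverse, h.1, by rw [List.length_reverse, h.2], rfl⟩⟩ else 0

theorem fe_val (r s : ℕ) (u w : 𝕃 n) : (fe R n r s u w : FA2 R n) =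
    if u.length = r ∧ w.length = s then xW R n u * xsW R n w.reverse else 0 := by
  unfold fe; split_ifs <;> rfl

noncomputable def ff (R : Type*) [CommRing R] (n r s : ℕ) : FA R n →ₗ[R] FA R n →ₗ[R] Frs R n r s :=
  wl fun u => wl fun w => fe R n r s u w

theorem ff_fw (r s : ℕ) (u w : 𝕃 n) : ff R n r s (fw R n u) (fw R n w) = fe R n r s u w := by
  rw [ff, wl_fw, wl_fw]

theorem fw_mid (u v : 𝕃 n) (a b : Fin n × Fin n) :
    fw R n u * (FreeAlgebra.ι R a * FreeAlgebra.ι R b) * fw R n v = fw R n (u ++ [a, b] ++ v) := by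
  rw [fw_append, fw_append]; simp [fw]

noncomputable abbrev mkY (R : Type*) [CommRing R] (q : Rˣ) (n r s : ℕ) : Frs R n r s →ₗ[R] AqMixed R q n r s :=
  ((Ysub R q n r s).comap (Frs R n r s).subtype).mkQ

theorem mkY_zero {r s : ℕ} (x : Frs R n r s) (h : (x : FA2 R n) ∈ Ysub R q n r s) : mkY R q n r s x = 0 := by
  rw [mkY, Submodule.mkQ_apply, Submodule.Quotient.mk_eq_zero]; exact h

theorem ff_x (r s : ℕ) (u v w : 𝕃 n) (x y) (h : QMRel R q n x y) :
    ((ff R n r s (fw R n u * (x - y) * fw R n v) (fw R n w)) : FA2 R n) ∈ Ysub R q n r s := by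
  by_cases hl : u.length + v.length + 2 = r ∧ w.length = s
  · have hl2 : ∀ a b : Fin n × Fin n, (u ++ [a, b] ++ v).length = r ∧ w.length = s := fun a b =>
      ⟨by simp; omega, hl.2⟩
    have key : ∀ h2, XRel2 R q n h2 → xW R n u * h2 * xW R n v * xsW R n w.reverse ∈ Ysub R q n r s :=
      fun h2 hh => Submodule.subset_span (Or.inl ⟨u, v, w.reverse, h2, hl.1, by rw [List.length_reverse, hl.2], hh, rfl⟩)
    cases h with
    | @col i j k h =>
      have := key _ (Or.inl ⟨i, j, k, h, rfl⟩)
      simp only [mul_sub, sub_mul, mul_smul_comm, smul_mul_assoc] at this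
      simpa only [mul_sub, sub_mul, mul_smul_comm, smul_mul_assoc, fw_mid, map_sub, map_smul,
        LinearMap.sub_apply, LinearMap.smul_apply, ff_fw, Submodule.coe_sub, Submodule.coe_smul,
        fe_val, if_pos (hl2 _ _), xW_append, xW_two] using this
    | @row k i j h =>
      have := key _ (Or.inr (Or.inl ⟨k, i, j, h, rfl⟩))
      simp only [mul_sub, sub_mul, mul_smul_comm, smul_mul_assoc] at this
      simpa only [mul_sub, sub_mul, mul_smul_comm, smul_mul_assoc, fw_mid, map_sub, map_smul,
        LinearMap.sub_apply, LinearMap.smul_apply, ff_fw, Submodule.coe_sub, Submodule.coe_smul,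
        fe_val, if_pos (hl2 _ _), xW_append, xW_two] using this
    | @comm i j k l h h' =>
      have := key _ (Or.inr (Or.inr (Or.inl ⟨i, j, k, l, h, h', rfl⟩)))
      simp only [mul_sub, sub_mul, mul_smul_comm, smul_mul_assoc] at this
      simpa only [mul_sub, sub_mul, mul_smul_comm, smul_mul_assoc, fw_mid, map_sub, map_smul,
        LinearMap.sub_apply, LinearMap.smul_apply, ff_fw, Submodule.coe_sub, Submodule.coe_smul,
        fe_val, if_pos (hl2 _ _), xW_append, xW_two] using this
    | @qcomm i j k l h h' =>
      have := key _ (Or.inr (Or.inr (Or.inr ⟨i, j, k, l, h, h', rfl⟩)))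
      rw [sub_sub] at this
      simp only [mul_sub, sub_mul, mul_add, add_mul, mul_smul_comm, smul_mul_assoc] at this
      simpa only [mul_sub, sub_mul, mul_add, add_mul, mul_smul_comm, smul_mul_assoc, fw_mid, map_sub, map_smul,
        map_add, LinearMap.add_apply, Submodule.coe_add,
        LinearMap.sub_apply, LinearMap.smul_apply, ff_fw, Submodule.coe_sub, Submodule.coe_smul,
        fe_val, if_pos (hl2 _ _), xW_append, xW_two] using this
  · have hl2 : ∀ a b : Fin n × Fin n, ¬ ((u ++ [a, b] ++ v).length = r ∧ w.length = s) := fun a b hc =>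
      hl ⟨by have := hc.1; simp at this; omega, hc.2⟩
    cases h <;>
    simp only [mul_sub, sub_mul, mul_add, add_mul, mul_smul_comm, smul_mul_assoc, fw_mid, map_sub, map_smul,
        map_add, LinearMap.add_apply, Submodule.coe_add,
        LinearMap.sub_apply, LinearMap.smul_apply, ff_fw, Submodule.coe_sub, Submodule.coe_smul,
        fe_val, if_neg (hl2 _ _), smul_zero, sub_zero, add_zero, zero_mem]

theorem ff_y (r s : ℕ) (u v w : 𝕃 n) (x y) (h : QMRel R q n x y) :
    ((ff R n r s (fw R n w) (fw R n u * (x - y) * fw R n v)) : FA2 R n) ∈ Ysub R q n r s := by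
  by_cases hl : u.length + v.length + 2 = s ∧ w.length = r
  · have hl2 : ∀ a b : Fin n × Fin n, w.length = r ∧ (u ++ [a, b] ++ v).length = s := fun a b =>
      ⟨hl.2, by simp; omega⟩
    have rv : ∀ a b : Fin n × Fin n, (u ++ [a, b] ++ v).reverse = v.reverse ++ [b, a] ++ u.reverse := by
      intro a b; simp
    have key : ∀ h2, XsRel2 R q n h2 → xW R n w * (xsW R n v.reverse * h2 * xsW R n u.reverse) ∈ Ysub R q n r s :=
      fun h2 hh => Submodule.subset_span (Or.inr (Or.inl ⟨w, v.reverse, u.reverse, h2, hl.2,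
        by rw [List.length_reverse, List.length_reverse]; omega, hh, by simp only [mul_assoc]⟩))
    have hq : (q : R) * ((q⁻¹ : Rˣ) : R) = 1 := Units.mul_inv q
    cases h with
    | @col i j k h =>
      have := Submodule.smul_mem _ (𝕟 q R) (key _ (Or.inl ⟨i, j, k, h, rfl⟩))
      simp only [mul_sub, sub_mul, mul_smul_comm, smul_mul_assoc, smul_sub, smul_smul, neg_mul, hq, neg_smul, one_smul, neg_sub_neg] at this
      simpa only [mul_sub, sub_mul, mul_smul_comm, smul_mul_assoc, fw_mid, map_sub, map_smul,
        LinearMap.sub_apply, LinearMap.smul_apply, ff_fw, Submodule.coe_sub, Submodule.coe_smul,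
        fe_val, if_pos (hl2 _ _), rv, xsW_append, xsW_two] using this
    | @row k i j h =>
      have := Submodule.smul_mem _ (𝕟 q R) (key _ (Or.inr (Or.inl ⟨k, i, j, h, rfl⟩)))
      simp only [mul_sub, sub_mul, mul_smul_comm, smul_mul_assoc, smul_sub, smul_smul, neg_mul, hq, neg_smul, one_smul, neg_sub_neg] at this
      simpa only [mul_sub, sub_mul, mul_smul_comm, smul_mul_assoc, fw_mid, map_sub, map_smul,
        LinearMap.sub_apply, LinearMap.smul_apply, ff_fw, Submodule.coe_sub, Submodule.coe_smul,
        fe_val, if_pos (hl2 _ _), rv, xsW_append, xsW_two] using this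
    | @comm i j k l h h' =>
      have := Submodule.neg_mem _ (key _ (Or.inr (Or.inr (Or.inl ⟨i, j, k, l, h, h', rfl⟩))))
      simp only [mul_sub, sub_mul, mul_smul_comm, smul_mul_assoc, neg_sub] at this
      simpa only [mul_sub, sub_mul, mul_smul_comm, smul_mul_assoc, fw_mid, map_sub, map_smul,
        LinearMap.sub_apply, LinearMap.smul_apply, ff_fw, Submodule.coe_sub, Submodule.coe_smul,
        fe_val, if_pos (hl2 _ _), rv, xsW_append, xsW_two] using this
    | @qcomm i j k l h h' =>
      have a1 := key _ (Or.inr (Or.inr (Or.inr ⟨i, j, k, l, h, h', rfl⟩)))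
      have a2 := key _ (Or.inr (Or.inr (Or.inl ⟨i, l, k, j, h, h', rfl⟩)))
      have := Submodule.sub_mem _ (Submodule.smul_mem _ ((q : R) - ((q⁻¹ : Rˣ) : R)) a2) a1
      simp only [mul_sub, sub_mul, mul_add, add_mul, mul_smul_comm, smul_mul_assoc, smul_sub] at this
      simp only [mul_sub, sub_mul, mul_add, add_mul, mul_smul_comm, smul_mul_assoc, fw_mid, map_sub, map_smul,
        map_add, LinearMap.add_apply, Submodule.coe_add,
        LinearMap.sub_apply, LinearMap.smul_apply, ff_fw, Submodule.coe_sub, Submodule.coe_smul,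
        fe_val, if_pos (hl2 _ _), rv, xsW_append, xsW_two]
      convert this using 1
      abel
  · have hl2 : ∀ a b : Fin n × Fin n, ¬ (w.length = r ∧ (u ++ [a, b] ++ v).length = s) := fun a b hc =>
      hl ⟨by have := hc.2; simp at this; omega, hc.1⟩
    cases h <;>
    simp only [mul_sub, sub_mul, mul_add, add_mul, mul_smul_comm, smul_mul_assoc, fw_mid, map_sub, map_smul,
        map_add, LinearMap.add_apply, Submodule.coe_add,
        LinearMap.sub_apply, LinearMap.smul_apply, ff_fw, Submodule.coe_sub, Submodule.coe_smul,
        fe_val, if_neg (hl2 _ _), smul_zero, sub_zero, add_zero, zero_mem]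

theorem mk_fw (u : 𝕃 n) : RingQuot.mkAlgHom R (QMRel R q n) (fw R n u) = Wd (xm R q n) u := by
  rw [fw, map_list_prod, List.map_map, Wd]; rfl

theorem exists_theta (q : Rˣ) (n r s : ℕ) : ∃ Θ : BB R q n →ₗ[R] AqMixed R q n r s,
    ∀ u w, Θ (Wd (xm R q n) u ⊗ₜ Wd (xm R q n) w) = mkY R q n r s (fe R n r s u w) := by
  obtain ⟨g1, hg1⟩ := desc (q := q) ((ff R n r s).compr₂ (mkY R q n r s)) (fun u v x y h =>
    fa_ext fun w => mkY_zero _ (ff_x r s u v w x y h))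
  obtain ⟨g2, hg2⟩ := desc (q := q) g1.flip (fun u v x y h => by
    ext1 a
    obtain ⟨a, rfl⟩ := RingQuot.mkAlgHom_surjective R (QMRel R q n) a
    rw [LinearMap.flip_apply, hg1, LinearMap.zero_apply]
    refine LinearMap.congr_fun (f := ((ff R n r s).compr₂ (mkY R q n r s)).flip _) (g := 0) (fa_ext fun w => ?_) a
    exact mkY_zero _ (ff_y r s u v w x y h))
  refine ⟨TensorProduct.lift g2.flip, fun u w => ?_⟩
  rw [TensorProduct.lift.tmul, LinearMap.flip_apply, ← mk_fw, ← mk_fw, hg2, LinearMap.flip_apply, hg1,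
    LinearMap.compr₂_apply, ff_fw]

end twenty
section twentyone
variable {R : Type*} [CommRing R] {n : ℕ} {q : Rˣ}
open MulOpposite TensorProduct

theorem aq_ext {M : Type*} [AddCommGroup M] [Module R M] {f g : AqAlg R q n →ₗ[R] M}
    (h : ∀ l, f (Wd (xm R q n) l) = g (Wd (xm R q n) l)) (a : AqAlg R q n) : f a = g a := by
  obtain ⟨a, rfl⟩ := RingQuot.mkAlgHom_surjective R (QMRel R q n) a
  have : f ∘ₗ (RingQuot.mkAlgHom R (QMRel R q n)).toLinearMap =
      g ∘ₗ (RingQuot.mkAlgHom R (QMRel R q n)).toLinearMap := fa_ext fun l => by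
    have := h l
    rw [← mk_fw] at this
    exact this
  exact LinearMap.congr_fun this a

theorem bb_ext {M : Type*} [AddCommGroup M] [Module R M] {f : BB R q n →ₗ[R] M}
    (h : ∀ u w, f (Wd (xm R q n) u ⊗ₜ Wd (xm R q n) w) = 0) (a : BB R q n) : f a = 0 := by
  have : f = 0 := by
    refine TensorProduct.ext' fun a b => ?_
    refine aq_ext (f := (TensorProduct.mk R _ _).compr₂ f |>.flip b) (g := 0) (fun u => ?_) a
    refine aq_ext (f := (TensorProduct.mk R _ _).compr₂ f (Wd (xm R q n) u)) (g := 0) (fun w => ?_) b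
    exact h u w
  rw [this]; rfl

theorem fe_one (r s : ℕ) (u w : 𝕃 n) (i j k l : Fin n)
    (h : u.length + 1 = r ∧ w.length + 1 = s) :
    (fe R n r s (u ++ [(i, j)]) (w ++ [(k, l)]) : FA2 R n) =
      xW R n u * Xg R n i j * xW R n [] * xsW R n [] * Xs R n k l * xsW R n w.reverse := by
  rw [fe_val, if_pos (by simpa using h), xW_append, xW_one, List.reverse_append, List.reverse_singleton, xsW_append, xsW_one]
  simp only [xW, xsW, List.map_nil, List.prod_nil, mul_one, mul_assoc]

theorem fe_two (r s : ℕ) (u w : 𝕃 n) (i j k l : Fin n)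
    (h : ¬ (u.length + 1 = r ∧ w.length + 1 = s)) :
    fe R n r s (u ++ [(i, j)]) (w ++ [(k, l)]) = 0 := by
  unfold fe
  exact dif_neg (by simpa using h)

theorem theta_Zq (r s : ℕ) (Θ : BB R q n →ₗ[R] AqMixed R q n r s)
    (h : ∀ u w, Θ (Wd (xm R q n) u ⊗ₜ Wd (xm R q n) w) = mkY R q n r s (fe R n r s u w))
    (z : BB R q n) (hz : z ∈ Zq q (bx R q n) (bY R q n)) : Θ z = 0 := by
  have h1 : ∀ u w i j k l, Θ (Wd (xm R q n) u ⊗ₜ Wd (xm R q n) w * (bx R q n i j * bY R q n k l)) =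
      mkY R q n r s (fe R n r s (u ++ [(i, j)]) (w ++ [(k, l)])) := by
    intro u w i j k l
    rw [bx_mul_bY, Algebra.TensorProduct.tmul_mul_tmul, ← h, Wd_append, Wd_append]
    simp [Wd]
  have t1 : ∀ u w i j, Θ (Wd (xm R q n) u ⊗ₜ Wd (xm R q n) w * T1 (bx R q n) (bY R q n) i j) =
      mkY R q n r s (∑ k, fe R n r s (u ++ [(i, k)]) (w ++ [(j, k)])) := by
    intro u w i j
    rw [T1, mul_sum, map_sum, map_sum]
    exact sum_congr rfl fun k _ => h1 u w i k j k
  have t2 : ∀ u w i j, Θ (Wd (xm R q n) u ⊗ₜ Wd (xm R q n) w * T2 q (bx R q n) (bY R q n) i j) =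
      mkY R q n r s (∑ k : Fin n, ((q ^ (2 * k.1) : Rˣ) : R) • fe R n r s (u ++ [(k, i)]) (w ++ [(k, j)])) := by
    intro u w i j
    rw [T2, mul_sum, map_sum, map_sum]
    refine sum_congr rfl fun k _ => ?_
    rw [mul_smul_comm, map_smul, map_smul]
    exact congrArg _ (h1 u w k i k j)
  have : Zq q (bx R q n) (bY R q n) ≤ LinearMap.ker Θ := by
    rw [Zq, Submodule.span_le]
    rintro _ ⟨a, g, hg, rfl⟩
    rw [SetLike.mem_coe, LinearMap.mem_ker]
    refine bb_ext (f := Θ ∘ₗ LinearMap.mulRight R g) (fun u w => ?_) a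
    rw [LinearMap.comp_apply, LinearMap.mulRight_apply]
    by_cases hl : u.length + 1 = r ∧ w.length + 1 = s
    · have hl1 : u.length + ([] : 𝕃 n).length + 1 = r := by simpa using hl.1
      have hl2 : ([] : 𝕃 n).length + w.reverse.length + 1 = s := by
        simpa using hl.2
      cases hg with
      | g1 i j hij =>
        rw [t1]
        refine mkY_zero _ ?_
        rw [Submodule.coe_sum]
        simp only [fe_one r s u w _ _ _ _ hl]
        exact Submodule.subset_span (Or.inr (Or.inr (Or.inl ⟨i, j, u, [], [], w.reverse, hij, hl1, hl2, rfl⟩)))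
      | g2 i j hij =>
        rw [t2]
        refine mkY_zero _ ?_
        rw [Submodule.coe_sum]
        simp only [Submodule.coe_smul, fe_one r s u w _ _ _ _ hl]
        have := Submodule.smul_mem (Ysub R q n r s) (((q ^ 2)⁻¹ : Rˣ) : R) (Submodule.subset_span
          (Or.inr (Or.inr (Or.inr (Or.inl ⟨i, j, u, [], [], w.reverse, hij, hl1, hl2, rfl⟩)))))
        rw [smul_sum] at this
        convert this using 2 with k _
        rw [smul_smul, ← Units.val_mul]
        congr 2
        rw [mul_add, pow_add, mul_one, mul_comm (q ^ (2 * k.1)), inv_mul_cancel_left]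
      | g3 i j =>
        refine (congrArg Θ (mul_sub _ _ _)).trans ?_
        rw [map_sub, t1, cT, mul_smul_comm, map_smul, t2, ← map_smul, ← map_sub]
        refine mkY_zero _ ?_
        rw [Submodule.coe_sub, Submodule.coe_smul, Submodule.coe_sum, Submodule.coe_sum]
        simp only [Submodule.coe_smul, fe_one r s u w _ _ _ _ hl]
        have := Submodule.subset_span (R := R) (s := Ygen R q n r s)
          (Or.inr (Or.inr (Or.inr (Or.inr ⟨i, j, u, [], [], w.reverse, hl1, hl2, rfl⟩))))
        refine (congrArg (· ∈ Ysub R q n r s) (congrArg (· - _) ?_)).mpr this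
        rw [smul_sum]
        refine sum_congr rfl fun k _ => ?_
        rw [smul_smul, ← Units.val_mul]
        congr 2
        rw [zpow_sub, mul_comm]
        norm_cast
    · cases hg with
      | g1 i j hij =>
        rw [t1]; simp only [fe_two r s u w _ _ _ _ hl, sum_const_zero, map_zero]
      | g2 i j hij =>
        rw [t2]; simp only [fe_two r s u w _ _ _ _ hl, smul_zero, sum_const_zero, map_zero]
      | g3 i j =>
        refine (congrArg Θ (mul_sub _ _ _)).trans ?_
        rw [map_sub, t1, cT, mul_smul_comm, map_smul, t2]
        simp only [fe_two r s u w _ _ _ _ hl, smul_zero, sum_const_zero, map_zero, sub_zero]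
  exact this hz

theorem exists_phi (q : Rˣ) (n r s : ℕ) : ∃ φ : AqAlg R q n →ₗ[R] AqMixed R q n r s,
    ∀ u w : 𝕃 n, u.length = r → w.length = s →
      φ (iotaHat R q n (xW R n u * xsW R n w)) = mkY R q n r s (fe R n r s u w.reverse) := by
  rcases Nat.eq_zero_or_pos n with rfl | hn
  · let e : AqAlg R q 0 →ₐ[R] R := liftA (X := (0 : Matrix (Fin 0) (Fin 0) R)) (q := q)
      (by constructor <;> intro i <;> exact i.elim0)
    refine ⟨(LinearMap.toSpanSingleton R _ (mkY R q 0 r s (fe R 0 r s [] []))) ∘ₗ e.toLinearMap, fun u w _ _ => ?_⟩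
    obtain rfl : u = [] := Subsingleton.elim _ _
    obtain rfl : w = [] := Subsingleton.elim _ _
    simp [xW, xsW]
  · obtain ⟨Θ, h⟩ := exists_theta (R := R) q n r s
    obtain ⟨φ, hφ⟩ := main_exp q (⟨0, hn⟩ : Fin n) rfl r s Θ (theta_Zq r s Θ h)
    refine ⟨φ ∘ₗ LinearMap.applyₗ (Finsupp.single 0 1) ∘ₗ (ps R q n).toLinearMap, fun u w hu hw => ?_⟩
    have := hφ u w.reverse hu (by simpa using hw)
    rw [← h]
    refine Eq.trans ?_ (this.trans ?_)
    · rw [LinearMap.comp_apply, LinearMap.comp_apply, AlgHom.toLinearMap_apply, ps_word]; rfl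
    · rw [← Wd_map (xm R q n) (bx R q n) Algebra.TensorProduct.includeLeft (fun _ _ => rfl),
        ← Wd_map (xm R q n) (bY R q n) Algebra.TensorProduct.includeRight (fun _ _ => rfl),
        Algebra.TensorProduct.includeLeft_apply, Algebra.TensorProduct.includeRight_apply,
        Algebra.TensorProduct.tmul_mul_tmul, one_mul, mul_one]

theorem exists_phi2 (q : Rˣ) (n r s : ℕ) : ∃ φ : AqAlg R q n →ₗ[R] AqMixed R q n r s,
    ∀ (x : FA2 R n) (hx : x ∈ Frs R n r s), φ (iotaHat R q n x) = mkY R q n r s ⟨x, hx⟩ := by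
  obtain ⟨φ, h⟩ := exists_phi (R := R) q n r s
  refine ⟨φ, fun x hx => ?_⟩
  induction hx using Submodule.span_induction with
  | mem x hx =>
    obtain ⟨u, w, hu, hw, rfl⟩ := hx
    rw [h u w hu hw]
    congr 1
    ext1
    rw [fe_val, if_pos ⟨hu, by simpa using hw⟩, List.reverse_reverse]
  | zero => rw [map_zero, map_zero]; exact (map_zero _).symm
  | add x y hx hy ihx ihy => rw [map_add, map_add, ihx, ihy, ← map_add]; rfl
  | smul c x hx ih => rw [map_smul, map_smul, ih, ← map_smul]; rfl

end twentyone
end QM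

/-- the induced map `ι : A_q(n;r,s) → A_q(n, r+(n−1)s)` admits an
`R`-linear left inverse `φ` (so `ι` is a split injection of `R`-modules), and
consequently the dual map `ι*` admits an `R`-linear right inverse `Ψ`
(so `ι*` is a split surjection of `R`-modules). -/
theorem stmt19 (R : Type*) [CommRing R] (q : Rˣ) (n r s : ℕ) :
    (∃ φ : ↥(AqDeg R q n (r + (n - 1) * s)) →ₗ[R] AqMixed R q n r s,
      ∀ (x : FA2 R n) (hx : x ∈ Frs R n r s)
        (hy : iotaHat R q n x ∈ AqDeg R q n (r + (n - 1) * s)),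
        φ ⟨iotaHat R q n x, hy⟩ = Submodule.Quotient.mk ⟨x, hx⟩) ∧
    (∃ Ψ : Module.Dual R (AqMixed R q n r s) →ₗ[R]
        Module.Dual R ↥(AqDeg R q n (r + (n - 1) * s)),
      ∀ (g : Module.Dual R (AqMixed R q n r s)) (x : FA2 R n) (hx : x ∈ Frs R n r s)
        (hy : iotaHat R q n x ∈ AqDeg R q n (r + (n - 1) * s)),
        Ψ g ⟨iotaHat R q n x, hy⟩ = g (Submodule.Quotient.mk ⟨x, hx⟩)) := by
  obtain ⟨φ, h⟩ := QM.exists_phi2 (R := R) q n r s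
  refine ⟨⟨φ ∘ₗ (AqDeg R q n (r + (n - 1) * s)).subtype, fun x hx hy => h x hx⟩,
    ⟨LinearMap.dualMap (φ ∘ₗ (AqDeg R q n (r + (n - 1) * s)).subtype), fun g x hx hy => ?_⟩⟩
  exact congrArg g (h x hx)
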